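/- Existence of periodic points of the renormalization operator, in concrete form: for every integer p ≥ 2 there exist a real number λ with 0 < |λ| < 1, radii r > r' > 0, and a complex analytic function f on the disk D_r = {z ∈ ℂ : |z| < r} such that: f commutes with complex conjugation (f(z̄) = conj(f(z)), so f is real on ℝ); f is normalized as f(z) = f(0) + z² + O(z³) (that is, f′(0) = 0 and f″(0) = 2); for every z ∈ D_{r'} the points λz, f(λz), …, f^{p−1}(λz) lie in D_r and the p-th iterate satisfies the fixed-point equation f^{∘p}(λz) = λ·f(z); and moreover there is a nondegenerate closed interval J ⊆ D_r ∩ ℝ containing 0 in its interior such that f^{∘p}(J) ⊆ J and the intervals J, f(J), …, f^{p−1}(J) are contained in D_r ∩ ℝ and have pairwise disjoint interiors. -/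

import Mathlib

section
open Metric
namespace RN

/-- scale -/
def K : ℤ := 1099511627776
lemma K_pos : (0:ℝ) < (K:ℝ) := by norm_num [K]
lemma K_pos' : (0:ℤ) < K := by norm_num [K]

def fN {α : Sort _} (n : ℕ) (k : ℕ → α) : α := match n with
  | 0 => k 0
  | m+1 => k (m+1)
def fI {α : Sort _} (z : ℤ) (k : ℤ → α) : α := match z with
  | .ofNat n => fN n (fun n => k (.ofNat n))
  | .negSucc n => fN n (fun n => k (.negSucc n))
@[simp] lemma fN_eq {α : Sort _} (n : ℕ) (k : ℕ → α) : fN n k = k n := by cases n <;> rfl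
@[simp] lemma fI_eq {α : Sort _} (n : ℤ) (k : ℤ → α) : fI n k = k n := by cases n <;> simp [fI]

inductive D where
  | bad : D
  | mk (a b r : ℤ) : D

def D.bd {α : Sort _} (X : D) (k : D → α) : α := match X with
  | .bad => k .bad
  | .mk a b r => k (.mk a b r)
@[simp] lemma D.bd_eq {α : Sort _} (X : D) (k : D → α) : X.bd k = k X := by cases X <;> rfl

def mk' (a b r : ℤ) : D := fI a fun a => fI b fun b => fI r fun r => D.mk a b r
@[simp] lemma mk'_eq (a b r : ℤ) : mk' a b r = D.mk a b r := by simp [mk']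

def D.mem (X : D) (z : ℂ) : Prop := match X with
  | .bad => True
  | .mk a b r => ‖(K:ℂ) * z - ((a:ℂ) + b * Complex.I)‖ ≤ r

/-- Newton iteration for integer square roots -/
def nwt (N : ℤ) : ℕ → ℤ → ℤ
  | 0, x => x
  | n+1, x => fI ((x + N / x) / 2) fun x => nwt N n x
/-- square root guess -/
def gs (N m : ℕ) : ℕ := fN m fun m => fN ((m + N/m)/2) fun m => fN ((m + N/m)/2) fun m => fN ((m + N/m)/2) fun m => m
def nuN (a b : ℕ) : ℕ :=
  fN (a*a+b*b) fun N => fN (gs N (bif Nat.ble a b then b + a/2 else a + b/2) + 1) fun c =>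
    bif Nat.ble N (c*c) then c else a+b
def nlN (a b : ℕ) : ℕ :=
  fN (a*a+b*b) fun N => fN (gs N (bif Nat.ble a b then b + a/2 else a + b/2)) fun c => fN (N/(c+1)) fun c =>
    bif Nat.ble (c*c) N then c else 0
/-- upper bound of norm -/
def nu (a b : ℤ) : ℤ := .ofNat (nuN a.natAbs b.natAbs)
def nl (a b : ℤ) : ℤ := .ofNat (nlN a.natAbs b.natAbs)

lemma normsq_int (a b : ℤ) : ‖((a:ℂ) + b * Complex.I)‖^2 = ((a.natAbs*a.natAbs+b.natAbs*b.natAbs : ℕ):ℝ) := by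
  rw [← Complex.normSq_eq_norm_sq, Complex.normSq_apply]; simp [Nat.cast_natAbs]

lemma nu_spec (a b : ℤ) : ‖((a:ℂ) + b * Complex.I)‖ ≤ (nu a b : ℝ) := by
  have h1 := normsq_int a b
  rw [nu]; simp only [nuN, fN_eq, Int.ofNat_eq_natCast, Int.cast_natCast]
  set c := gs _ _ + 1
  cases h : Nat.ble (a.natAbs*a.natAbs+b.natAbs*b.natAbs) (c*c)
  · simp only [cond_false]
    refine (norm_add_le _ _).trans ?_
    rw [norm_mul, Complex.norm_I, mul_one]
    simp [Nat.cast_natAbs]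
  · simp only [cond_true]
    have h2 : ((a.natAbs*a.natAbs+b.natAbs*b.natAbs : ℕ):ℝ) ≤ (c:ℝ)^2 := by
      have := Nat.le_of_ble_eq_true h; rw [pow_two]; exact_mod_cast this
    rw [← h1] at h2
    exact abs_le_of_sq_le_sq' h2 (by positivity) |>.2
lemma nl_spec (a b : ℤ) : (nl a b : ℝ) ≤ ‖((a:ℂ) + b * Complex.I)‖ := by
  have h1 := normsq_int a b
  rw [nl]; simp only [nlN, fN_eq, Int.ofNat_eq_natCast, Int.cast_natCast]
  set c := _ / (gs _ _ + 1)
  cases h : Nat.ble (c*c) (a.natAbs*a.natAbs+b.natAbs*b.natAbs) 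
  · simp
  · simp only [cond_true]
    have h2 : (c:ℝ)^2 ≤ ((a.natAbs*a.natAbs+b.natAbs*b.natAbs : ℕ):ℝ) := by
      have := Nat.le_of_ble_eq_true h; rw [pow_two]; exact_mod_cast this
    rw [← h1] at h2
    exact abs_le_of_sq_le_sq' h2 (norm_nonneg _) |>.2
lemma nl_nonneg (a b : ℤ) : 0 ≤ nl a b := Int.natCast_nonneg _

lemma normsq_int' (a b : ℤ) : ‖((a:ℂ) + b * Complex.I)‖^2 = ((a*a+b*b : ℤ):ℝ) := by
  rw [← Complex.normSq_eq_norm_sq, Complex.normSq_apply]; simp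
lemma ediv_err (a b : ℤ) (hb : 0 < b) : |(a:ℝ)/b - ((a / b : ℤ):ℝ)| ≤ 1 := by
  have h1 := Int.emod_nonneg a hb.ne'
  have h2 := Int.emod_lt_of_pos a hb
  have h3 := Int.emod_add_mul_ediv a b
  have hb' : (0:ℝ) < b := by exact_mod_cast hb
  have e : (a:ℝ)/b - ((a / b : ℤ):ℝ) = ((a % b : ℤ):ℝ) / b := by
    rw [div_sub' hb'.ne']; congr 1
    have : (a:ℝ) = ((a % b : ℤ):ℝ) + b * ((a/b : ℤ):ℝ) := by exact_mod_cast h3.symm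
    linarith
  rw [e, abs_of_nonneg (by positivity), div_le_one hb']
  exact_mod_cast h2.le
lemma ediv_ub (a b : ℤ) (hb : 0 < b) : (a:ℝ)/b ≤ ((a / b + 1 : ℤ):ℝ) := by
  have := (abs_le.1 (ediv_err a b hb)).2
  push_cast; linarith

lemma round_err (p q b : ℤ) (hb : 0 < b) :
    ‖((p:ℂ) + q * Complex.I) / b - (((p / b : ℤ):ℂ) + ((q / b : ℤ):ℂ) * Complex.I)‖ ≤ 2 := by
  have e : ((p:ℂ) + q * Complex.I) / b - (((p / b : ℤ):ℂ) + ((q / b : ℤ):ℂ) * Complex.I)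
      = (((p:ℝ)/b - ((p / b : ℤ):ℝ) : ℝ) : ℂ) + (((q:ℝ)/b - ((q / b : ℤ):ℝ) : ℝ) : ℂ) * Complex.I := by
    push_cast; ring
  rw [e]
  refine (norm_add_le _ _).trans ?_
  rw [norm_mul, Complex.norm_I, mul_one, Complex.norm_real, Complex.norm_real]
  have := ediv_err p b hb
  have := ediv_err q b hb
  simp only [Real.norm_eq_abs]; linarith

def D.add (X Y : D) : D := match X, Y with
  | .mk a b r, .mk c d s => mk' (a+c) (b+d) (r+s)
  | _, _ => .bad
def D.sub (X Y : D) : D := match X, Y with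
  | .mk a b r, .mk c d s => mk' (a-c) (b-d) (r+s)
  | _, _ => .bad
def D.mul (X Y : D) : D := match X, Y with
  | .mk a b r, .mk c d s =>
    mk' (Int.ediv (Int.sub (Int.mul a c) (Int.mul b d)) K) (Int.ediv (Int.add (Int.mul a d) (Int.mul b c)) K)
      (Int.add (Int.ediv (Int.add (Int.add (Int.mul (nu a b) s) (Int.mul (nu c d) r)) (Int.mul r s)) K) 3)
  | _, _ => .bad
lemma D.mul_mk (a b r c d s : ℤ) : D.mul (.mk a b r) (.mk c d s) =
    .mk ((a*c-b*d)/K) ((a*d+b*c)/K) ((nu a b * s + nu c d * r + r*s)/K + 3) := by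
  simp only [D.mul, mk'_eq]; rfl
def D.inv (X : D) : D := match X with
  | .mk a b r => fI (a*a+b*b-r*r) fun M =>
    if 0 < M then mk' (a*(K*K)/M) (-b*(K*K)/M) (r*(K*K)/M+3) else .bad
  | .bad => .bad
def D.of (n : ℤ) : D := .mk n 0 0
def D.neg (X : D) : D := match X with
  | .mk a b r => mk' (-a) (-b) r
  | .bad => .bad
/-- enlarge by an error radius -/
def D.err (X : D) (s : ℤ) : D := match X with
  | .mk a b r => mk' a b (r+s)
  | .bad => .bad

lemma mem_add {X Y : D} {x y : ℂ} (hx : X.mem x) (hy : Y.mem y) : (X.add Y).mem (x+y) := by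
  cases X <;> cases Y <;> simp only [D.add, D.mem, mk'_eq] at *
  push_cast
  refine le_trans ?_ (add_le_add hx hy)
  refine le_trans (le_of_eq ?_) (norm_add_le _ _)
  congr 1; ring
lemma mem_sub {X Y : D} {x y : ℂ} (hx : X.mem x) (hy : Y.mem y) : (X.sub Y).mem (x-y) := by
  cases X <;> cases Y <;> simp only [D.sub, D.mem, mk'_eq] at *
  push_cast
  refine le_trans ?_ (add_le_add hx hy)
  refine le_trans (le_of_eq ?_) (norm_sub_le _ _)
  congr 1; ring
lemma mem_neg {X : D} {x : ℂ} (hx : X.mem x) : (X.neg).mem (-x) := by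
  cases X <;> simp only [D.neg, D.mem, mk'_eq] at *
  refine le_trans (le_of_eq ?_) hx
  rw [← norm_neg]
  congr 1; push_cast; ring
lemma mem_err {X : D} {x y : ℂ} {s : ℤ} (hx : X.mem x) (hy : (K:ℝ) * ‖y - x‖ ≤ s) : (X.err s).mem y := by
  cases X <;> simp only [D.err, D.mem, mk'_eq] at *
  push_cast
  refine le_trans ?_ (add_le_add hx hy)
  have : (K:ℝ) * ‖y - x‖ = ‖(K:ℂ) * (y-x)‖ := by
    rw [norm_mul, Complex.norm_intCast, abs_of_pos K_pos]
  rw [this]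
  refine le_trans (le_of_eq ?_) (norm_add_le _ _)
  congr 1; ring
lemma mem_of (n : ℤ) {x : ℂ} (h : (K:ℂ) * x = n) : (D.of n).mem x := by
  simp [D.of, D.mem, h]
lemma mem_mul {X Y : D} {x y : ℂ} (hx : X.mem x) (hy : Y.mem y) : (X.mul Y).mem (x*y) := by
  cases X with
  | bad => cases Y <;> simp [D.mul, D.mem]
  | mk a b r =>
  cases Y with
  | bad => simp [D.mul, D.mem]
  | mk c d s =>
  simp only [D.mul_mk, D.mem] at *
  have hK : (K:ℂ) ≠ 0 := by exact_mod_cast K_pos'.ne'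
  have h1 := round_err (a*c-b*d) (a*d+b*c) K K_pos'
  have h2 := ediv_ub (nu a b * s + nu c d * r + r*s) K K_pos'
  have h3 := nu_spec a b
  have h4 := nu_spec c d
  set C1 := (a:ℂ) + b * Complex.I
  set C2 := (c:ℂ) + d * Complex.I
  have e : ((a*c-b*d : ℤ):ℂ) + ((a*d+b*c : ℤ):ℂ) * Complex.I = C1 * C2 := by
    simp only [C1, C2]; push_cast
    linear_combination (- (b:ℂ) * d) * Complex.I_mul_I
  rw [e] at h1
  have h5 : ‖(K:ℂ) * (x*y) - C1*C2/K‖ ≤ (nu a b * s + nu c d * r + r*s : ℝ)/K := by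
    rw [le_div_iff₀ K_pos]
    have : ‖(K:ℂ) * (x*y) - C1*C2/K‖ * K = ‖C1 * (K*y-C2) + C2 * (K*x - C1) + (K*x-C1)*(K*y-C2)‖ := by
      have : (K:ℝ) = ‖(K:ℂ)‖ := by rw [Complex.norm_intCast, abs_of_pos K_pos]
      rw [this, ← norm_mul]; congr 1; field_simp; ring
    rw [this]
    have r0 : (0:ℝ) ≤ r := (norm_nonneg _).trans hx
    have s0 : (0:ℝ) ≤ s := (norm_nonneg _).trans hy
    refine (norm_add₃_le).trans ?_
    simp only [norm_mul]
    have := mul_le_mul h3 hy (norm_nonneg _) ((norm_nonneg _).trans h3)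
    have := mul_le_mul h4 hx (norm_nonneg _) ((norm_nonneg _).trans h4)
    have := mul_le_mul hx hy (norm_nonneg _) r0
    linarith
  push_cast at h2 ⊢
  have := norm_sub_le_norm_sub_add_norm_sub ((K:ℂ) * (x*y)) (C1*C2/K) (((a*c-b*d)/K : ℤ) + (((a*d+b*c)/K : ℤ):ℂ) * Complex.I)
  linarith

lemma mem_inv {X : D} {x : ℂ} (hx : X.mem x) : (X.inv).mem (x⁻¹) := by
  cases X with
  | bad => simp [D.inv, D.mem]
  | mk a b r =>
  simp only [D.inv, D.mem, mk'_eq, fI_eq] at *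
  split_ifs with hM
  swap
  · trivial
  simp only
  set M := a*a+b*b-r*r with hMd
  have hK : (K:ℂ) ≠ 0 := by exact_mod_cast K_pos'.ne'
  have hKn : ‖(K:ℂ)‖ = (K:ℝ) := by rw [Complex.norm_intCast, abs_of_pos K_pos]
  have hM' : (0:ℝ) < M := by exact_mod_cast hM
  have hMc : (M:ℂ) ≠ 0 := by exact_mod_cast hM.ne'
  have h1 := round_err (a*(K*K)) (-b*(K*K)) M hM
  have h2 := ediv_ub (r*(K*K)) M hM
  have r0 : (0:ℝ) ≤ r := (norm_nonneg _).trans hx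
  set z := (K:ℂ)*x with hz
  have hsq : Complex.normSq (z - ((a:ℂ) + b * Complex.I)) ≤ (r:ℝ)^2 := by
    rw [Complex.normSq_eq_norm_sq]; gcongr
  have hz0 : z ≠ 0 := by
    intro h0
    rw [h0, zero_sub, Complex.normSq_neg, Complex.normSq_eq_norm_sq, normsq_int'] at hsq
    have : ((M:ℤ):ℝ) = ((a*a+b*b:ℤ):ℝ) - r^2 := by rw [hMd]; push_cast; ring
    linarith
  have key : ‖(M:ℂ) - ((a:ℂ) - b * Complex.I) * z‖ ≤ r * ‖z‖ := by
    refine abs_le_of_sq_le_sq' ?_ (by positivity) |>.2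
    rw [mul_pow, ← Complex.normSq_eq_norm_sq, ← Complex.normSq_eq_norm_sq]
    simp only [Complex.normSq_apply] at hsq ⊢
    simp at hsq ⊢
    have eM : (M:ℝ) = a*a+b*b-r*r := by rw [hMd]; push_cast; ring
    set u := z.re; set v := z.im
    have : (M:ℝ) * ((u-a)*(u-a)+(v-b)*(v-b) - r^2) ≤ 0 :=
      mul_nonpos_of_nonneg_of_nonpos hM'.le (by linarith)
    rw [eM] at this ⊢
    nlinarith [this]
  have e : (K:ℂ) * x⁻¹ - (((a*(K*K):ℤ):ℂ) + ((-b*(K*K) : ℤ):ℂ) * Complex.I)/M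
     = (K*K/(M * z)) * ((M:ℂ) - ((a:ℂ) - b * Complex.I) * z) := by
    have hx0 : x ≠ 0 := by rintro rfl; simp [hz] at hz0
    rw [hz]; push_cast; field_simp; ring
  have h3 : ‖(K:ℂ) * x⁻¹ - (((a*(K*K):ℤ):ℂ) + ((-b*(K*K) : ℤ):ℂ) * Complex.I)/M‖ ≤ (r*(K*K):ℝ)/M := by
    rw [e, norm_mul, norm_div, norm_mul, norm_mul, hKn, Complex.norm_intCast, abs_of_pos hM']
    have hzn : 0 < ‖z‖ := norm_pos_iff.2 hz0
    have hk := K_pos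
    calc _ ≤ (K*K:ℝ)/(M*‖z‖) * (r * ‖z‖) := by
            apply mul_le_mul_of_nonneg_left key; positivity
      _ = _ := by field_simp
  push_cast at h2 ⊢
  have := norm_sub_le_norm_sub_add_norm_sub ((K:ℂ) * x⁻¹) ((((a*(K*K):ℤ):ℂ) + ((-b*(K*K) : ℤ):ℂ) * Complex.I)/M) (((a*(K*K)/M : ℤ):ℂ) + ((-b*(K*K)/M : ℤ):ℂ) * Complex.I)
  linarith

/-- square root with nonnegative real part -/
noncomputable def csq (z : ℂ) : ℂ := if 0 < z.re then Complex.exp (Complex.log z / 2) else 1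
lemma csq_eq {z : ℂ} (hz : 0 < z.re) : csq z = Complex.exp (Complex.log z / 2) := if_pos hz
lemma csq_sq {z : ℂ} (hz : 0 < z.re) : csq z ^ 2 = z := by
  rw [csq_eq hz, ← Complex.exp_nat_mul]
  push_cast
  rw [mul_div_cancel₀ _ (two_ne_zero), Complex.exp_log (by rintro rfl; simp at hz)]
lemma csq_ne (z : ℂ) : csq z ≠ 0 := by
  unfold csq; split_ifs
  · exact Complex.exp_ne_zero _
  · simp
lemma csq_one : csq 1 = 1 := by simp [csq]
lemma csq_conj (z : ℂ) : csq (starRingEnd ℂ z) = starRingEnd ℂ (csq z) := by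
  unfold csq
  rw [Complex.conj_re]
  split_ifs with h
  · rw [Complex.log_conj _ (fun h' => by
      have := Complex.abs_arg_lt_pi_div_two_iff.2 (Or.inl h)
      rw [h', abs_of_pos Real.pi_pos] at this; linarith [Real.pi_pos]), ← Complex.exp_conj, map_div₀, map_ofNat]
  · rw [map_one]
lemma csq_re {z : ℂ} (hz : 0 < z.re) : 0 < (csq z).re := by
  rw [csq_eq hz, Complex.exp_re]
  apply mul_pos (Real.exp_pos _)
  have h : (Complex.log z / 2).im = z.arg / 2 := by
    rw [← Complex.log_im]; simp
  rw [h]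
  have := Complex.abs_arg_lt_pi_div_two_iff.2 (Or.inl hz)
  rw [abs_lt] at this
  apply Real.cos_pos_of_mem_Ioo
  constructor <;> linarith [Real.pi_pos]
lemma csq_im {z : ℂ} (hz : 0 < z.re) : |(csq z).im| ≤ (csq z).re := by
  have h := csq_sq hz
  have h1 := csq_re hz
  have h2 : z.re = (csq z).re^2 - (csq z).im^2 := by
    conv_lhs => rw [← h]
    rw [pow_two, Complex.mul_re]; ring
  apply abs_le_of_sq_le_sq _ h1.le
  linarith

/-- real part positivity check -/
def D.pos (X : D) : Bool := match X with
  | .mk a _ r => decide (r < a)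
  | .bad => false
lemma pos_spec {X : D} (h : X.pos = true) {x : ℂ} (hx : X.mem x) : 0 < x.re := by
  cases X with
  | bad => simp [D.pos] at h
  | mk a b r =>
  simp only [D.pos, decide_eq_true_eq, D.mem] at h hx
  have h1 := (Complex.abs_re_le_norm _).trans hx
  simp at h1
  rw [abs_le] at h1
  have : (r:ℝ) < a := by exact_mod_cast h
  have h2 : 0 < (K:ℝ) * x.re := by linarith
  exact (pos_iff_pos_of_mul_pos h2).1 K_pos

def D.sqrt (X : D) : D := match X with
  | .mk a b r =>
    fI (nu a b) fun n => fI ((n+a)/2*K) fun N => fI (nwt N 6 ((n+K)/2)) fun wr =>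
    fI (b*K/(2*wr)) fun wi =>
    fI (nu (a*K-(wr*wr-wi*wi)) (b*K-2*wr*wi) + r*K) fun e =>
    fI (nl wr wi) fun W =>
    fI (e/(2*W)+1) fun p => fI (e/(2*W-p)+1) fun p => fI (e/(2*W-p)+1) fun p =>
    fI (e/(2*W-p)+1) fun o => fI (2*o-p+2) fun p =>
    if r < a ∧ |wi| ≤ wr ∧ e < W*W ∧ 0 ≤ p ∧ p ≤ W ∧ e ≤ p*(2*W-p) then mk' wr wi p else .bad
  | .bad => .bad

lemma sqrt_aux {x : ℂ} {a b r wr wi p e W : ℤ}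
    (he : e = nu (a*K-(wr*wr-wi*wi)) (b*K-2*wr*wi) + r*K) (hW : W = nl wr wi)
    (hx : (D.mk a b r).mem x)
    (h : r < a ∧ |wi| ≤ wr ∧ e < W*W ∧ 0 ≤ p ∧ p ≤ W ∧ e ≤ p*(2*W-p)) :
    (D.mk wr wi p).mem (csq x) := by
  obtain ⟨h1, h2, h3, h4, h5, h6⟩ := h
  have xre : 0 < x.re := pos_spec (X := .mk a b r) (by simpa [D.pos] using h1) hx
  have x0 : x ≠ 0 := by rintro rfl; simp at xre
  simp only [D.mem] at hx ⊢
  have hKn : ‖(K:ℂ)‖ = (K:ℝ) := by rw [Complex.norm_intCast, abs_of_pos K_pos]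
  set s := (K:ℂ) * csq x with hs
  set w := (wr:ℂ) + wi * Complex.I with hw
  have hss : s^2 = K^2 * x := by rw [hs, mul_pow, csq_sq xre]
  have sre : 0 < s.re := by
    rw [hs]; simp only [Complex.mul_re, Complex.intCast_re, Complex.intCast_im, zero_mul, sub_zero]
    exact mul_pos K_pos (csq_re xre)
  have sim : |s.im| ≤ s.re := by
    rw [hs]; simp only [Complex.mul_re, Complex.mul_im, Complex.intCast_re, Complex.intCast_im, zero_mul, sub_zero, add_zero]
    rw [abs_mul, abs_of_pos K_pos]
    exact mul_le_mul_of_nonneg_left (csq_im xre) K_pos.le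
  have A : ‖s^2 - w^2‖ ≤ e := by
    have n1 := nu_spec (a*K-(wr*wr-wi*wi)) (b*K-2*wr*wi)
    have : s^2 - w^2 = K * (K*x - (a + b * Complex.I)) + (((a*K-(wr*wr-wi*wi) : ℤ):ℂ) + ((b*K-2*wr*wi : ℤ):ℂ) * Complex.I) := by
      rw [hss, hw]; push_cast; linear_combination (-(wi:ℂ)^2) * Complex.I_mul_I
    rw [this]
    refine (norm_add_le _ _).trans ?_
    rw [norm_mul, hKn, he]
    push_cast
    have := mul_le_mul_of_nonneg_left hx K_pos.le
    push_cast at n1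
    linarith
  have B : ‖s - w‖ ≤ ‖s + w‖ := by
    refine abs_le_of_sq_le_sq' ?_ (by positivity) |>.2
    rw [← Complex.normSq_eq_norm_sq, ← Complex.normSq_eq_norm_sq]
    simp only [Complex.normSq_apply, hw]
    simp
    have c2 : |(wi:ℝ)| ≤ wr := by exact_mod_cast h2
    have : |s.im * wi| ≤ s.re * wr := by
      rw [abs_mul]; exact mul_le_mul sim c2 (abs_nonneg _) sre.le
    have := (abs_le.1 this).1
    nlinarith
  have W1 : (W:ℝ) ≤ ‖w‖ := by rw [hW]; exact nl_spec _ _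
  have W0 : (0:ℝ) ≤ W := by rw [hW]; exact_mod_cast nl_nonneg _ _
  have C : ‖s-w‖ * ‖s+w‖ ≤ e := by
    rw [← norm_mul]; refine le_trans (le_of_eq ?_) A; congr 1; ring
  have h3' : (e:ℝ) < W*W := by exact_mod_cast h3
  have h5' : (p:ℝ) ≤ W := by exact_mod_cast h5
  have h6' : (e:ℝ) ≤ p*(2*W-p) := by exact_mod_cast h6
  set q := ‖s-w‖
  have q0 : 0 ≤ q := norm_nonneg _
  have E : q < W := by
    by_contra hq; push Not at hq
    nlinarith
  have F : 2*W - q ≤ ‖s+w‖ := by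
    have : ‖(2:ℂ) * w‖ ≤ ‖s+w‖ + ‖s-w‖ := by
      refine le_trans (le_of_eq ?_) (norm_sub_le _ _); congr 1; ring
    rw [norm_mul] at this; simp at this
    linarith
  by_contra hp; push Not at hp
  nlinarith [mul_le_mul_of_nonneg_left F q0]

lemma mem_sqrt {X : D} {x : ℂ} (hx : X.mem x) : (X.sqrt).mem (csq x) := by
  cases X with
  | bad => simp [D.sqrt, D.mem]
  | mk a b r =>
  simp only [D.sqrt, fI_eq, mk'_eq]
  split_ifs with h
  · exact sqrt_aux rfl rfl hx h
  · simp [D.mem]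

/-- magnitude bound (scaled) ; `none`-like huge value avoided by returning in D -/
def D.mag (X : D) : Option ℤ := match X with
  | .mk a b r => fI (nu a b + r) fun c => some c
  | .bad => none
lemma mag_spec {X : D} {c : ℤ} (h : X.mag = some c) {x : ℂ} (hx : X.mem x) : (K:ℝ) * ‖x‖ ≤ c := by
  cases X with
  | bad => simp [D.mag] at h
  | mk a b r =>
  simp only [D.mag, fI_eq, Option.some.injEq, D.mem] at h hx
  have n1 := nu_spec a b
  have : (K:ℝ) * ‖x‖ = ‖(K:ℂ) * x‖ := by
    rw [norm_mul, Complex.norm_intCast, abs_of_pos K_pos]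
  rw [this, ← h]; push_cast
  have := norm_sub_norm_le ((K:ℂ)*x) ((a:ℂ) + b * Complex.I)
  linarith

/-- `X ⊆ closed disc(c, s)` check -/
def D.inn (X : D) (c s : ℤ) : Bool := match X with
  | .mk a b r => decide (nu (a-c) b + r ≤ s)
  | .bad => false
lemma inn_spec {X : D} {c s : ℤ} (h : X.inn c s = true) {x : ℂ} (hx : X.mem x) :
    ‖x - (c:ℂ)/K‖ ≤ (s:ℝ)/K := by
  cases X with
  | bad => simp [D.inn] at h
  | mk a b r =>
  simp only [D.inn, decide_eq_true_eq, D.mem] at h hx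
  have n1 := nu_spec (a-c) b
  have hK : (K:ℂ) ≠ 0 := by exact_mod_cast K_pos'.ne'
  have h' : (nu (a-c) b : ℝ) + r ≤ s := by exact_mod_cast h
  rw [le_div_iff₀ K_pos]
  have : ‖x - (c:ℂ)/K‖ * K = ‖((K:ℂ)*x - (a + b * Complex.I)) + (((a-c:ℤ):ℂ) + b * Complex.I)‖ := by
    have : (K:ℝ) = ‖(K:ℂ)‖ := by rw [Complex.norm_intCast, abs_of_pos K_pos]
    rw [this, ← norm_mul]; congr 1; field_simp; push_cast; ring
  rw [this]
  exact (norm_add_le _ _).trans (by linarith)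

end RN
end

section
open Metric
namespace RN

structure Jet (f : ℂ → ℂ) (x d N S : ℂ) : Prop where
  an : AnalyticAt ℂ f x
  d0 : d ≠ 0
  h1 : deriv f x = d
  h2 : deriv (deriv f) x = N * d
  h3 : deriv (deriv (deriv f)) x = (S + 3/2*N^2) * d

lemma deriv_comp_ev {f g : ℂ → ℂ} {x : ℂ} (hf : AnalyticAt ℂ f x) (hg : AnalyticAt ℂ g (f x)) :
    deriv (fun y => g (f y)) =ᶠ[nhds x] fun y => deriv g (f y) * deriv f y := by
  have h1 := hf.eventually_analyticAt
  have h2 := hf.continuousAt.eventually hg.eventually_analyticAt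
  filter_upwards [h1, h2] with y a b
  exact (b.differentiableAt.hasDerivAt.comp y a.differentiableAt.hasDerivAt).deriv

lemma Jet.comp {f g : ℂ → ℂ} {x d N S d' N' S' : ℂ} (hf : Jet f x d N S) (hg : Jet g (f x) d' N' S') :
    Jet (fun y => g (f y)) x (d' * d) (N + d * N') (S + d^2 * S') := by
  obtain ⟨af, d0, f1, f2, f3⟩ := hf
  obtain ⟨ag, d0', g1, g2, g3⟩ := hg
  have e1 := deriv_comp_ev af ag
  have e1' := deriv_comp_ev af ag.deriv
  have e1'' := deriv_comp_ev af ag.deriv.deriv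
  have e2 : deriv (deriv (fun y => g (f y))) =ᶠ[nhds x]
      fun y => deriv (deriv g) (f y) * deriv f y ^ 2 + deriv g (f y) * deriv (deriv f) y := by
    have h1 := af.eventually_analyticAt
    have h2 := af.continuousAt.eventually ag.eventually_analyticAt
    filter_upwards [e1.deriv, e1', h1, h2] with y a b h1 h2
    rw [a]
    have := ((h2.deriv.comp h1).differentiableAt.hasDerivAt.mul h1.deriv.differentiableAt.hasDerivAt).deriv
    simp only [Function.comp_def] at this
    refine Eq.trans this ?_
    rw [b]; ring
  refine ⟨ag.comp af, mul_ne_zero d0' d0, ?_, ?_, ?_⟩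
  · rw [e1.eq_of_nhds, g1, f1]
  · rw [e2.eq_of_nhds, g1, f1, g2, f2]; ring
  · rw [e2.deriv_eq]
    have A := (ag.deriv.deriv.comp af).differentiableAt.hasDerivAt
    have B := (ag.deriv.comp af).differentiableAt.hasDerivAt
    have C := af.deriv.differentiableAt.hasDerivAt
    have C' := af.deriv.deriv.differentiableAt.hasDerivAt
    have := ((A.mul (C.pow 2)).add (B.mul C')).deriv
    simp only [Function.comp_def] at this
    refine Eq.trans this ?_
    rw [e1'.eq_of_nhds, e1''.eq_of_nhds]
    simp only [Pi.pow_apply]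
    rw [f3, f2, f1, g3, g2, g1]; push_cast; ring

lemma Jet.congr {f g : ℂ → ℂ} {x d N S d' N' S' : ℂ} (hf : Jet f x d N S) (h : f =ᶠ[nhds x] g)
    (hd : d = d') (hN : N = N') (hS : S = S') : Jet g x d' N' S' := by
  subst hd hN hS
  obtain ⟨af, d0, f1, f2, f3⟩ := hf
  exact ⟨af.congr h, d0, by rw [← h.deriv_eq, f1], by rw [← h.deriv.deriv_eq, f2],
    by rw [← h.deriv.deriv.deriv_eq, f3]⟩

/-- Moebius maps -/
lemma Jet.mob (a b c d x : ℂ) (h : c * x + d ≠ 0) (hk : a * d - b * c ≠ 0) :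
    Jet (fun w => (a * w + b) / (c * w + d)) x ((a*d-b*c)/(c*x+d)^2) (-2*c/(c*x+d)) 0 := by
  have an : AnalyticAt ℂ (fun w => (a * w + b) / (c * w + d)) x := by fun_prop (disch := exact h)
  have ev : ∀ᶠ y in nhds x, c * y + d ≠ 0 :=
    ContinuousAt.eventually_ne (by fun_prop) h
  have L : ∀ (n : ℕ) (C y : ℂ), c * y + d ≠ 0 →
      deriv (fun w => C * ((c * w + d)^n)⁻¹) y = (-n * c * C) * ((c * y + d)^(n+1))⁻¹ := by
    intro n C y hy
    have h1 : HasDerivAt (fun w => c * w + d) c y := by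
      simpa using ((hasDerivAt_id y).const_mul c).add_const d
    have h2 := (((h1.pow n).inv (pow_ne_zero n hy)).const_mul C).deriv
    refine Eq.trans h2 ?_
    simp only [Pi.pow_apply]
    rcases n with _ | n
    · simp
    · simp only [Pi.inv_apply, Pi.pow_apply, Nat.add_sub_cancel]; field_simp; try ring
  have e1 : deriv (fun w => (a * w + b) / (c * w + d)) =ᶠ[nhds x] fun y => (a*d-b*c) * ((c*y+d)^2)⁻¹ := by
    filter_upwards [ev] with y hy
    have h1 : HasDerivAt (fun w => c * w + d) c y := by
      simpa using ((hasDerivAt_id y).const_mul c).add_const d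
    have h2 : HasDerivAt (fun w => a * w + b) a y := by
      simpa using ((hasDerivAt_id y).const_mul a).add_const b
    refine Eq.trans (h2.div h1 hy).deriv ?_
    field_simp; ring
  have e2 : deriv (deriv (fun w => (a * w + b) / (c * w + d))) =ᶠ[nhds x] fun y => (-(2:ℕ)*c*(a*d-b*c)) * ((c*y+d)^3)⁻¹ := by
    filter_upwards [ev, e1.deriv] with y hy h
    rw [h, L 2 _ y hy]
  refine ⟨an, div_ne_zero hk (pow_ne_zero _ h), ?_, ?_, ?_⟩
  · rw [e1.eq_of_nhds]; rfl
  · rw [e2.eq_of_nhds]; field_simp; push_cast; ring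
  · rw [e2.deriv_eq, L 3 _ x h]; field_simp; push_cast; ring

lemma Jet.lin (a x : ℂ) (ha : a ≠ 0) : Jet (fun w => a * w) x a 0 0 := by
  refine (Jet.mob a 0 0 1 x (by simp) (by simpa using ha)).congr ?_ (by simp) (by simp) rfl
  filter_upwards with y; simp

lemma slit_of_re {x : ℂ} (h : 0 < x.re) : x ∈ Complex.slitPlane := Or.inl h

lemma csq_analyticAt {x : ℂ} (h : 0 < x.re) : AnalyticAt ℂ csq x := by
  have : AnalyticAt ℂ (fun z => Complex.exp (Complex.log z / 2)) x := by
    have := slit_of_re h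
    fun_prop (disch := assumption)
  refine this.congr ?_
  filter_upwards [(Complex.continuous_re.tendsto x).eventually (lt_mem_nhds h)] with y hy
  exact (csq_eq hy).symm

lemma Jet.csq {x : ℂ} (h : 0 < x.re) : Jet csq x (RN.csq x / (2 * x)) (-1/(2*x)) (3/(8*x^2)) := by
  have ev : ∀ᶠ y in nhds x, 0 < y.re :=
    (Complex.continuous_re.tendsto x).eventually (lt_mem_nhds h)
  have ne : ∀ {y : ℂ}, 0 < y.re → y ≠ 0 := by rintro y hy rfl; simp at hy
  have L : ∀ (n : ℕ) (C y : ℂ), 0 < y.re →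
      deriv (fun w => C * (RN.csq w * (w^n)⁻¹)) y = ((1/2 - n) * C) * (RN.csq y * (y^(n+1))⁻¹) := by
    intro n C y hy
    have h0 := ne hy
    have h1 : HasDerivAt RN.csq (RN.csq y * (y⁻¹/2)) y := by
      have := ((Complex.hasDerivAt_log (slit_of_re hy)).div_const 2).cexp
      rw [← csq_eq hy] at this
      refine this.congr_of_eventuallyEq ?_
      filter_upwards [(Complex.continuous_re.tendsto y).eventually (lt_mem_nhds hy)] with w hw
      exact csq_eq hw
    have h2 := ((h1.mul (((hasDerivAt_id y).pow n).inv (pow_ne_zero n h0))).const_mul C).deriv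
    refine Eq.trans h2 ?_
    simp only [Pi.pow_apply, id]
    rcases n with _ | n
    · simp; field_simp
    · simp only [Pi.inv_apply, Pi.pow_apply, Nat.add_sub_cancel, id]; field_simp; push_cast; ring
  have e1 : deriv RN.csq =ᶠ[nhds x] fun y => (1/2) * (RN.csq y * (y^1)⁻¹) := by
    filter_upwards [ev] with y hy
    have := L 0 1 y hy
    simpa using this
  have e2 : deriv (deriv RN.csq) =ᶠ[nhds x] fun y => ((1/2-(1:ℕ))*(1/2)) * (RN.csq y * (y^2)⁻¹) := by
    filter_upwards [ev, e1.deriv] with y hy h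
    rw [h, L 1 _ y hy]
  have x0 := ne h
  refine ⟨csq_analyticAt h, div_ne_zero (csq_ne x) (by simpa using x0), ?_, ?_, ?_⟩
  · rw [e1.eq_of_nhds]; field_simp
  · rw [e2.eq_of_nhds]; field_simp; push_cast; ring
  · rw [e2.deriv_eq, L 2 _ x h]; field_simp; push_cast; ring

/-- comparison along rays, strict -/
lemma ray_lt {Ω : Set ℂ} (hO : IsOpen Ω) (hs : StarConvex ℝ 0 Ω) {f : ℂ → ℂ} (hf : DifferentiableOn ℂ f Ω)
    {B B' : ℝ → ℝ} (hB : ∀ t, HasDerivAt B (B' t) t) (h0 : ‖f 0‖ ≤ B 0)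
    (h : ∀ x ∈ Ω, ‖f x‖ = B ‖x‖ → ‖deriv f x‖ < B' ‖x‖) {x : ℂ} (hx : x ∈ Ω) : ‖f x‖ ≤ B ‖x‖ := by
  rcases eq_or_ne x 0 with rfl | hx0
  · simpa using h0
  have hn : 0 < ‖x‖ := norm_pos_iff.2 hx0
  set v : ℂ := x / ‖x‖ with hv
  have hv1 : ‖v‖ = 1 := by rw [hv, norm_div]; simp [hn.ne']
  have mem : ∀ t ∈ Set.Icc 0 ‖x‖, (t:ℂ) * v ∈ Ω := by
    intro t ht
    have := hs.smul_mem hx (div_nonneg ht.1 hn.le) (div_le_one_of_le₀ ht.2 hn.le)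
    convert this using 1
    rw [hv, Complex.real_smul]; push_cast; ring
  have hd : ∀ t ∈ Set.Icc 0 ‖x‖, HasDerivAt (fun t : ℝ => f (t * v)) (deriv f (t*v) * v) t := by
    intro t ht
    have h1 := (hf.differentiableAt (hO.mem_nhds (mem t ht))).hasDerivAt
    have h2 : HasDerivAt (fun t : ℝ => (t:ℂ) * v) v t := by
      simpa using (Complex.ofRealCLM.hasDerivAt (x := t)).mul_const v
    exact h1.comp t h2
  have nt : ∀ t ∈ Set.Icc 0 ‖x‖, ‖(t:ℂ) * v‖ = t := by
    intro t ht
    rw [norm_mul, hv1, mul_one, Complex.norm_real, Real.norm_eq_abs, abs_of_nonneg ht.1]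
  have := image_norm_le_of_norm_deriv_right_lt_deriv_boundary (a := 0) (b := ‖x‖)
    (f := fun t : ℝ => f (t * v)) (f' := fun t => deriv f (t*v) * v) (B := B) (B' := B')
    (fun t ht => (hd t ht).continuousAt.continuousWithinAt)
    (fun t ht => (hd t ⟨ht.1, ht.2.le⟩).hasDerivWithinAt) (by simpa using h0) hB ?_
    (x := ‖x‖) ⟨hn.le, le_rfl⟩
  · have e : ((‖x‖:ℝ):ℂ) * v = x := by
      rw [hv]; field_simp [Complex.ofReal_ne_zero.2 hn.ne']
    simpa [e] using this
  · intro t ht heq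
    have ht' : t ∈ Set.Icc 0 ‖x‖ := ⟨ht.1, ht.2.le⟩
    have := h _ (mem t ht') (by rw [nt t ht']; exact heq)
    rw [nt t ht'] at this
    rw [norm_mul, hv1, mul_one]; exact this

lemma ray_le {Ω : Set ℂ} (hO : IsOpen Ω) (hs : StarConvex ℝ 0 Ω) {f : ℂ → ℂ} (hf : DifferentiableOn ℂ f Ω)
    {B B' : ℝ → ℝ} (hB : ∀ t, HasDerivAt B (B' t) t) (h0 : ‖f 0‖ ≤ B 0)
    (h : ∀ x ∈ Ω, ‖deriv f x‖ ≤ B' ‖x‖) {x : ℂ} (hx : x ∈ Ω) : ‖f x‖ ≤ B ‖x‖ := by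
  refine le_of_forall_pos_le_add fun ε hε => ?_
  have hn : 0 < 1 + ‖x‖ := by positivity
  have := ray_lt hO hs hf (B := fun t => B t + ε/(1+‖x‖) * t) (B' := fun t => B' t + ε/(1+‖x‖))
    (fun t => ((hB t).add ((hasDerivAt_id t).const_mul (ε/(1+‖x‖)))).congr_deriv (by simp)) (by simpa using h0)
    (fun y hy _ => (h y hy).trans_lt (by simpa using div_pos hε hn)) hx
  refine this.trans ?_
  have : ε/(1+‖x‖) * ‖x‖ ≤ ε := by
    rw [div_mul_eq_mul_div, div_le_iff₀ hn]; nlinarith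
  simpa using this

end RN
end

section
open Metric
namespace RN

structure Ctx where
  (m R ka l0 ep e0 A b0 be P : ℝ)
  V0 : ℂ → ℂ

namespace Ctx
def O (c : Ctx) : Set ℂ := ball (c.m : ℂ) c.R
def Mx (c : Ctx) : ℝ := |c.m| + c.R
noncomputable def v0 (c : Ctx) : ℂ → ℂ := deriv c.V0
structure Ok (c : Ctx) : Prop where
  dV : Differentiable ℂ c.V0
  V00 : c.V0 0 = 0
  V01 : c.v0 0 = 1
  V02 : deriv c.v0 0 = 0
  R0 : 0 < c.R
  m0 : |c.m| < c.R
  m1 : |1 - c.m| < c.R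
  ka0 : 0 ≤ c.ka
  kaM : c.ka * c.Mx^2 < 1
  hv : ∀ x : ℂ, ‖x‖ ≤ c.Mx → ‖c.v0 x - 1‖ ≤ c.ka * ‖x‖^2
  P0 : 0 < c.P
  ep0 : 0 < c.ep
  A0 : 0 < c.A
  be0 : 0 < c.be
  cj : ∀ x : ℂ, c.V0 (starRingEnd ℂ x) = starRingEnd ℂ (c.V0 x)
end Ctx

structure St where
  (l e b : ℂ)
  V : ℂ → ℂ

/-- the coordinate functions -/
noncomputable def Ctx.uu (c : Ctx) (V : ℂ → ℂ) (x : ℂ) : ℂ := deriv V x / c.v0 x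
noncomputable def Ctx.om (c : Ctx) (V : ℂ → ℂ) (x : ℂ) : ℂ := deriv (c.uu V) x / c.v0 x
noncomputable def Ctx.q (c : Ctx) (V : ℂ → ℂ) (x : ℂ) : ℂ := deriv (c.om V) x

structure Nrm (c : Ctx) (V : ℂ → ℂ) : Prop where
  d : DifferentiableOn ℂ V c.O
  z0 : V 0 = 0
  z1 : deriv V 0 = 1
  z2 : deriv (deriv V) 0 = 0

structure Dom (c : Ctx) (θ : ℝ) (u : St) : Prop where
  hl : ‖u.l - c.l0‖ ≤ θ * c.ep
  he : ‖u.e - c.e0‖ ≤ θ * c.A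
  hb : ‖u.b - c.b0‖ ≤ θ * c.be
  nrm : Nrm c u.V
  hq : ∀ x ∈ c.O, ‖c.q u.V x‖ ≤ θ * c.P

namespace Ctx
variable {c : Ctx}
lemma O_open : IsOpen c.O := isOpen_ball
lemma Ok.mem0 (h : c.Ok) : (0:ℂ) ∈ c.O := by
  simp [O, mem_ball, dist_eq_norm]; exact h.m0
lemma Ok.mem1 (h : c.Ok) : (1:ℂ) ∈ c.O := by
  rw [O, mem_ball, dist_eq_norm]
  have : (1:ℂ) - c.m = ((1 - c.m : ℝ):ℂ) := by push_cast; ring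
  rw [this, Complex.norm_real]; exact h.m1
lemma Ok.star (h : c.Ok) : StarConvex ℝ 0 c.O := (convex_ball _ _).starConvex h.mem0
lemma norm_le_Mx' {x : ℂ} (hx : x ∈ closedBall (c.m:ℂ) c.R) : ‖x‖ ≤ c.Mx := by
  rw [mem_closedBall, dist_eq_norm] at hx
  have := norm_sub_norm_le x (c.m:ℂ)
  rw [Complex.norm_real, Real.norm_eq_abs] at this
  rw [Mx]; linarith
lemma norm_le_Mx {x : ℂ} (hx : x ∈ c.O) : ‖x‖ ≤ c.Mx := norm_le_Mx' (ball_subset_closedBall hx)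
lemma Ok.Mx_pos (h : c.Ok) : 0 < c.Mx := by have := h.R0; rw [Mx]; positivity
lemma Ok.v0_norm (h : c.Ok) {x : ℂ} (hx : ‖x‖ ≤ c.Mx) : ‖c.v0 x‖ ≤ 1 + c.ka * ‖x‖^2 := by
  have := h.hv x hx
  have h2 := norm_sub_norm_le (c.v0 x) 1
  rw [norm_one] at h2; linarith
lemma Ok.kx (h : c.Ok) {x : ℂ} (hx : ‖x‖ ≤ c.Mx) : c.ka * ‖x‖^2 ≤ c.ka * c.Mx^2 :=
  mul_le_mul_of_nonneg_left (pow_le_pow_left₀ (norm_nonneg _) hx 2) h.ka0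
lemma Ok.v0_ne (h : c.Ok) {x : ℂ} (hx : ‖x‖ ≤ c.Mx) : c.v0 x ≠ 0 := by
  intro h0
  have := h.hv x hx
  have h1 := h.kaM
  have h2 := h.kx hx
  rw [h0, zero_sub, norm_neg, norm_one] at this
  linarith
lemma Ok.v0_diff (h : c.Ok) : Differentiable ℂ c.v0 := fun x =>
  (h.dV.analyticAt x).deriv.differentiableAt
lemma Ok.v0_an (h : c.Ok) (x : ℂ) : AnalyticAt ℂ c.v0 x := h.v0_diff.analyticAt x
end Ctx

section
variable {c : Ctx} (h : c.Ok) {V : ℂ → ℂ} (n : Nrm c V)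
include h n
lemma Nrm.anV {x : ℂ} (hx : x ∈ c.O) : AnalyticAt ℂ V x := n.d.analyticAt (c.O_open.mem_nhds hx)
lemma Nrm.anU {x : ℂ} (hx : x ∈ c.O) : AnalyticAt ℂ (c.uu V) x :=
  (n.anV h hx).deriv.div (h.v0_an x) (h.v0_ne (Ctx.norm_le_Mx hx))
lemma Nrm.anOm {x : ℂ} (hx : x ∈ c.O) : AnalyticAt ℂ (c.om V) x :=
  (n.anU h hx).deriv.div (h.v0_an x) (h.v0_ne (Ctx.norm_le_Mx hx))
lemma Nrm.anq {x : ℂ} (hx : x ∈ c.O) : AnalyticAt ℂ (c.q V) x := (n.anOm h hx).deriv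
lemma Nrm.om0 : c.om V 0 = 0 := by
  have a := (n.anV h h.mem0).deriv.differentiableAt.hasDerivAt
  have b := (h.v0_diff 0).hasDerivAt
  have := (a.div b (by rw [h.V01]; exact one_ne_zero)).deriv
  rw [n.z2, h.V02] at this
  have e : deriv (c.uu V) 0 = 0 := by
    refine Eq.trans this ?_
    simp
  rw [Ctx.om, e, zero_div]
lemma Nrm.u0 : c.uu V 0 = 1 := by rw [Ctx.uu, n.z1, h.V01, div_one]
omit n in
lemma V0nrm : Nrm c c.V0 := ⟨h.dV.differentiableOn, h.V00, h.V01, h.V02⟩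

variable {P : ℝ} (hq : ∀ x ∈ c.O, ‖c.q V x‖ ≤ P)
include hq
lemma om_bd {x : ℂ} (hx : x ∈ c.O) : ‖c.om V x‖ ≤ P * ‖x‖ := by
  refine ray_le c.O_open h.star (fun y hy => (n.anOm h hy).differentiableAt.differentiableWithinAt)
    (B := fun t => P * t) (B' := fun _ => P) (fun t => by simpa using (hasDerivAt_id t).const_mul P)
    (by simp [n.om0 h]) hq hx
lemma ud_eq {x : ℂ} (hx : x ∈ c.O) : deriv (c.uu V) x = c.v0 x * c.om V x := by
  rw [Ctx.om]; field_simp [h.v0_ne (Ctx.norm_le_Mx hx)]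
lemma ud_bd {x : ℂ} (hx : x ∈ c.O) : ‖deriv (c.uu V) x‖ ≤ P * ‖x‖ * (1 + c.ka * ‖x‖^2) := by
  rw [ud_eq h n hq hx, norm_mul, mul_comm]
  exact mul_le_mul (om_bd h n hq hx) (h.v0_norm (Ctx.norm_le_Mx hx)) (norm_nonneg _)
    ((norm_nonneg _).trans (om_bd h n hq hx))
lemma u_bd {x : ℂ} (hx : x ∈ c.O) : ‖c.uu V x - 1‖ ≤ P * (‖x‖^2 * (1/2 + c.ka * ‖x‖^2/4)) := by
  refine ray_le c.O_open h.star (f := fun x => c.uu V x - 1)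
    (fun y hy => ((n.anU h hy).differentiableAt.sub_const 1).differentiableWithinAt)
    (B := fun t => P * (t^2 * (1/2 + c.ka * t^2/4))) (B' := fun t => P * t * (1 + c.ka * t^2))
    (fun t => ?_) (by simp [n.u0 h]) (fun y hy => ?_) hx
  · have := (((hasDerivAt_id t).pow 2).mul ((((((hasDerivAt_id t).pow 2).const_mul c.ka).div_const 4)).const_add (1/2))).const_mul P
    refine this.congr_deriv ?_
    simp; ring
  · rw [deriv_sub_const]; exact ud_bd h n hq hy
lemma Vd_eq {x : ℂ} (hx : x ∈ c.O) : deriv V x = c.v0 x * c.uu V x := by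
  rw [Ctx.uu]; field_simp [h.v0_ne (Ctx.norm_le_Mx hx)]
lemma V_bd (hP : 0 ≤ P) {x : ℂ} (hx : x ∈ c.O) :
    ‖V x - c.V0 x‖ ≤ (1+c.ka*c.Mx^2) * (P * (‖x‖^3 * (1/6 + c.ka * ‖x‖^2/20))) := by
  refine ray_le c.O_open h.star (f := fun x => V x - c.V0 x)
    (fun y hy => ((n.anV h hy).differentiableAt.sub (h.dV y)).differentiableWithinAt)
    (B := fun t => (1+c.ka*c.Mx^2) * (P * (t^3 * (1/6 + c.ka * t^2/20))))
    (B' := fun t => (1+c.ka*c.Mx^2) * (P * (t^2 * (1/2 + c.ka * t^2/4))))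
    (fun t => ?_) (by simp [n.z0, h.V00]) (fun y hy => ?_) hx
  · have := ((((hasDerivAt_id t).pow 3).mul ((((((hasDerivAt_id t).pow 2).const_mul c.ka).div_const 20)).const_add (1/6))).const_mul P).const_mul (1+c.ka*c.Mx^2)
    refine this.congr_deriv ?_
    simp only [Pi.pow_apply, id]; push_cast; ring
  · have e : deriv (fun x => V x - c.V0 x) y = c.v0 y * (c.uu V y - 1) := by
      refine Eq.trans (((n.anV h hy).differentiableAt.hasDerivAt.sub (h.dV y).hasDerivAt).deriv) ?_
      rw [Vd_eq h n hq hy, mul_sub, mul_one]; rfl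
    rw [e, norm_mul]
    have k0 := h.ka0
    refine mul_le_mul ((h.v0_norm (Ctx.norm_le_Mx hy)).trans ?_) (u_bd h n hq hy) (norm_nonneg _) (by positivity)
    have := h.kx (Ctx.norm_le_Mx hy); linarith
end

noncomputable def NV (V : ℂ → ℂ) (x : ℂ) : ℂ := deriv (deriv V) x / deriv V x
noncomputable def SV (V : ℂ → ℂ) (x : ℂ) : ℂ := deriv (deriv (deriv V)) x / deriv V x - 3/2 * (NV V x)^2
lemma Jet.of {V : ℂ → ℂ} {x : ℂ} (a : AnalyticAt ℂ V x) (h : deriv V x ≠ 0) :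
    Jet V x (deriv V x) (NV V x) (SV V x) := by
  refine ⟨a, h, rfl, ?_, ?_⟩
  · rw [NV]; field_simp
  · rw [SV]; field_simp; ring
lemma Jet.N_eq {V : ℂ → ℂ} {x d N S : ℂ} (j : Jet V x d N S) : NV V x = N := by
  rw [NV, j.h1, j.h2]; field_simp [j.d0]
lemma Jet.S_eq {V : ℂ → ℂ} {x d N S : ℂ} (j : Jet V x d N S) : SV V x = S := by
  rw [SV, j.N_eq, j.h1, j.h3]; field_simp [j.d0]; ring

section
variable {c : Ctx} (h : c.Ok) {V : ℂ → ℂ} (n : Nrm c V)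
include h n
/-- logarithmic derivative in terms of u -/
lemma N_split {x : ℂ} (hx : x ∈ c.O) (hu : c.uu V x ≠ 0) :
    NV V x = NV c.V0 x + deriv (c.uu V) x / c.uu V x := by
  have v := h.v0_ne (Ctx.norm_le_Mx hx)
  have e : deriv V =ᶠ[nhds x] fun y => c.v0 y * c.uu V y := by
    filter_upwards [c.O_open.mem_nhds hx] with y hy
    rw [Ctx.uu]; field_simp [h.v0_ne (Ctx.norm_le_Mx hy)]
  have e2 := ((h.v0_diff x).hasDerivAt.mul (n.anU h hx).differentiableAt.hasDerivAt).deriv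
  rw [NV, e.deriv_eq, e.eq_of_nhds]
  erw [e2]
  rw [NV]; change _ = deriv c.v0 x / c.v0 x + _
  field_simp
lemma S_split {x : ℂ} (hx : x ∈ c.O) (hu : c.uu V x ≠ 0) :
    SV V x = SV c.V0 x + c.v0 x * c.q V x / c.uu V x - 3/2 * (deriv (c.uu V) x / c.uu V x)^2 := by
  have v := h.v0_ne (Ctx.norm_le_Mx hx)
  have O' := c.O_open.mem_nhds hx
  have e : deriv V =ᶠ[nhds x] fun y => c.v0 y * c.uu V y := by
    filter_upwards [O'] with y hy
    rw [Ctx.uu]; field_simp [h.v0_ne (Ctx.norm_le_Mx hy)]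
  have eo : deriv (c.uu V) =ᶠ[nhds x] fun y => c.v0 y * c.om V y := by
    filter_upwards [O'] with y hy
    rw [Ctx.om]; field_simp [h.v0_ne (Ctx.norm_le_Mx hy)]
  have e2 : deriv (deriv V) =ᶠ[nhds x] fun y => deriv c.v0 y * c.uu V y + c.v0 y * (c.v0 y * c.om V y) := by
    filter_upwards [O', e.deriv, eo] with y hy h1 h2
    rw [h1, ← h2]
    exact ((h.v0_diff y).hasDerivAt.mul (n.anU h hy).differentiableAt.hasDerivAt).deriv
  have dv := (h.v0_diff x).hasDerivAt
  have du := (n.anU h hx).differentiableAt.hasDerivAt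
  have dom := (n.anOm h hx).differentiableAt.hasDerivAt
  have ddv := (h.v0_an x).deriv.differentiableAt.hasDerivAt
  have e3 := ((ddv.mul du).add (dv.mul (dv.mul dom))).deriv
  have e3' : deriv (deriv (deriv V)) x = deriv (deriv c.v0) x * c.uu V x + deriv c.v0 x * (c.v0 x * c.om V x)
     + (deriv c.v0 x * (c.v0 x * c.om V x) + c.v0 x * (deriv c.v0 x * c.om V x + c.v0 x * c.q V x)) := by
    rw [e2.deriv_eq, ← eo.eq_of_nhds]
    rw [eo.eq_of_nhds] at e3 ⊢
    exact e3
  rw [SV, N_split h n hx hu, e3', e.eq_of_nhds, SV, NV]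
  change _ = deriv (deriv c.v0) x / c.v0 x - _ * (deriv c.v0 x / c.v0 x)^2 + _ - _
  change _ - 3 / 2 * (deriv c.v0 x / c.v0 x + _)^2 = _
  rw [eo.eq_of_nhds]
  field_simp
  ring

lemma NS_bd {P : ℝ} (hq : ∀ x ∈ c.O, ‖c.q V x‖ ≤ P) {x : ℂ} (hx : x ∈ c.O) {B0 B1 w : ℝ}
    (hB0 : P * (‖x‖^2 * (1/2 + c.ka * ‖x‖^2/4)) ≤ B0) (hB : B0 < 1)
    (hB1 : P * ‖x‖ * (1 + c.ka * ‖x‖^2) ≤ B1) (hw : 1 + c.ka * ‖x‖^2 ≤ w) :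
    deriv V x ≠ 0 ∧ ‖NV V x - NV c.V0 x‖ ≤ B1/(1-B0) ∧
    ‖SV V x - SV c.V0 x‖ ≤ w*P/(1-B0) + 3/2*(B1/(1-B0))^2 := by
  have hu1 := (u_bd h n hq hx).trans hB0
  have hun : 1 - B0 ≤ ‖c.uu V x‖ := by
    have := norm_sub_norm_le 1 (c.uu V x)
    rw [norm_sub_rev, norm_one] at this; linarith
  have hB' : 0 < 1 - B0 := by linarith
  have hu : c.uu V x ≠ 0 := norm_pos_iff.1 (hB'.trans_le hun)
  have k : ‖deriv (c.uu V) x / c.uu V x‖ ≤ B1/(1-B0) := by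
    rw [norm_div]
    have := (ud_bd h n hq hx).trans hB1
    exact div_le_div₀ ((norm_nonneg _).trans this) this hB' hun
  refine ⟨?_, ?_, ?_⟩
  · rw [Vd_eq h n hq hx]; exact mul_ne_zero (h.v0_ne (Ctx.norm_le_Mx hx)) hu
  · rw [N_split h n hx hu, add_sub_cancel_left]; exact k
  · have : SV V x - SV c.V0 x = c.v0 x * c.q V x / c.uu V x - 3/2 * (deriv (c.uu V) x / c.uu V x)^2 := by
      rw [S_split h n hx hu]; ring
    rw [this]
    refine (norm_sub_le _ _).trans (add_le_add ?_ ?_)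
    · rw [norm_div, norm_mul]
      have a := (h.v0_norm (Ctx.norm_le_Mx hx)).trans hw
      have := mul_le_mul a (hq x hx) (norm_nonneg _) ((norm_nonneg _).trans a)
      exact div_le_div₀ ((by positivity : (0:ℝ) ≤ _).trans this) this hB' hun
    · rw [norm_mul, norm_pow]
      have : ‖(3/2 : ℂ)‖ = 3/2 := by norm_num
      rw [this]; gcongr
end

end RN
end

section
open Metric
namespace RN

namespace St
noncomputable def G (u : St) (y : ℂ) : ℂ := (u.V 1 - u.V y) / (1 + u.e * u.V y)
noncomputable def Lm (u : St) (y : ℂ) : ℂ := - csq (u.b * u.G y)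
noncomputable def y (u : St) (j : ℕ) (z : ℂ) : ℂ := (u.Lm)^[j] z
noncomputable def bh (u : St) (n : ℕ) : ℂ := (u.G (u.y n u.l))⁻¹
noncomputable def ss (u : St) (n : ℕ) (z : ℂ) : ℂ := csq (u.G (u.y n z) * u.bh n)
noncomputable def lh (u : St) (n : ℕ) : ℂ := deriv (u.ss n) u.l
noncomputable def gg (u : St) (n : ℕ) (x : ℂ) : ℂ := u.G (u.ss n (u.lh n * x))
noncomputable def hh (u : St) (n : ℕ) (x : ℂ) : ℂ := (u.gg n x - u.gg n 0) / deriv (u.gg n) 0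
noncomputable def kk (u : St) (n : ℕ) : ℂ := deriv (deriv (u.hh n)) 0 / 2
noncomputable def T (n : ℕ) (u : St) : St :=
  ⟨u.lh n, (-u.kk n - u.lh n * u.e) / (1 - u.lh n), u.bh n, fun x => u.hh n x / (1 + u.kk n * u.hh n x)⟩

noncomputable def k (u : St) : ℂ := 1 + u.e * u.V 1
noncomputable def r (u : St) (y : ℂ) : ℂ := -(deriv u.V y * u.k) / ((u.V 1 - u.V y) * (1 + u.e * u.V y))
noncomputable def NG (u : St) (y : ℂ) : ℂ := NV u.V y - 2 * (u.e * deriv u.V y) / (1 + u.e * u.V y)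
noncomputable def dj (u : St) : ℕ → ℂ → ℂ
  | 0, _ => 1
  | j+1, z => u.dj j z * (u.r (u.y j z) * u.y (j+1) z / 2)
noncomputable def tN (u : St) (y : ℂ) : ℂ := u.NG y - u.r y / 2
noncomputable def tS (u : St) (y : ℂ) : ℂ := SV u.V y + 3/8 * u.r y ^ 2
end St

structure Reg (c : Ctx) (u : St) : Prop where
  d : DifferentiableOn ℂ u.V c.O
  V' : ∀ x ∈ c.O, deriv u.V x ≠ 0
  eV : ∀ x ∈ c.O, 1 + u.e * u.V x ≠ 0
  k0 : u.k ≠ 0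

variable {c : Ctx} {u : St}
lemma Reg.an (R : Reg c u) {y : ℂ} (hy : y ∈ c.O) : AnalyticAt ℂ u.V y :=
  R.d.analyticAt (c.O_open.mem_nhds hy)

lemma Reg.jetG (R : Reg c u) {y : ℂ} (hy : y ∈ c.O) :
    Jet u.G y (-(deriv u.V y * u.k) / (1 + u.e * u.V y)^2) (u.NG y) (SV u.V y) := by
  have h := R.eV y hy
  have J := Jet.of (R.an hy) (R.V' y hy)
  have M := Jet.mob (-1) (u.V 1) u.e 1 (u.V y) (by rwa [add_comm]) (by
    have := neg_ne_zero.2 R.k0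
    intro h0; apply this; rw [St.k]; linear_combination h0)
  refine (J.comp M).congr ?_ ?_ ?_ (by ring)
  · filter_upwards with x
    rw [St.G]; congr 1 <;> ring
  · rw [St.k]; rw [add_comm (u.e * u.V y)]; field_simp; ring
  · rw [St.NG, add_comm (u.e * u.V y)]; field_simp; ring

lemma G_ne_of {B y : ℂ} (h : 0 < (u.G y * B).re) : u.G y ≠ 0 ∧ B ≠ 0 := by
  constructor <;> intro h0 <;> rw [h0] at h <;> simp at h

lemma Reg.jetS (R : Reg c u) {y B : ℂ} (hy : y ∈ c.O) (h : 0 < (u.G y * B).re) :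
    Jet (fun w => csq (u.G w * B)) y (u.r y * csq (u.G y * B) / 2) (u.tN y) (u.tS y) := by
  obtain ⟨hG, hB⟩ := G_ne_of h
  have e := R.eV y hy
  have hw : u.V 1 - u.V y ≠ 0 := by
    intro h0; apply hG; rw [St.G, h0, zero_div]
  have J := (((R.jetG hy).comp (Jet.lin B _ hB)).comp (g := csq) (Jet.csq (by rwa [mul_comm])))
  refine J.congr ?_ ?_ ?_ ?_
  · filter_upwards with x; rw [mul_comm]
  · rw [mul_comm B]
    rw [St.r]
    generalize csq (u.G y * B) = q
    have : u.G y = (u.V 1 - u.V y) / (1 + u.e * u.V y) := rfl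
    rw [this]; field_simp
  · rw [St.tN, St.r]
    have : B * u.G y = B * ((u.V 1 - u.V y) / (1 + u.e * u.V y)) := rfl
    rw [this]; field_simp; ring
  · rw [St.tS, St.r]
    have : B * u.G y = B * ((u.V 1 - u.V y) / (1 + u.e * u.V y)) := rfl
    rw [this]; field_simp; ring

lemma Reg.jetL (R : Reg c u) {y : ℂ} (hy : y ∈ c.O) (h : 0 < (u.b * u.G y).re) :
    Jet u.Lm y (u.r y * u.Lm y / 2) (u.tN y) (u.tS y) := by
  have J := (R.jetS hy (B := u.b) (by rwa [mul_comm])).comp (Jet.lin (-1) _ (by norm_num))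
  refine J.congr ?_ ?_ (by ring) (by ring)
  · filter_upwards with x; rw [St.Lm, mul_comm u.b]; ring
  · rw [St.Lm, mul_comm u.b]; ring

open Finset in
lemma Reg.jetY (R : Reg c u) {z : ℂ} (n : ℕ) (h1 : ∀ j < n, u.y j z ∈ c.O)
    (h2 : ∀ j < n, 0 < (u.b * u.G (u.y j z)).re) :
    Jet (u.y n) z (u.dj n z) (∑ j ∈ range n, u.dj j z * u.tN (u.y j z))
      (∑ j ∈ range n, u.dj j z ^ 2 * u.tS (u.y j z)) := by
  induction n with
  | zero =>
    simp only [range_zero, sum_empty, St.dj]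
    refine (Jet.lin 1 z one_ne_zero).congr ?_ rfl rfl rfl
    filter_upwards with x; simp [St.y]
  | succ n ih =>
    have J := (ih (fun j hj => h1 j (by omega)) (fun j hj => h2 j (by omega))).comp
      (R.jetL (h1 n (by omega)) (h2 n (by omega)))
    rw [sum_range_succ, sum_range_succ]
    refine J.congr ?_ ?_ rfl rfl
    · filter_upwards with x; simp only [St.y, Function.iterate_succ_apply']
    · rw [St.dj]; simp only [St.y, Function.iterate_succ_apply']; ring

/-- goodness of a point -/
structure Pt (c : Ctx) (u : St) (n : ℕ) (z : ℂ) : Prop where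
  y : ∀ j ≤ n, u.y j z ∈ c.O
  re : ∀ j < n, 0 < (u.b * u.G (u.y j z)).re
  res : 0 < (u.G (u.y n z) * u.bh n).re

open Finset in
noncomputable def St.sN (u : St) (n : ℕ) (z : ℂ) : ℂ := ∑ j ∈ range (n+1), u.dj j z * u.tN (u.y j z)
open Finset in
noncomputable def St.sS (u : St) (n : ℕ) (z : ℂ) : ℂ := ∑ j ∈ range (n+1), u.dj j z ^ 2 * u.tS (u.y j z)
noncomputable def St.sg (u : St) (n : ℕ) (z : ℂ) : ℂ := u.dj n z * u.r (u.y n z) * u.ss n z / 2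

open Finset in
lemma Reg.jetSS (R : Reg c u) {n : ℕ} {z : ℂ} (h : Pt c u n z) :
    Jet (u.ss n) z (u.sg n z) (u.sN n z) (u.sS n z) := by
  have J := (R.jetY n (fun j hj => h.y j hj.le) h.re).comp (R.jetS (h.y n le_rfl) h.res)
  refine J.congr ?_ ?_ ?_ ?_
  · filter_upwards with x; rfl
  · rw [St.sg, St.ss]; ring
  · rw [St.sN, sum_range_succ]
  · rw [St.sS, sum_range_succ]

lemma Reg.ss_l (h : u.G (u.y n u.l) ≠ 0) : u.ss n u.l = 1 := by
  rw [St.ss, St.bh, mul_inv_cancel₀ h, csq_one]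

lemma Reg.lh_eq (R : Reg c u) {n : ℕ} (h : Pt c u n u.l) :
    u.lh n = u.dj n u.l * u.r (u.y n u.l) / 2 ∧ u.lh n ≠ 0 := by
  have J := R.jetSS h
  have e : u.sg n u.l = u.dj n u.l * u.r (u.y n u.l) / 2 := by
    rw [St.sg, Reg.ss_l (G_ne_of h.res).1, mul_one]
  exact ⟨by rw [St.lh, J.h1, e], by rw [St.lh, J.h1]; exact J.d0⟩

lemma Reg.jetGG (R : Reg c u) {n : ℕ} {x : ℂ} (h : Pt c u n (u.lh n * x)) (hs : u.ss n (u.lh n * x) ∈ c.O)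
    (hl : u.lh n ≠ 0) : ∃ d, 
    Jet (u.gg n) x d (u.lh n * (u.sN n (u.lh n * x) + u.sg n (u.lh n * x) * u.NG (u.ss n (u.lh n * x))))
      (u.lh n ^2 * (u.sS n (u.lh n * x) + u.sg n (u.lh n * x)^2 * SV u.V (u.ss n (u.lh n * x)))) := by
  have J := ((Jet.lin (u.lh n) x hl).comp (R.jetSS h)).comp (R.jetG hs)
  refine ⟨_, J.congr ?_ rfl ?_ ?_⟩
  · filter_upwards with x; rfl
  · ring
  · ring

end RN
end

section
open Metric
namespace RN
noncomputable def cjf (f : ℂ → ℂ) (x : ℂ) : ℂ := starRingEnd ℂ (f (starRingEnd ℂ x))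
lemma deriv_cjf (f : ℂ → ℂ) : deriv (cjf f) = cjf (deriv f) := by
  exact deriv_conj_conj (𝕜 := ℂ) (f := f)
namespace St
noncomputable def cj (u : St) : St := ⟨starRingEnd ℂ u.l, starRingEnd ℂ u.e, starRingEnd ℂ u.b, cjf u.V⟩
variable (u : St) (n : ℕ)
lemma cj_l : u.cj.l = starRingEnd ℂ u.l := rfl
lemma cj_e : u.cj.e = starRingEnd ℂ u.e := rfl
lemma cj_b : u.cj.b = starRingEnd ℂ u.b := rfl
lemma cj_V : u.cj.V = cjf u.V := rfl
lemma cj_G : u.cj.G = cjf u.G := by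
  funext y; simp [G, cj_l, cj_e, cj_b, cj_V, cjf]
lemma cj_Lm (y : ℂ) : u.cj.Lm y = starRingEnd ℂ (u.Lm (starRingEnd ℂ y)) := by
  simp only [Lm, cj_G, cjf, cj_l, cj_e, cj_b, cj_V, map_neg, ← csq_conj, map_mul]
lemma cj_y : u.cj.y n = cjf (u.y n) := by
  funext z
  induction n with
  | zero => simp [y, cjf]
  | succ n ih =>
    simp only [y, cjf, Function.iterate_succ_apply'] at ih ⊢
    rw [ih, cj_Lm]; simp
lemma cj_bh : u.cj.bh n = starRingEnd ℂ (u.bh n) := by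
  simp [bh, cj_G, cj_y, cjf, cj_l, cj_e, cj_b, cj_V]
lemma cj_ss : u.cj.ss n = cjf (u.ss n) := by
  funext z
  simp [ss, cj_G, cj_y, cjf, cj_bh, ← csq_conj]
lemma cj_lh : u.cj.lh n = starRingEnd ℂ (u.lh n) := by
  simp [lh, cj_ss, deriv_cjf, cjf, cj_l, cj_e, cj_b, cj_V]
lemma cj_gg : u.cj.gg n = cjf (u.gg n) := by
  funext x
  simp [gg, cj_G, cj_ss, cj_lh, cjf]
lemma cj_hh : u.cj.hh n = cjf (u.hh n) := by
  funext x
  simp [hh, cj_gg, deriv_cjf, cjf]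
lemma cj_kk : u.cj.kk n = starRingEnd ℂ (u.kk n) := by
  simp [kk, map_ofNat, cj_hh, deriv_cjf, cjf]
lemma cj_T : u.cj.T n = (u.T n).cj := by
  rw [T, cj_lh, cj_kk, cj_bh, cj_hh, cj_e]
  simp only [T, cj, map_div₀, map_sub, map_neg, map_mul, map_one, mk.injEq, true_and]
  funext x; simp [cjf]
lemma cj_k : u.cj.k = starRingEnd ℂ u.k := by simp [k, cj_l, cj_e, cj_b, cj_V, cjf]
lemma cj_r (y : ℂ) : u.cj.r y = starRingEnd ℂ (u.r (starRingEnd ℂ y)) := by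
  rw [r, cj_k]; simp [r, cj_l, cj_e, cj_b, cj_V, cjf, deriv_cjf]
lemma cj_NG (y : ℂ) : u.cj.NG y = starRingEnd ℂ (u.NG (starRingEnd ℂ y)) := by
  simp [NG, map_ofNat, NV, cj_l, cj_e, cj_b, cj_V, cjf, deriv_cjf]
lemma cj_SV (y : ℂ) : SV u.cj.V y = starRingEnd ℂ (SV u.V (starRingEnd ℂ y)) := by
  simp [SV, map_ofNat, NV, cj_l, cj_e, cj_b, cj_V, cjf, deriv_cjf]
lemma cj_dj (z : ℂ) : u.cj.dj n z = starRingEnd ℂ (u.dj n (starRingEnd ℂ z)) := by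
  induction n with
  | zero => simp [dj]
  | succ n ih => simp [dj, map_ofNat, ih, cj_r, cj_y, cjf]
lemma cj_sN (z : ℂ) : u.cj.sN n z = starRingEnd ℂ (u.sN n (starRingEnd ℂ z)) := by
  simp [sN, map_ofNat, tN, cj_dj, cj_y, cj_NG, cj_r, cjf]
lemma cj_sS (z : ℂ) : u.cj.sS n z = starRingEnd ℂ (u.sS n (starRingEnd ℂ z)) := by
  simp [sS, map_ofNat, tS, cj_dj, cj_y, cj_SV, cj_r, cjf]
lemma cj_sg (z : ℂ) : u.cj.sg n z = starRingEnd ℂ (u.sg n (starRingEnd ℂ z)) := by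
  simp [sg, map_ofNat, cj_dj, cj_y, cj_r, cj_ss, cjf]
lemma cj_cj : u.cj.cj = u := by
  simp only [cj, Complex.conj_conj]
  congr 1
  funext x; simp [cjf]
end St
variable {c : Ctx}
lemma cj_O {x : ℂ} (h : x ∈ c.O) : starRingEnd ℂ x ∈ c.O := by
  rw [Ctx.O, mem_ball, dist_eq_norm] at *
  rw [← Complex.norm_conj]; simpa using h
lemma Ctx.Ok.v0_cj (o : c.Ok) (x : ℂ) : c.v0 (starRingEnd ℂ x) = starRingEnd ℂ (c.v0 x) := by
  have : c.V0 = cjf c.V0 := by funext y; rw [cjf, o.cj]; simp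
  have h : deriv c.V0 = cjf (deriv c.V0) := by conv_lhs => rw [this, deriv_cjf]
  rw [Ctx.v0]; exact (congrFun h _).trans (by simp [cjf])
lemma Ctx.Ok.SV0_cj (o : c.Ok) (x : ℂ) : SV c.V0 (starRingEnd ℂ x) = starRingEnd ℂ (SV c.V0 x) := by
  have : c.V0 = cjf c.V0 := by funext y; rw [cjf, o.cj]; simp
  have h := St.cj_SV ⟨0,0,0,c.V0⟩ (starRingEnd ℂ x)
  simp only [St.cj, ← this] at h
  simpa using h
lemma Ctx.Ok.uu_cj (o : c.Ok) (V : ℂ → ℂ) : c.uu (cjf V) = cjf (c.uu V) := by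
  funext x; simp [Ctx.uu, deriv_cjf, cjf, o.v0_cj]
lemma Ctx.Ok.om_cj (o : c.Ok) (V : ℂ → ℂ) : c.om (cjf V) = cjf (c.om V) := by
  funext x; simp [Ctx.om, o.uu_cj, deriv_cjf, cjf, o.v0_cj]
lemma Ctx.Ok.q_cj (o : c.Ok) (V : ℂ → ℂ) : c.q (cjf V) = cjf (c.q V) := by
  funext x; simp [Ctx.q, o.om_cj, deriv_cjf, cjf]
lemma Nrm.cj {V : ℂ → ℂ} (n : Nrm c V) : Nrm c (cjf V) := by
  refine ⟨?_, by simp [cjf, n.z0], by simp [deriv_cjf, cjf, n.z1], by simp [deriv_cjf, cjf, n.z2]⟩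
  intro x hx
  have := n.d.differentiableAt (Ctx.O_open.mem_nhds (cj_O hx))
  have h2 := this.conj_conj
  simp only [Complex.conj_conj] at h2
  exact h2.differentiableWithinAt
lemma Dom.cj (o : c.Ok) {θ : ℝ} {u : St} (h : Dom c θ u) : Dom c θ u.cj := by
  refine ⟨?_, ?_, ?_, h.nrm.cj, ?_⟩
  · rw [← Complex.norm_conj]; simpa [St.cj] using h.hl
  · rw [← Complex.norm_conj]; simpa [St.cj] using h.he
  · rw [← Complex.norm_conj]; simpa [St.cj] using h.hb
  · intro x hx
    rw [St.cj, o.q_cj, cjf, Complex.norm_conj]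
    exact h.hq _ (cj_O hx)
end RN
end

section
open Metric
namespace RN
variable {c : Ctx} {u : St}

lemma max_mod {f : ℂ → ℂ} {m : ℂ} {R C : ℝ} (hR : 0 < R) (hf : ∀ x ∈ closedBall m R, AnalyticAt ℂ f x)
    (h : ∀ x ∈ sphere m R, ‖f x‖ ≤ C) {x : ℂ} (hx : x ∈ closedBall m R) : ‖f x‖ ≤ C := by
  refine Complex.norm_le_of_forall_mem_frontier_norm_le (U := ball m R) isBounded_ball ?_ ?_ ?_
  · refine ⟨fun y hy => (hf y (ball_subset_closedBall hy)).differentiableAt.differentiableWithinAt, ?_⟩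
    rw [closure_ball _ hR.ne']
    exact fun y hy => (hf y hy).continuousAt.continuousWithinAt
  · rwa [frontier_ball _ hR.ne']
  · rwa [closure_ball _ hR.ne']

lemma NV_an {f : ℂ → ℂ} {x : ℂ} (h : AnalyticAt ℂ f x) (h0 : deriv f x ≠ 0) : AnalyticAt ℂ (NV f) x :=
  h.deriv.deriv.div h.deriv h0
lemma SV_an {f : ℂ → ℂ} {x : ℂ} (h : AnalyticAt ℂ f x) (h0 : deriv f x ≠ 0) : AnalyticAt ℂ (SV f) x :=
  (h.deriv.deriv.deriv.div h.deriv h0).sub (analyticAt_const.mul ((NV_an h h0).pow 2))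

/-- conclusion of the output estimate -/
structure OutV (c : Ctx) (θ : ℝ) (V : ℂ → ℂ) : Prop where
  nrm : Nrm c V
  V' : ∀ x ∈ c.O, deriv V x ≠ 0
  q : ∀ x ∈ c.O, ‖c.q V x‖ ≤ θ * c.P

/-- Schwarzian bound implies the bound on `q`. -/
lemma q_out (h : c.Ok) {V : ℂ → ℂ} (n : Nrm c V) (hV : ∀ x ∈ c.O, deriv V x ≠ 0) {c1 cc aa θ : ℝ}
    (hc1 : ∀ x ∈ c.O, ‖(SV V x - SV c.V0 x) / c.v0 x‖ ≤ c1) (cc0 : 0 ≤ cc) (aa0 : 0 ≤ aa)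
    (i1 : c1 + (1+c.ka*c.Mx^2) * (cc*c.Mx)^2/2 < cc)
    (i2 : (1+aa*c.Mx)*((1+c.ka*c.Mx^2)*(cc*c.Mx)) < aa)
    (i3 : (1+aa*c.Mx)*(c1+3/2*((1+c.ka*c.Mx^2) * (cc*c.Mx)^2)) ≤ θ * c.P) :
    ∀ x ∈ c.O, ‖c.q V x‖ ≤ θ * c.P := by
  set W := 1+c.ka*c.Mx^2 with hW
  have W0 : 0 ≤ W := by have := h.ka0; positivity
  have M0 := h.Mx_pos
  have v0 : ∀ {x}, x ∈ c.O → c.v0 x ≠ 0 := fun hx => h.v0_ne (Ctx.norm_le_Mx hx)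
  have vW : ∀ {x}, x ∈ c.O → ‖c.v0 x‖ ≤ W := fun hx =>
    (h.v0_norm (Ctx.norm_le_Mx hx)).trans (by have := h.kx (Ctx.norm_le_Mx hx); linarith)
  have u0 : ∀ {x}, x ∈ c.O → c.uu V x ≠ 0 := fun {x} hx => div_ne_zero (hV x hx) (v0 hx)
  have un : ∀ {x}, x ∈ c.O → AnalyticAt ℂ (c.uu V) x := fun hx => n.anU h hx
  set η : ℂ → ℂ := fun x => c.om V x / c.uu V x with hη
  have ηa : ∀ {x}, x ∈ c.O → AnalyticAt ℂ η x := fun hx => (n.anOm h hx).div (un hx) (u0 hx)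
  have ue : ∀ {x}, x ∈ c.O → deriv (c.uu V) x = c.uu V x * (c.v0 x * η x) := by
    intro x hx
    have : deriv (c.uu V) x = c.v0 x * c.om V x := by rw [Ctx.om]; field_simp [v0 hx]
    rw [this, hη]; field_simp [u0 hx]
  have qe : ∀ {x}, x ∈ c.O → c.q V x = c.uu V x * ((SV V x - SV c.V0 x) / c.v0 x + 3/2 * (c.v0 x * η x^2)) := by
    intro x hx
    rw [S_split h n hx (u0 hx), ue hx]
    field_simp [u0 hx, v0 hx]; ring
  have ηd : ∀ {x}, x ∈ c.O → deriv η x = (SV V x - SV c.V0 x) / c.v0 x + 1/2 * (c.v0 x * η x^2) := by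
    intro x hx
    have e := ((n.anOm h hx).differentiableAt.hasDerivAt.div (un hx).differentiableAt.hasDerivAt (u0 hx)).deriv
    have e' : deriv η x = (c.q V x * c.uu V x - c.om V x * deriv (c.uu V) x) / (c.uu V x)^2 := e
    rw [e', qe hx, ue hx]
    have : c.om V x = η x * c.uu V x := by rw [hη]; field_simp [u0 hx]
    rw [this]
    field_simp [u0 hx, v0 hx]; ring
  have ηb : ∀ {x}, x ∈ c.O → ‖η x‖ ≤ cc * ‖x‖ := by
    intro x hx
    refine ray_lt c.O_open h.star (fun y hy => (ηa hy).differentiableAt.differentiableWithinAt)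
      (B := fun t => cc * t) (B' := fun _ => cc) (fun t => by simpa using (hasDerivAt_id t).const_mul cc)
      (by simp [hη, n.om0 h]) (fun y hy hyy => ?_) hx
    rw [ηd hy]
    refine lt_of_le_of_lt ((norm_add_le _ _).trans (add_le_add (hc1 y hy) ?_)) i1
    rw [norm_mul, norm_mul, norm_pow, hyy]
    have a1 : ‖(1/2:ℂ)‖ = 1/2 := by norm_num
    have a2 : (cc * ‖y‖)^2 ≤ (cc * c.Mx)^2 := by
      gcongr; exact Ctx.norm_le_Mx hy
    rw [a1]
    have := mul_le_mul (vW hy) a2 (by positivity) W0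
    linarith
  have ηb' : ∀ {x}, x ∈ c.O → ‖η x‖ ≤ cc * c.Mx := fun hx =>
    (ηb hx).trans (mul_le_mul_of_nonneg_left (Ctx.norm_le_Mx hx) cc0)
  have ub : ∀ {x}, x ∈ c.O → ‖c.uu V x‖ ≤ 1 + aa * c.Mx := by
    intro x hx
    refine le_trans (ray_lt c.O_open h.star (fun y hy => (un hy).differentiableAt.differentiableWithinAt)
      (B := fun t => 1 + aa * t) (B' := fun _ => aa) (fun t => by simpa using ((hasDerivAt_id t).const_mul aa).const_add 1)
      (by simp [n.u0 h]) (fun y hy hyy => ?_) hx) ?_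
    · rw [ue hy, norm_mul, norm_mul, hyy]
      refine lt_of_le_of_lt ?_ i2
      have := Ctx.norm_le_Mx hy
      gcongr
      · exact vW hy
      · exact ηb' hy
    · have := Ctx.norm_le_Mx hx
      gcongr
  intro x hx
  refine le_trans ?_ i3
  rw [qe hx, norm_mul]
  refine mul_le_mul (ub hx) ?_ (norm_nonneg _) (by positivity)
  refine (norm_add_le _ _).trans (add_le_add (hc1 x hx) ?_)
  rw [norm_mul, norm_mul, norm_pow]
  have a1 : ‖(3/2:ℂ)‖ = 3/2 := by norm_num
  rw [a1]
  have := vW hx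
  have := ηb' hx
  gcongr

/-- everything needed about the renormalized objects -/
structure Good (c : Ctx) (n : ℕ) (u : St) : Prop where
  reg : Reg c u
  ptl : Pt c u n u.l
  pt : ∀ x ∈ closedBall (c.m:ℂ) c.R, Pt c u n (u.lh n * x)
  ss : ∀ x ∈ closedBall (c.m:ℂ) c.R, u.ss n (u.lh n * x) ∈ c.O
  l1 : u.lh n ≠ 1
  ph : ∀ x ∈ c.O, 1 + u.kk n * u.hh n x ≠ 0
  out : Nrm c (u.T n).V
  V' : ∀ x ∈ c.O, deriv (u.T n).V x ≠ 0

lemma good_of (h : c.Ok) {n : ℕ} (R : Reg c u) (hl : Pt c u n u.l)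
    (hp : ∀ x ∈ closedBall (c.m:ℂ) c.R, Pt c u n (u.lh n * x)) (l1 : u.lh n ≠ 1)
    {R' c1 cN : ℝ} (hR' : R' < c.R)
    (hs : ∀ x ∈ sphere (c.m:ℂ) c.R, ‖u.ss n (u.lh n * x) - c.m‖ ≤ R')
    (hN : ∀ x ∈ sphere (c.m:ℂ) c.R, ‖u.lh n * (u.sN n (u.lh n * x) + u.sg n (u.lh n * x) * u.NG (u.ss n (u.lh n * x)))‖ ≤ cN)
    (hS : ∀ x ∈ sphere (c.m:ℂ) c.R, ‖((u.lh n ^2 * (u.sS n (u.lh n * x) + u.sg n (u.lh n * x)^2 * SV u.V (u.ss n (u.lh n * x))))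
      - SV c.V0 x) / c.v0 x‖ ≤ c1)
    (cN0 : 0 < cN) (hcN : cN * c.Mx < 1/2) : 
    Good c n u ∧ ∀ x ∈ c.O, ‖(SV (u.T n).V x - SV c.V0 x) / c.v0 x‖ ≤ c1 := by
  obtain ⟨-, l0⟩ := R.lh_eq hl
  have M0 := h.Mx_pos
  have cb : c.O ⊆ closedBall (c.m:ℂ) c.R := ball_subset_closedBall
  have sph : sphere (c.m:ℂ) c.R ⊆ closedBall (c.m:ℂ) c.R := sphere_subset_closedBall
  have ssO : ∀ x ∈ closedBall (c.m:ℂ) c.R, u.ss n (u.lh n * x) ∈ c.O := by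
    intro x hx
    rw [Ctx.O, mem_ball, dist_eq_norm]
    refine lt_of_le_of_lt (max_mod (f := fun x => u.ss n (u.lh n * x) - c.m) h.R0 (fun y hy => ?_) hs hx) hR'
    exact ((Jet.lin (u.lh n) y l0).comp (R.jetSS (hp y hy))).an.sub analyticAt_const
  have J : ∀ x ∈ closedBall (c.m:ℂ) c.R, _ := fun x hx => R.jetGG (hp x hx) (ssO x hx) l0
  have ga : ∀ x ∈ closedBall (c.m:ℂ) c.R, AnalyticAt ℂ (u.gg n) x ∧ deriv (u.gg n) x ≠ 0 := by
    intro x hx; obtain ⟨d, j⟩ := J x hx; exact ⟨j.an, by rw [j.h1]; exact j.d0⟩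
  have gN : ∀ x ∈ closedBall (c.m:ℂ) c.R, ‖NV (u.gg n) x‖ ≤ cN := by
    intro x hx
    refine max_mod h.R0 (fun y hy => NV_an (ga y hy).1 (ga y hy).2) (fun y hy => ?_) hx
    obtain ⟨d, j⟩ := J y (sph hy)
    rw [j.N_eq]; exact hN y hy
  have gS : ∀ x ∈ closedBall (c.m:ℂ) c.R, ‖(SV (u.gg n) x - SV c.V0 x) / c.v0 x‖ ≤ c1 := by
    intro x hx
    refine max_mod (f := fun x => (SV (u.gg n) x - SV c.V0 x) / c.v0 x) h.R0 (fun y hy => ?_) (fun y hy => ?_) hx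
    · have := h.v0_ne (Ctx.norm_le_Mx' hy)
      exact ((SV_an (ga y hy).1 (ga y hy).2).sub (SV_an (h.dV.analyticAt y) this)).div (h.v0_an y) this
    · obtain ⟨d, j⟩ := J y (sph hy)
      simp only [j.S_eq]; exact hS y hy
  have m0 : (0:ℂ) ∈ closedBall (c.m:ℂ) c.R := cb h.mem0
  -- hh
  have g0 := (ga 0 m0).2
  have HJ : ∀ x ∈ closedBall (c.m:ℂ) c.R,
      Jet (u.hh n) x (deriv (u.gg n) x / deriv (u.gg n) 0) (NV (u.gg n) x) (SV (u.gg n) x) := by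
    intro x hx
    have j := (Jet.of (ga x hx).1 (ga x hx).2).comp (Jet.mob 1 (-u.gg n 0) 0 (deriv (u.gg n) 0) _ (by simpa using g0) (by simpa using g0))
    refine j.congr ?_ ?_ (by simp) (by simp)
    · filter_upwards with y; rw [St.hh]; simp [sub_eq_add_neg]
    · simp; field_simp
  have hh1 : deriv (u.hh n) 0 = 1 := by rw [(HJ 0 m0).h1, div_self g0]
  have hh0 : u.hh n 0 = 0 := by simp [St.hh]
  have kke : u.kk n = NV (u.gg n) 0 / 2 := by
    rw [St.kk, (HJ 0 m0).h2, div_self g0, mul_one]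
  have hb1 : ∀ x ∈ c.O, ‖deriv (u.hh n) x‖ ≤ 2 := by
    intro x hx
    refine le_trans (ray_lt c.O_open h.star (f := deriv (u.hh n))
      (fun y hy => (HJ y (cb hy)).an.deriv.differentiableAt.differentiableWithinAt)
      (B := fun t => 1 + 2*cN * t) (B' := fun _ => 2*cN) (fun t => by simpa using ((hasDerivAt_id t).const_mul (2*cN)).const_add 1)
      (by simp [hh1]) (fun y hy hyy => ?_) hx) ?_
    · rw [(HJ y (cb hy)).h2, ← (HJ y (cb hy)).h1, norm_mul, hyy]
      have a1 := gN y (cb hy)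
      have a2 := Ctx.norm_le_Mx hy
      have : ‖NV (u.gg n) y‖ * (1 + 2*cN*‖y‖) ≤ cN * (1+2*cN*c.Mx) := by gcongr
      nlinarith
    · have a2 := Ctx.norm_le_Mx hx
      have : cN * ‖x‖ ≤ cN * c.Mx := by gcongr
      linarith
  have hb : ∀ x ∈ c.O, ‖u.hh n x‖ ≤ 2 * ‖x‖ := by
    intro x hx
    exact ray_le c.O_open h.star (f := u.hh n)
      (fun y hy => (HJ y (cb hy)).an.differentiableAt.differentiableWithinAt)
      (B := fun t => 2 * t) (B' := fun _ => 2) (fun t => by simpa using ((hasDerivAt_id t).const_mul 2))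
      (by simp [hh0]) hb1 hx
  have kh : ∀ x ∈ c.O, 1 + u.kk n * u.hh n x ≠ 0 := by
    intro x hx h0
    have e : u.kk n * u.hh n x = -1 := by linear_combination h0
    have e1 : ‖u.kk n * u.hh n x‖ = 1 := by rw [e]; simp
    rw [norm_mul, kke, norm_div] at e1
    have a1 := gN 0 m0
    have a2 := hb x hx
    have a3 := Ctx.norm_le_Mx hx
    have : ‖NV (u.gg n) 0‖ / ‖(2:ℂ)‖ * ‖u.hh n x‖ ≤ cN/2 * (2 * c.Mx) := by
      rw [Complex.norm_ofNat]
      gcongr; linarith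
    linarith
  have VJ : ∀ x ∈ c.O, ∃ d N, Jet (u.T n).V x d N (SV (u.gg n) x) ∧ 
      d = 1 / (u.kk n * u.hh n x + 1)^2 * deriv (u.hh n) x ∧
      N = NV (u.gg n) x + deriv (u.hh n) x * (-2*u.kk n/(u.kk n * u.hh n x+1)) := by
    intro x hx
    have k1 : u.kk n * u.hh n x + 1 ≠ 0 := by rw [add_comm]; exact kh x hx
    have j := (HJ x (cb hx)).comp (Jet.mob 1 0 (u.kk n) 1 _ k1 (by simp))
    refine ⟨_, _, j.congr ?_ rfl rfl (by ring), ?_, ?_⟩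
    · filter_upwards with y; simp [St.T, add_comm]
    · rw [(HJ x (cb hx)).h1]; ring
    · rw [(HJ x (cb hx)).h1]
  have nrm : Nrm c (u.T n).V := by
    obtain ⟨d, N, j, hd, hN'⟩ := VJ 0 h.mem0
    have hd1 : d = 1 := by rw [hd, hh0, hh1]; simp
    refine ⟨fun x hx => ?_, by simp [St.T, hh0], by rw [j.h1, hd1], ?_⟩
    · obtain ⟨d, N, j, -⟩ := VJ x hx; exact j.an.differentiableAt.differentiableWithinAt
    · rw [j.h2, hN', hh0, hh1, kke]; simp; left; ring
  refine ⟨⟨R, hl, hp, ssO, l1, kh, nrm, fun x hx => ?_⟩, fun x hx => ?_⟩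
  · obtain ⟨d, N, j, -⟩ := VJ x hx; rw [j.h1]; exact j.d0
  · obtain ⟨d, N, j, -⟩ := VJ x hx; rw [j.S_eq]; exact gS x (cb hx)

/-- formula for the new `e` -/
lemma e_new (h : c.Ok) {n : ℕ} (g : Good c n u) :
    (u.T n).e = -(u.lh n / 2 * (u.sN n 0 + 2 * u.e + u.sg n 0 * u.NG (u.ss n 0))) / (1 - u.lh n) := by
  obtain ⟨-, l0⟩ := g.reg.lh_eq g.ptl
  have m0 : (0:ℂ) ∈ closedBall (c.m:ℂ) c.R := ball_subset_closedBall h.mem0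
  have J := g.reg.jetGG (g.pt 0 m0) (g.ss 0 m0) l0
  simp only [mul_zero] at J
  obtain ⟨d, j⟩ := J
  have kke : u.kk n = NV (u.gg n) 0 / 2 := by
    have e1 : deriv (u.hh n) =ᶠ[nhds 0] fun x => deriv (u.gg n) x / deriv (u.gg n) 0 := by
      filter_upwards [j.an.eventually_analyticAt] with y hy
      exact ((hy.differentiableAt.hasDerivAt.sub_const _).div_const _).deriv
    rw [St.kk, e1.deriv_eq, deriv_div_const]
    rfl
  simp only [St.T]
  rw [kke, j.N_eq]
  congr 1; ring

end RN
end

section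
open Metric
namespace RN

def mu (a b : ℤ) : ℤ := a*b/K+1
def du (a b : ℤ) : ℤ := a*K/b+1
lemma mu_spec {x y : ℝ} {a b : ℤ} (hx : 0 ≤ x) (hy : 0 ≤ y) (ha : K*x ≤ a) (hb : K*y ≤ b) : K*(x*y) ≤ mu a b := by
  have h := ediv_ub (a*b) K K_pos'
  have k := K_pos
  refine le_trans ?_ h
  rw [le_div_iff₀ k]; push_cast
  have := mul_le_mul ha hb (by positivity) ((by positivity : (0:ℝ) ≤ K*x).trans ha)
  linarith
lemma du_spec {x y : ℝ} {a b : ℤ} (hx : 0 ≤ x) (ha : K*x ≤ a) (hb : 0 < b) (hy : b ≤ K*y) : K*(x/y) ≤ du a b := by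
  have h := ediv_ub (a*K) b hb
  have k := K_pos
  have hb' : (0:ℝ) < b := by exact_mod_cast hb
  have hy' : 0 < y := (pos_iff_pos_of_mul_pos (hb'.trans_le hy)).1 k
  refine le_trans ?_ h
  push_cast
  rw [← mul_div_assoc, div_le_div_iff₀ hy' hb']
  have := mul_le_mul ha hy hb'.le ((by positivity : (0:ℝ) ≤ K*x).trans ha)
  linarith

noncomputable def ev : List ℤ → ℂ → ℂ
  | [], _ => 0
  | a :: l, x => (a:ℂ)/K + x * ev l x
def addL : List ℤ → List ℤ → List ℤ
  | [], b => b
  | a, [] => a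
  | x :: a, y :: b => (x+y) :: addL a b
def der : List ℤ → List ℤ
  | [] => []
  | [_] => []
  | _ :: b :: l => addL (b :: l) (0 :: der (b :: l))
def hor : List ℤ → D → D
  | [], _ => D.of 0
  | a :: l, X => (D.of a).add (X.mul (hor l X))
def evu : List ℤ → ℤ → ℤ
  | [], _ => 0
  | a :: l, M => |a| + mu M (evu l M)

lemma Kc : (K:ℂ) ≠ 0 := by exact_mod_cast K_pos'.ne'
lemma ev_add (a b : List ℤ) (x : ℂ) : ev (addL a b) x = ev a x + ev b x := by
  induction a generalizing b with
  | nil => simp [addL, ev]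
  | cons a l ih =>
    cases b with
    | nil => simp [addL, ev]
    | cons b t => simp only [addL, ev, ih]; push_cast; ring
lemma ev_der (l : List ℤ) (x : ℂ) : HasDerivAt (ev l) (ev (der l) x) x := by
  induction l with
  | nil => exact (hasDerivAt_const x (0:ℂ))
  | cons a l ih =>
    have := ((hasDerivAt_id x).mul ih).const_add ((a:ℂ)/K)
    refine this.congr_deriv ?_
    cases l with
    | nil => simp [der, ev]
    | cons b l => simp only [der, ev_add]; simp [ev]
lemma ev_deriv (l : List ℤ) : deriv (ev l) = ev (der l) := funext fun x => (ev_der l x).deriv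
lemma ev_cj (l : List ℤ) (x : ℂ) : ev l (starRingEnd ℂ x) = starRingEnd ℂ (ev l x) := by
  induction l with
  | nil => simp [ev]
  | cons a l ih => simp [ev, ih]
lemma mem_hor (l : List ℤ) {X : D} {x : ℂ} (hx : X.mem x) : (hor l X).mem (ev l x) := by
  induction l with
  | nil => exact mem_of 0 (by simp [ev])
  | cons a l ih =>
    exact mem_add (mem_of a (by rw [mul_comm, div_mul_cancel₀ _ Kc])) (mem_mul hx ih)
lemma evu_spec (l : List ℤ) {M : ℤ} {x : ℂ} (hx : K*‖x‖ ≤ M) : K*‖ev l x‖ ≤ evu l M := by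
  induction l with
  | nil => simp [ev, evu]
  | cons a l ih =>
    have := mu_spec (norm_nonneg _) (norm_nonneg _) hx ih
    simp only [ev, evu]; push_cast
    have k := K_pos
    have h2 : K * ‖(a:ℂ)/K + x * ev l x‖ ≤ K * (‖(a:ℂ)/K‖ + ‖x * ev l x‖) :=
      mul_le_mul_of_nonneg_left (norm_add_le _ _) k.le
    rw [norm_div, norm_mul, Complex.norm_intCast, Complex.norm_intCast, abs_of_pos k, mul_add, mul_div_cancel₀ _ k.ne'] at h2
    push_cast at *
    linarith

structure Par where
  (m R ka l0 ep e0 A b0 be P : ℤ)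
  (c0 c1 c2 c3 t : List ℤ)
  (md : ℕ) (Yc Yr : ℤ)
  (th q1 qN qc qa : ℤ)
  (dep : ℕ) (h0 : ℤ)

noncomputable def Par.ctx (p : Par) : Ctx :=
  ⟨p.m/K, p.R/K, p.ka/K, p.l0/K, p.ep/K, p.e0/K, p.A/K, p.b0/K, p.be/K, p.P/K, ev p.c0⟩
def Par.Mx (p : Par) : ℤ := |p.m| + p.R
def Par.W (p : Par) : ℤ := K + mu p.ka (mu p.Mx p.Mx)

def Par.ok (p : Par) : Prop :=
  der p.c0 = p.c1 ∧ der p.c1 = p.c2 ∧ der p.c2 = p.c3 ∧ p.c0.headD 1 = 0 ∧ p.c1 = K :: 0 :: p.t ∧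
  0 < p.R ∧ |p.m| < p.R ∧ |K - p.m| < p.R ∧ 0 ≤ p.ka ∧ mu p.ka (mu p.Mx p.Mx) < K ∧
  evu p.t p.Mx ≤ p.ka ∧ 0 < p.P ∧ 0 < p.ep ∧ 0 < p.A ∧ 0 < p.be
instance (p : Par) : Decidable p.ok := by unfold Par.ok; infer_instance

lemma Par.MxK (p : Par) : (K:ℝ) * p.ctx.Mx = p.Mx := by
  have k := K_pos
  simp only [Ctx.Mx, Par.ctx, Par.Mx, abs_div, abs_of_pos k]; push_cast; field_simp
lemma Par.v0 {p : Par} (h : p.ok) : p.ctx.v0 = ev p.c1 := by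
  rw [← h.1]; exact ev_deriv _
lemma KK (x : ℝ) : (K:ℝ) * (x/K) = x := by have := K_pos; field_simp

lemma Par.Ok {p : Par} (h : p.ok) : p.ctx.Ok := by
  have v0 := Par.v0 h
  have mxk := p.MxK
  obtain ⟨d0, d1, d2, hd, hc, R0, m0, m1, ka0, kaM, hv, P0, ep0, A0, be0⟩ := h
  have k := K_pos
  have pos : ∀ {a : ℤ}, 0 < a → (0:ℝ) < a/K := fun ha => div_pos (by exact_mod_cast ha) k
  have R0' : (0:ℝ) < p.R := by exact_mod_cast R0
  have Mx0 : 0 ≤ p.ctx.Mx := by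
    simp only [Ctx.Mx, Par.ctx]; positivity
  have ka0' : (0:ℝ) ≤ p.ka := by exact_mod_cast ka0
  refine ⟨fun x => (ev_der _ x).differentiableAt, ?_, ?_, ?_, pos R0, ?_, ?_, ?_, ?_, ?_, pos P0, pos ep0, pos A0, pos be0, ev_cj _⟩
  · simp only [Par.ctx]
    rcases hh : p.c0 with _ | ⟨a, l⟩
    · simp [ev]
    · rw [hh] at hd; simp at hd; simp [ev, hd]
  · rw [v0, hc]; simp [ev, K_pos'.ne']
  · rw [v0, ev_deriv, hc]; simp [der, ev_add, ev]
  · simp only [Par.ctx]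
    rw [abs_div, abs_of_pos k]
    have : |(p.m:ℝ)| < p.R := by exact_mod_cast m0
    gcongr
  · simp only [Par.ctx]
    have : (1:ℝ) - p.m/K = (K - p.m)/K := by field_simp
    rw [this, abs_div, abs_of_pos k]
    have : |(K - p.m:ℝ)| < p.R := by exact_mod_cast m1
    gcongr
  · simp only [Par.ctx]; positivity
  · have a1 := mu_spec Mx0 Mx0 mxk.le mxk.le
    have a2 := mu_spec (x := p.ctx.ka) (by simp only [Par.ctx]; positivity) (mul_nonneg Mx0 Mx0) (KK _).le a1
    have a3 : (mu p.ka (mu p.Mx p.Mx) : ℝ) < K := by exact_mod_cast kaM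
    have := a2.trans_lt a3
    rw [pow_two]
    nlinarith
  · intro x hx
    rw [v0, hc]
    have e : ev (K :: 0 :: p.t) x - 1 = x^2 * ev p.t x := by simp [ev, K_pos'.ne']; ring
    rw [e, norm_mul, norm_pow, mul_comm]
    refine mul_le_mul_of_nonneg_right ?_ (by positivity)
    have a1 := evu_spec p.t (M := p.Mx) (x := x) (by rw [← mxk]; gcongr)
    have a2 : (evu p.t p.Mx : ℝ) ≤ p.ka := by exact_mod_cast hv
    simp only [Par.ctx]
    rw [le_div_iff₀ k]; linarith

def Par.eD (p : Par) : D := D.mk p.e0 0 p.A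
def Par.bD (p : Par) : D := D.mk p.b0 0 p.be
def Par.lD (p : Par) : D := D.mk p.l0 0 p.ep

def inp (p : Par) (X : D) (k : D → D → D → D → Bool) : Bool :=
  match X.mag with
  | none => false
  | some M => fI (mu M M) fun M2 => fI (mu p.ka M2) fun kM =>
    fI (K + kM) fun w1 => fI (mu (mu p.P M) w1) fun B1 => fI (mu p.P (mu M2 (K/2 + (kM/4+1)))) fun B0 =>
    fI (mu p.W (mu p.P (mu (mu M2 M) (K/6+1+(kM/20+1))))) fun Ve =>
    fI (du B1 (K-B0)) fun d => 
    fI (du (mu w1 p.P) (K-B0) + (3*mu d d/2+1)) fun Se =>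
    if B0 < K then
      (hor p.c1 X).bd fun v => v.inv.bd fun iv => ((hor p.c2 X).mul iv).bd fun N0 =>
      (((hor p.c3 X).mul iv).sub ((D.of (3*K/2)).mul (N0.mul N0))).bd fun S0 =>
      ((hor p.c0 X).err Ve).bd fun V => (v.mul (D.mk K 0 B0)).bd fun V' =>
      (N0.err d).bd fun N => (S0.err Se).bd fun S => k V V' N S
    else false

lemma mem_half : (D.of (K/2)).mem (1/2) := mem_of _ (by norm_num [K])
lemma mem_32 : (D.of (3*K/2)).mem (3/2) := mem_of _ (by norm_num [K])
lemma mem_38 : (D.of (3*K/8)).mem (3/8) := mem_of _ (by norm_num [K])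
lemma mem_one : (D.of K).mem 1 := mem_of _ (by norm_num [K])
lemma mem_two : (D.of (2*K)).mem 2 := mem_of _ (by norm_num [K])

lemma mem_S0 {p : Par} (h : p.ok) {X v N0 : D} {x : ℂ} (hx : X.mem x)
    (hv : v.mem (ev p.c1 x)) (hN : N0.mem (NV p.ctx.V0 x)) :
    (((hor p.c3 X).mul v.inv).sub ((D.of (3*K/2)).mul (N0.mul N0))).mem (SV p.ctx.V0 x) := by
  have e : SV p.ctx.V0 x = ev p.c3 x * (ev p.c1 x)⁻¹ - 3/2 * (NV p.ctx.V0 x * NV p.ctx.V0 x) := by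
    rw [SV, pow_two, ← div_eq_mul_inv]
    simp only [Par.ctx]
    rw [ev_deriv, h.1, ev_deriv, h.2.1, ev_deriv, h.2.2.1]
  rw [e]
  exact mem_sub (mem_mul (mem_hor _ hx) (mem_inv hv)) (mem_mul mem_32 (mem_mul hN hN))
lemma mem_N0 {p : Par} (h : p.ok) {X v : D} {x : ℂ} (hx : X.mem x)
    (hv : v.mem (ev p.c1 x)) : ((hor p.c2 X).mul v.inv).mem (NV p.ctx.V0 x) := by
  have e : NV p.ctx.V0 x = ev p.c2 x * (ev p.c1 x)⁻¹ := by
    rw [NV, ← div_eq_mul_inv]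
    simp only [Par.ctx]
    rw [ev_deriv, h.1, ev_deriv, h.2.1]
  rw [e]
  exact mem_mul (mem_hor _ hx) (mem_inv hv)

lemma inp_spec {p : Par} (h : p.ok) {X : D} {k} (hi : inp p X k = true) :
    ∃ V V' N S, k V V' N S = true ∧ ∀ {u : St}, Dom p.ctx 1 u → ∀ {x : ℂ}, x ∈ p.ctx.O → X.mem x →
      V.mem (u.V x) ∧ V'.mem (deriv u.V x) ∧ N.mem (NV u.V x) ∧ S.mem (SV u.V x) ∧ deriv u.V x ≠ 0 := by
  unfold inp at hi
  split at hi
  · simp at hi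
  rename_i M hM
  simp only [fI_eq, D.bd_eq] at hi
  split_ifs at hi with hB
  refine ⟨_, _, _, _, hi, ?_⟩
  intro u hu x hO hx
  have O := Par.Ok h
  have n := hu.nrm
  have k := K_pos
  have hq : ∀ x ∈ p.ctx.O, ‖p.ctx.q u.V x‖ ≤ p.ctx.P := fun x hx => by simpa using hu.hq x hx
  have hm := mag_spec hM hx
  have x0 := norm_nonneg x
  set t := ‖x‖
  have P0 := O.P0
  have ka0 := O.ka0
  have hP : (K:ℝ)*p.ctx.P ≤ p.P := (KK _).le
  have hka : (K:ℝ)*p.ctx.ka ≤ p.ka := (KK _).le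
  have M2 := mu_spec x0 x0 hm hm
  set m2 := mu M M
  have kM := mu_spec ka0 (mul_nonneg x0 x0) hka M2
  set km := mu p.ka m2
  have w1 : (K:ℝ) * (1 + p.ctx.ka * t^2) ≤ ((K+km:ℤ):ℝ) := by push_cast; rw [pow_two]; linarith
  have pw : 0 ≤ 1 + p.ctx.ka * t^2 := by positivity
  have B1 := mu_spec (by positivity) pw (mu_spec P0.le x0 hP hm) w1
  have q4 := ediv_ub km 4 (by norm_num)
  have q20 := ediv_ub km 20 (by norm_num)
  have q6 := ediv_ub K 6 (by norm_num)
  have q2 : ((K/2:ℤ):ℝ) = K/2 := by norm_num [K]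
  have B0 := mu_spec P0.le (by positivity) hP (mu_spec (by positivity) (y := 1/2+p.ctx.ka*t^2/4) (by positivity) M2 
    (b := K/2+(km/4+1)) (by push_cast at *; rw [q2, pow_two]; linarith))
  have hW : (K:ℝ) * (1+p.ctx.ka*p.ctx.Mx^2) ≤ p.W := by
    have a1 := mu_spec O.Mx_pos.le O.Mx_pos.le p.MxK.le p.MxK.le
    have a2 := mu_spec ka0 (by have := O.Mx_pos; positivity) hka a1
    rw [Par.W]; push_cast; rw [pow_two]; linarith
  have hVe := mu_spec (by positivity) (by positivity) hW (mu_spec P0.le (by positivity) hP (mu_spec (by positivity) 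
    (y := 1/6+p.ctx.ka*t^2/20) (by positivity) (mu_spec (by positivity) x0 M2 hm)
    (b := K/6+1+(km/20+1)) (by push_cast at *; rw [pow_two]; linarith)))
  rw [show t*t*t = t^3 by ring] at hVe
  rw [← pow_two] at B0
  set b0 := mu p.P (mu m2 (K / 2 + (km / 4 + 1)))
  set b1 := mu (mu p.P M) (K+km)
  have c0 : p.ctx.P * (t^2 * (1/2 + p.ctx.ka * t^2/4)) ≤ (b0:ℝ)/K := by
    rw [le_div_iff₀ k]; linarith
  have c1 : p.ctx.P * t * (1 + p.ctx.ka * t^2) ≤ (b1:ℝ)/K := by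
    rw [le_div_iff₀ k]; linarith
  have hB' : (b0:ℝ) < K := by exact_mod_cast hB
  obtain ⟨n0, nN, nS⟩ := NS_bd O n hq hO c0 (by rwa [div_lt_one k]) c1 le_rfl
  have b1' : (0:ℝ) ≤ b1/K := le_trans (by positivity) c1
  have hBi : 0 < K - b0 := by omega
  have dd := du_spec (y := 1 - b0/K) b1' (KK _).le hBi (by push_cast; field_simp; exact le_rfl)
  have b0' : 0 < 1 - (b0:ℝ)/K := by rw [sub_pos, div_lt_one k]; exact hB'
  have se := du_spec (y := 1 - b0/K) (by positivity) (mu_spec pw P0.le w1 hP) hBi (by push_cast; field_simp; exact le_rfl)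
  set d := du b1 (K-b0)
  have dn : 0 ≤ (b1:ℝ)/K/(1-b0/K) := by positivity
  have d2 := mu_spec dn dn dd dd
  have q3 := ediv_ub (3*mu d d) 2 (by norm_num)
  have hv : (hor p.c1 X).mem (ev p.c1 x) := mem_hor _ hx
  have vv := Par.v0 h
  refine ⟨mem_err (mem_hor _ hx) ((mul_le_mul_of_nonneg_left (V_bd O n hq P0.le hO) k.le).trans hVe), ?_, ?_, ?_, n0⟩
  · rw [Vd_eq O n hq hO, vv]
    refine mem_mul hv ?_
    have := (u_bd O n hq hO).trans c0
    rw [le_div_iff₀ k] at this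
    refine mem_err (X := D.of K) (s := b0) mem_one (by linarith) |> fun h => ?_
    simpa [D.err, D.of] using h
  · refine mem_err (mem_N0 h hx hv) ((mul_le_mul_of_nonneg_left nN k.le).trans dd)
  · refine mem_err (mem_S0 h hx hv (mem_N0 h hx hv)) ((mul_le_mul_of_nonneg_left nS k.le).trans ?_)
    push_cast at *
    rw [mul_add]
    refine add_le_add se ?_
    rw [pow_two]; linarith
end RN
end

section
open Metric
namespace RN

lemma mem_mk {c s : ℤ} {x : ℂ} (h : ‖x - (c:ℂ)/K‖ ≤ (s:ℝ)/K) : (D.mk c 0 s).mem x := by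
  have k := K_pos
  rw [le_div_iff₀ k] at h
  simp only [D.mem]
  have : (K:ℂ) * x - ((c:ℂ) + ((0:ℤ):ℂ) * Complex.I) = (x - (c:ℂ)/K) * K := by
    have := Kc; push_cast; field_simp; ring
  rw [this, norm_mul, Complex.norm_intCast, abs_of_pos k]; exact h
lemma O_of {p : Par} {x : ℂ} (h : ‖x - (p.m:ℂ)/K‖ ≤ ((p.R-1:ℤ):ℝ)/K) : x ∈ p.ctx.O := by
  have k := K_pos
  rw [Ctx.O, mem_ball, dist_eq_norm]
  simp only [Par.ctx]
  push_cast at h ⊢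
  refine h.trans_lt ?_
  gcongr; linarith

variable {p : Par} {u : St}
lemma mem_eD (hu : Dom p.ctx 1 u) : p.eD.mem u.e := mem_mk (by have := hu.he; simpa [Par.ctx] using this)
lemma mem_bD (hu : Dom p.ctx 1 u) : p.bD.mem u.b := mem_mk (by have := hu.hb; simpa [Par.ctx] using this)
lemma mem_lD (hu : Dom p.ctx 1 u) : p.lD.mem u.l := mem_mk (by have := hu.hl; simpa [Par.ctx] using this)

def core (p : Par) (Y : D) (k : D → D → D → D → D → Bool) : Bool :=
  if Y.inn p.m (p.R-1) then inp p Y fun V V' N S =>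
    ((D.of K).add (p.eD.mul V)).inv.bd fun q =>
    (N.sub ((D.of (2*K)).mul ((p.eD.mul V').mul q))).bd fun NG => k V q V' NG S
  else false
lemma core_spec (h : p.ok) {Y : D} {k} (hi : core p Y k = true) :
    ∃ V q V' NG S, k V q V' NG S = true ∧ ∀ {u : St}, Dom p.ctx 1 u → ∀ {y : ℂ}, Y.mem y →
      y ∈ p.ctx.O ∧ ‖y - (p.m:ℂ)/K‖ ≤ ((p.R-1:ℤ):ℝ)/K ∧ V.mem (u.V y) ∧ q.mem ((1 + u.e * u.V y)⁻¹) ∧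
      V'.mem (deriv u.V y) ∧ NG.mem (u.NG y) ∧ S.mem (SV u.V y) := by
  unfold core at hi
  split_ifs at hi with hY
  obtain ⟨V, V', N, S, hk, H⟩ := inp_spec h hi
  simp only [D.bd_eq] at hk
  refine ⟨_, _, _, _, _, hk, ?_⟩
  intro u hu y hy
  have a := inn_spec hY hy
  have hO := O_of a
  obtain ⟨b1, b2, b3, b4, -⟩ := H hu hO hy
  have q := mem_inv (mem_add mem_one (mem_mul (mem_eD hu) b1))
  refine ⟨hO, a, b1, q, b2, ?_, b4⟩
  rw [St.NG, mul_div_assoc, div_eq_mul_inv (u.e * _)]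
  exact mem_sub b3 (mem_mul mem_two (mem_mul (mem_mul (mem_eD hu) b2) q))

structure Env (p : Par) (one kD : D) : Prop where
  one : ∀ {u : St}, Dom p.ctx 1 u → one.mem (u.V 1)
  kD : ∀ {u : St}, Dom p.ctx 1 u → kD.mem u.k

variable {one kD : D}
def full (p : Par) (one kD Y : D) (k : D → D → D → D → Bool) : Bool :=
  core p Y fun V q V' NG S => (one.sub V).bd fun w => (w.mul q).bd fun G =>
    (((V'.mul kD).mul (w.inv.mul q)).neg).bd fun r => k G r NG S
lemma full_spec (h : p.ok) (E : Env p one kD) {Y : D} {k} (hi : full p one kD Y k = true) :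
    ∃ G r NG S, k G r NG S = true ∧ ∀ {u : St}, Dom p.ctx 1 u → ∀ {y : ℂ}, Y.mem y →
      y ∈ p.ctx.O ∧ G.mem (u.G y) ∧ r.mem (u.r y) ∧ NG.mem (u.NG y) ∧ S.mem (SV u.V y) := by
  unfold full at hi
  obtain ⟨V, q, V', NG, S, hk, H⟩ := core_spec h hi
  simp only [D.bd_eq] at hk
  refine ⟨_, _, _, _, hk, ?_⟩
  intro u hu y hy
  obtain ⟨b0, -, b1, b2, b3, b4, b5⟩ := H hu hy
  have w := mem_sub (E.one hu) b1
  refine ⟨b0, ?_, ?_, b4, b5⟩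
  · rw [St.G, div_eq_mul_inv]; exact mem_mul w b2
  · rw [St.r, neg_div, div_eq_mul_inv, mul_inv]
    exact mem_neg (mem_mul (mem_mul b3 (E.kD hu)) (mem_mul (mem_inv w) b2))

def step (p : Par) (G r : D) (k : D → D → Bool) : Bool :=
  (p.bD.mul G).bd fun w => if w.pos then w.sqrt.neg.bd fun y => ((D.of (K/2)).mul (r.mul y)).bd fun d => k y d else false
lemma step_spec {G r : D} {k} (hi : step p G r k = true) :
    ∃ Y d, k Y d = true ∧ ∀ {u : St}, Dom p.ctx 1 u → ∀ {y : ℂ}, G.mem (u.G y) → r.mem (u.r y) →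
      0 < (u.b * u.G y).re ∧ Y.mem (u.Lm y) ∧ d.mem (u.r y * u.Lm y / 2) := by
  unfold step at hi
  simp only [D.bd_eq] at hi
  split_ifs at hi with hp
  refine ⟨_, _, hi, ?_⟩
  intro u hu y hG hr
  have w := mem_mul (mem_bD hu) hG
  have y' := mem_neg (mem_sqrt w)
  refine ⟨pos_spec hp w, y', ?_⟩
  have e : u.r y * u.Lm y / 2 = 1/2 * (u.r y * u.Lm y) := by ring
  rw [e]
  exact mem_mul mem_half (mem_mul hr y')

def tSD (r S : D) : D := S.add ((D.of (3*K/8)).mul (r.mul r))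
lemma mem_tS {r S : D} {y : ℂ} (hr : r.mem (u.r y)) (hS : S.mem (SV u.V y)) : (tSD r S).mem (u.tS y) := by
  rw [St.tS, pow_two]; exact mem_add hS (mem_mul mem_38 (mem_mul hr hr))
def tND (r NG : D) : D := NG.sub ((D.of (K/2)).mul r)
lemma mem_tN {r NG : D} {y : ℂ} (hr : r.mem (u.r y)) (hS : NG.mem (u.NG y)) : (tND r NG).mem (u.tN y) := by
  rw [St.tN, show u.r y / 2 = 1/2 * u.r y by ring]; exact mem_sub hS (mem_mul mem_half hr)

/-- the lump of all levels `≥ 2` -/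
def lump (p : Par) (one kD y d : D) (k : D → D → ℤ → ℤ → ℤ → Bool) : Bool :=
  if y.inn p.Yc p.Yr then full p one kD (D.mk p.Yc 0 p.Yr) fun G r NG S =>
    step p G r fun y1 d1 => if y1.inn p.Yc p.Yr then
      match d1.mag, d.mag, (tND r NG).mag, (tSD r S).mag with
      | some k1, some dm, some tn, some ts => 
        if k1 < K then
        fI (du (mu dm tn) (K-k1)) fun eN => fI (du (mu (mu dm dm) ts) (K-k1)) fun eS => k G r dm eN eS
        else false
      | _, _, _, _ => false
    else false
  else false

open Finset in
lemma geo {a : ℕ → ℂ} {x k : ℝ} (hk0 : 0 ≤ k) (hk : k < 1) (hx : 0 ≤ x) (h : ∀ i, ‖a i‖ ≤ x * k^i) (n : ℕ) :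
    ‖∑ i ∈ range n, a i‖ ≤ x / (1-k) := by
  refine (norm_sum_le _ _).trans ((sum_le_sum fun i _ => h i).trans ?_)
  rw [← mul_sum, div_eq_mul_inv, ← tsum_geometric_of_lt_one hk0 hk]
  exact mul_le_mul_of_nonneg_left ((summable_geometric_of_lt_one hk0 hk).sum_le_tsum _ (fun i _ => by positivity)) hx

open Finset in
lemma lump_spec (h : p.ok) (E : Env p one kD) {y d : D} {k} (hi : lump p one kD y d k = true) :
    ∃ G r dm eN eS, k G r dm eN eS = true ∧ ∀ {u : St}, Dom p.ctx 1 u → ∀ {z : ℂ}, y.mem (u.y 2 z) → d.mem (u.dj 2 z) →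
      ∀ n, (∀ j ≤ n, u.y (2+j) z ∈ p.ctx.O ∧ 0 < (u.b * u.G (u.y (2+j) z)).re) ∧
       G.mem (u.G (u.y (2+n) z)) ∧ r.mem (u.r (u.y (2+n) z)) ∧ K * ‖u.dj (2+n) z‖ ≤ dm ∧
       K * ‖∑ j ∈ range (n+1), u.dj (2+j) z * u.tN (u.y (2+j) z)‖ ≤ eN ∧
       K * ‖∑ j ∈ range (n+1), u.dj (2+j) z ^ 2 * u.tS (u.y (2+j) z)‖ ≤ eS := by
  unfold lump at hi
  split_ifs at hi with hy
  obtain ⟨G, r, NG, S, hi, H⟩ := full_spec h E hi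
  obtain ⟨y1, d1, hi, H1⟩ := step_spec hi
  split_ifs at hi with hy1
  split at hi
  case h_2 => simp at hi
  rename_i k1 dm tn ts hk1 hdm htn hts
  split_ifs at hi with hk
  simp only [fI_eq] at hi
  refine ⟨_, _, _, _, _, hi, ?_⟩
  intro u hu z hy2 hd2
  have kp := K_pos
  have hk' : (k1:ℝ) < K := by exact_mod_cast hk
  have iY : ∀ j, (D.mk p.Yc 0 p.Yr).mem (u.y (2+j) z) := by
    intro j
    induction j with
    | zero => exact mem_mk (inn_spec hy hy2)
    | succ j ih =>
      obtain ⟨-, a1, a2, -, -⟩ := H hu ih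
      have := (H1 hu a1 a2).2.1
      rw [← add_assoc, St.y, Function.iterate_succ_apply']
      exact mem_mk (inn_spec hy1 this)
  have dstep : ∀ j, K * ‖u.r (u.y (2+j) z) * u.Lm (u.y (2+j) z) / 2‖ ≤ k1 := by
    intro j
    obtain ⟨-, a1, a2, -, -⟩ := H hu (iY j)
    exact mag_spec hk1 (H1 hu a1 a2).2.2
  have k10 : (0:ℝ) ≤ k1 := le_trans (by positivity) (dstep 0)
  set κ : ℝ := k1/K
  have κ0 : 0 ≤ κ := by positivity
  have κ1 : κ < 1 := (div_lt_one kp).2 hk'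
  have ds := mag_spec hdm hd2
  have dj : ∀ j, ‖u.dj (2+j) z‖ ≤ ‖u.dj 2 z‖ * κ^j := by
    intro j
    induction j with
    | zero => simp
    | succ j ih =>
      rw [← add_assoc, St.dj, norm_mul, pow_succ, ← mul_assoc]
      have : u.y (2+j+1) z = u.Lm (u.y (2+j) z) := by rw [St.y, Function.iterate_succ_apply']; rfl
      rw [this]
      exact mul_le_mul ih (by rw [le_div_iff₀ kp]; linarith [dstep j]) (norm_nonneg _) (by positivity)
  have κp : ∀ j, κ^j ≤ 1 := fun j => pow_le_one₀ κ0 κ1.le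
  have tN : ∀ j, K * ‖u.tN (u.y (2+j) z)‖ ≤ tn := fun j => by
    obtain ⟨-, -, a2, a3, -⟩ := H hu (iY j)
    exact mag_spec htn (mem_tN a2 a3)
  have tS : ∀ j, K * ‖u.tS (u.y (2+j) z)‖ ≤ ts := fun j => by
    obtain ⟨-, -, a2, -, a3⟩ := H hu (iY j)
    exact mag_spec hts (mem_tS a2 a3)
  have tn0 : (0:ℝ) ≤ tn := le_trans (by positivity) (tN 0)
  have ts0 : (0:ℝ) ≤ ts := le_trans (by positivity) (tS 0)
  have hKk : (((K-k1:ℤ)):ℝ) ≤ K * (1-κ) := by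
    simp only [κ]; push_cast; field_simp; exact le_rfl
  have hKk0 : 0 < K - k1 := by omega
  intro n
  obtain ⟨a0, a1, a2, -, -⟩ := H hu (iY n)
  refine ⟨fun j _ => ?_, a1, a2, ?_, ?_, ?_⟩
  · obtain ⟨b0, b1, b2, -, -⟩ := H hu (iY j)
    exact ⟨b0, (H1 hu b1 b2).1⟩
  · refine le_trans ?_ ds
    refine mul_le_mul_of_nonneg_left ((dj n).trans ?_) kp.le
    exact mul_le_of_le_one_right (norm_nonneg _) (κp n)
  · refine le_trans (mul_le_mul_of_nonneg_left (geo κ0 κ1 (x := ‖u.dj 2 z‖ * (tn/K)) (by positivity) (fun i => ?_) _) kp.le) ?_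
    · rw [norm_mul, mul_right_comm]
      exact mul_le_mul (dj i) (by rw [le_div_iff₀ kp]; linarith [tN i]) (norm_nonneg _) (by positivity)
    · exact du_spec (by positivity) (mu_spec (by positivity) (by positivity) ds (KK _).le) hKk0 hKk
  · refine le_trans (mul_le_mul_of_nonneg_left (geo κ0 κ1 (x := ‖u.dj 2 z‖ * ‖u.dj 2 z‖ * (ts/K)) (by positivity) (fun i => ?_) _) kp.le) ?_
    · rw [norm_mul, norm_pow, pow_two, mul_right_comm (‖u.dj 2 z‖ * ‖u.dj 2 z‖)]
      refine mul_le_mul ?_ (by rw [le_div_iff₀ kp]; linarith [tS i]) (norm_nonneg _) (by positivity)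
      rw [mul_assoc ‖u.dj 2 z‖]
      refine mul_le_mul ((dj i).trans (mul_le_of_le_one_right (norm_nonneg _) (κp i))) (dj i) (norm_nonneg _) (norm_nonneg _)
    · exact du_spec (by positivity) (mu_spec (by positivity) (by positivity) (mu_spec (by positivity) (by positivity) ds ds) (KK _).le) hKk0 hKk

/-- outputs: G, r, d, SS, NN, NG0 -/
def levels (p : Par) (one kD Z : D) (k : D → D → D → D → D → D → Bool) : Bool :=
  full p one kD Z fun G r NG S => (tSD r S).bd fun SS => ((D.of (K/2)).mul r).neg.bd fun NN =>
  match p.md with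
  | 0 => k G r (D.of K) SS NN NG
  | m+1 => step p G r fun y d => full p one kD y fun G r NG1 S =>
    (SS.add ((d.mul d).mul (tSD r S))).bd fun SS => (NN.add (d.mul (tND r NG1))).bd fun NN =>
    match m with
    | 0 => k G r d SS NN NG
    | _+1 => step p G r fun y d1 => (d.mul d1).bd fun d2 => lump p one kD y d2 fun G r dm eN eS =>
      k G r (D.mk 0 0 dm) (SS.err eS) (NN.err eN) NG

open Finset in
lemma levels_spec (h : p.ok) (E : Env p one kD) {n : ℕ} (hn : p.md = min n 2) {Z : D} {k} (hi : levels p one kD Z k = true) :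
    ∃ G r d SS NN NG, k G r d SS NN NG = true ∧ ∀ {u : St}, Dom p.ctx 1 u → ∀ {z : ℂ}, Z.mem z →
      (∀ j ≤ n, u.y j z ∈ p.ctx.O) ∧ (∀ j < n, 0 < (u.b * u.G (u.y j z)).re) ∧ G.mem (u.G (u.y n z)) ∧
      r.mem (u.r (u.y n z)) ∧ d.mem (u.dj n z) ∧ SS.mem (u.sS n z) ∧ NN.mem (u.sN n z - u.NG z) ∧ NG.mem (u.NG z) := by
  unfold levels at hi
  obtain ⟨G0, r0, NG0, S0, hi, H0⟩ := full_spec h E hi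
  simp only [D.bd_eq] at hi
  have y0 : ∀ (u:St) z, u.y 0 z = z := fun _ _ => rfl
  have dj0 : ∀ (u:St) z, u.dj 0 z = 1 := fun _ _ => rfl
  have yS : ∀ (u:St) j z, u.y (j+1) z = u.Lm (u.y j z) := fun u j z => by rw [St.y, Function.iterate_succ_apply']; rfl
  have djS : ∀ (u:St) j z, u.dj (j+1) z = u.dj j z * (u.r (u.y j z) * u.Lm (u.y j z) / 2) := fun u j z => by rw [St.dj, yS]
  split at hi
  · rename_i hm
    have n0 : n = 0 := by omega
    subst n0
    refine ⟨_, _, _, _, _, _, hi, ?_⟩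
    intro u hu z hz
    obtain ⟨a0, a1, a2, a3, a4⟩ := H0 hu hz
    refine ⟨fun j hj => ?_, fun j hj => by omega, a1, a2, mem_one, ?_, ?_, a3⟩
    · obtain rfl : j = 0 := by omega
      exact a0
    · simpa [St.sS, y0, dj0] using mem_tS a2 a4
    · have : u.sN 0 z - u.NG z = -(1/2 * u.r z) := by simp [St.sN, y0, dj0, St.tN]; ring
      rw [this]; exact mem_neg (mem_mul mem_half a2)
  rename_i m hm
  obtain ⟨Y1, d1, hi, HS1⟩ := step_spec hi
  obtain ⟨G1, r1, NG1, S1, hi, H1⟩ := full_spec h E hi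
  have y1 : ∀ (u:St) z, u.y 1 z = u.Lm z := fun _ _ => rfl
  have dj1 : ∀ (u:St) z, u.dj 1 z = (u.r z * u.Lm z / 2) := fun u z => by rw [djS, dj0, one_mul, y0]
  have nn : ∀ (u:St) z, -(1/2 * u.r z) + (u.r z * u.Lm z / 2) * u.tN (u.Lm z) = u.sN 1 z - u.NG z := fun u z => by
    simp only [St.sN, sum_range_succ, range_zero, sum_empty, y0, dj0, y1, dj1, St.tN]; ring
  have sS : ∀ (u:St) z, u.tS z + (u.r z * u.Lm z / 2)*(u.r z * u.Lm z / 2) * u.tS (u.Lm z) = u.sS 1 z := fun u z => by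
    simp only [St.sS, sum_range_succ, range_zero, sum_empty, y0, dj0, y1, dj1]; ring
  split at hi
  · have n0 : n = 1 := by omega
    subst n0
    refine ⟨_, _, _, _, _, _, hi, ?_⟩
    intro u hu z hz
    obtain ⟨a0, a1, a2, a3, a4⟩ := H0 hu hz
    obtain ⟨b0, b1, b2⟩ := HS1 hu a1 a2
    obtain ⟨c0, c1, c2, c3, c4⟩ := H1 hu b1
    rw [yS, y0, djS, y0, dj0, one_mul, ← nn, ← sS]
    refine ⟨fun j hj => ?_, fun j hj => ?_, c1, c2, b2, ?_, ?_, a3⟩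
    · interval_cases j
      · exact a0
      · rw [yS]; exact c0
    · obtain rfl : j = 0 := by omega
      exact b0
    · exact mem_add (mem_tS a2 a4) (mem_mul (mem_mul b2 b2) (mem_tS c2 c4))
    · exact mem_add (mem_neg (mem_mul mem_half a2)) (mem_mul b2 (mem_tN c2 c3))
  · obtain ⟨Y2, d2, hi, HS2⟩ := step_spec hi
    obtain ⟨G, r, dm, eN, eS, hi, HL⟩ := lump_spec h E hi
    refine ⟨_, _, _, _, _, _, hi, ?_⟩
    obtain ⟨N, rfl⟩ : ∃ N, n = 2 + N := ⟨n-2, by omega⟩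
    intro u hu z hz
    obtain ⟨a0, a1, a2, a3, a4⟩ := H0 hu hz
    obtain ⟨b0, b1, b2⟩ := HS1 hu a1 a2
    obtain ⟨c0, c1, c2, c3, c4⟩ := H1 hu b1
    obtain ⟨e0, e1, e2⟩ := HS2 hu c1 c2
    obtain ⟨f1, f2, f3, f4, f5, f6⟩ := HL hu (z := z) (by rw [yS, yS, y0]; exact e1) (by 
      rw [djS, djS, yS, y0, dj0, one_mul]; exact mem_mul b2 e2) N
    refine ⟨fun j hj => ?_, fun j hj => ?_, f2, f3, ?_, ?_, ?_, a3⟩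
    · rcases j with _ | _ | j
      · exact a0
      · rw [yS]; exact c0
      · rw [show j+1+1 = 2 + j by ring]; exact (f1 j (by omega)).1
    · rcases j with _ | _ | j
      · exact b0
      · rw [yS]; exact e0
      · rw [show j+1+1 = 2 + j by ring]; exact (f1 j (by omega)).2
    · have : (D.mk 0 0 dm).mem (u.dj (2+N) z) := mem_mk (by rw [le_div_iff₀ K_pos]; simp; linarith)
      exact this
    · have e : u.sS (2+N) z = u.sS 1 z + ∑ j ∈ range (N+1), u.dj (2+j) z ^ 2 * u.tS (u.y (2+j) z) := by
        rw [St.sS, St.sS, show 2 + N + 1 = 2 + (N+1) by ring, sum_range_add]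
      refine mem_err (x := u.sS 1 z) ?_ ?_
      · rw [← sS]; exact mem_add (mem_tS a2 a4) (mem_mul (mem_mul b2 b2) (mem_tS c2 c4))
      · rw [e, add_sub_cancel_left]; exact f6
    · have e : u.sN (2+N) z = u.sN 1 z + ∑ j ∈ range (N+1), u.dj (2+j) z * u.tN (u.y (2+j) z) := by
        rw [St.sN, St.sN, show 2 + N + 1 = 2 + (N+1) by ring, sum_range_add]
      refine mem_err (x := u.sN 1 z - u.NG z) ?_ ?_
      · rw [← nn]; exact mem_add (mem_neg (mem_mul mem_half a2)) (mem_mul b2 (mem_tN c2 c3))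
      · rw [e]; ring_nf at f5 ⊢; exact f5
end RN
end

section
open Metric
namespace RN
variable {p : Par} {u : St} {one kD bn ln : D}

def fin (p : Par) (one kD bn Z : D) (k : D → D → D → D → D → D → Bool) : Bool :=
  levels p one kD Z fun G r d SS NN NG => (G.mul bn).bd fun w => if w.pos then w.sqrt.bd fun s =>
    ((D.of (K/2)).mul ((d.mul r).mul s)).bd fun sg => core p s fun _ _ _ NGs Ss => k sg SS NN NG NGs Ss
  else false
lemma fin_spec (h : p.ok) (E : Env p one kD) {n : ℕ} (hn : p.md = min n 2) {Z : D} {k} (hi : fin p one kD bn Z k = true) :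
    ∃ sg SS NN NG NGs Ss, k sg SS NN NG NGs Ss = true ∧ ∀ {u : St}, Dom p.ctx 1 u → bn.mem (u.bh n) → ∀ {z : ℂ}, Z.mem z →
      Pt p.ctx u n z ∧ ‖u.ss n z - (p.m:ℂ)/K‖ ≤ ((p.R-1:ℤ):ℝ)/K ∧ sg.mem (u.sg n z) ∧
      SS.mem (u.sS n z) ∧ NN.mem (u.sN n z - u.NG z) ∧ NG.mem (u.NG z) ∧ NGs.mem (u.NG (u.ss n z)) ∧ Ss.mem (SV u.V (u.ss n z)) := by
  unfold fin at hi
  obtain ⟨G, r, d, SS, NN, NG, hi, H⟩ := levels_spec h E hn hi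
  simp only [D.bd_eq] at hi
  split_ifs at hi with hw
  obtain ⟨_, _, _, NGs, Ss, hi, HC⟩ := core_spec h hi
  refine ⟨_, _, _, _, _, _, hi, ?_⟩
  intro u hu hb z hz
  obtain ⟨a1, a2, a3, a4, a5, a6, a7, a8⟩ := H hu hz
  have w := mem_mul a3 hb
  have s : _ := mem_sqrt w
  obtain ⟨c1, c2, -, -, -, c3, c4⟩ := HC hu s
  refine ⟨⟨a1, a2, pos_spec hw w⟩, c2, ?_, a6, a7, a8, c3, c4⟩
  rw [St.sg, show u.dj n z * u.r (u.y n z) * u.ss n z / 2 = 1/2 * (u.dj n z * u.r (u.y n z) * u.ss n z) by ring]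
  exact mem_mul mem_half (mem_mul (mem_mul a5 a4) s)

def pre (p : Par) (k : D → D → D → D → Bool) : Bool :=
  core p (D.of K) fun one _ _ _ _ => ((D.of K).add (p.eD.mul one)).bd fun kD =>
  kD.pos && (inp p (D.mk p.m 0 p.R) (fun V _ _ _ => ((D.of K).add (p.eD.mul V)).pos) &&
  levels p one kD p.lD fun G r d _ _ _ => G.pos && (G.inv.bd fun bn => ((D.of (K/2)).mul (d.mul r)).bd fun ln =>
    bn.inn p.b0 (p.th*p.be/K) && (ln.inn p.l0 (p.th*p.ep/K) && (((D.of K).sub ln).pos &&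
    (levels p one kD (ln.mul (D.mk p.m 0 p.R)) (fun G _ _ _ _ _ => (G.mul bn).pos) && k one kD bn ln)))))

lemma th_le {a b : ℤ} {x : ℝ} (h : x ≤ ((a*b/K:ℤ):ℝ)/K) : x ≤ (a:ℝ)/K * (b/K) := by
  have k := K_pos
  refine h.trans ?_
  have : ((a*b/K:ℤ):ℝ) ≤ (a*b:ℝ)/K := by
    have h2 : a*b/K*K ≤ a*b := Int.ediv_mul_le _ K_pos'.ne'
    rw [le_div_iff₀ k]; exact_mod_cast h2
  rw [div_le_iff₀ k]
  refine this.trans (le_of_eq ?_)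
  field_simp

lemma mem_Om {x : ℂ} (h : x ∈ closedBall (p.ctx.m:ℂ) p.ctx.R) : (D.mk p.m 0 p.R).mem x := by
  refine mem_mk ?_
  rw [mem_closedBall, dist_eq_norm] at h
  simpa [Par.ctx] using h

lemma re_ne {z : ℂ} (h : 0 < z.re) : z ≠ 0 := by rintro rfl; simp at h

structure Out (p : Par) (n : ℕ) (one kD bn ln : D) (u : St) : Prop where
  reg : Reg p.ctx u
  k0 : 0 < u.k.re
  eV : ∀ x ∈ p.ctx.O, 0 < (1 + u.e * u.V x).re
  ptl : Pt p.ctx u n u.l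
  G0 : 0 < (u.G (u.y n u.l)).re
  pt : ∀ x ∈ closedBall (p.ctx.m:ℂ) p.ctx.R, Pt p.ctx u n (u.lh n * x)
  l1 : 0 < (1 - u.lh n).re
  bn : bn.mem (u.bh n)
  ln : ln.mem (u.lh n)
  hb : ‖u.bh n - p.ctx.b0‖ ≤ p.th/K * p.ctx.be
  hl : ‖u.lh n - p.ctx.l0‖ ≤ p.th/K * p.ctx.ep

lemma pre_spec (h : p.ok) {n : ℕ} (hn : p.md = min n 2) {k} (hi : pre p k = true) :
    ∃ one kD bn ln, k one kD bn ln = true ∧ Env p one kD ∧ ∀ {u : St}, Dom p.ctx 1 u → Out p n one kD bn ln u := by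
  unfold pre at hi
  obtain ⟨one, _, _, _, _, hi, H1⟩ := core_spec h hi
  simp only [D.bd_eq, Bool.and_eq_true] at hi
  obtain ⟨hk, hi1, hi⟩ := hi
  obtain ⟨VO, _, _, _, hV, HO⟩ := inp_spec h hi1
  have E : Env p one ((D.of K).add (p.eD.mul one)) := by
    refine ⟨fun hu => (H1 hu mem_one).2.2.1, fun {u} hu => ?_⟩
    rw [St.k]
    exact mem_add mem_one (mem_mul (mem_eD hu) (H1 hu mem_one).2.2.1)
  obtain ⟨G, r, d, _, _, _, hi, HL⟩ := levels_spec h E hn hi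
  simp only [Bool.and_eq_true] at hi
  obtain ⟨hG, hb, hl, hl1, hlev, hi⟩ := hi
  obtain ⟨G2, _, _, _, _, _, hG2, HL2⟩ := levels_spec h E hn hlev
  refine ⟨_, _, _, _, hi, E, ?_⟩
  intro u hu
  have eV : ∀ x ∈ p.ctx.O, 0 < (1 + u.e * u.V x).re := fun x hx =>
    pos_spec hV (mem_add mem_one (mem_mul (mem_eD hu) (HO hu hx (mem_Om (ball_subset_closedBall hx))).1))
  have k0 := pos_spec hk (E.kD hu)
  have R : Reg p.ctx u := ⟨hu.nrm.d, fun x hx => (HO hu hx (mem_Om (ball_subset_closedBall hx))).2.2.2.2, 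
    fun x hx => re_ne (eV x hx), re_ne k0⟩
  obtain ⟨a1, a2, a3, a4, a5, -, -, -⟩ := HL hu (mem_lD hu)
  have G0 := pos_spec hG a3
  have ptl : Pt p.ctx u n u.l := ⟨a1, a2, by rw [St.bh, mul_inv_cancel₀ (re_ne G0)]; simp⟩
  have bn := mem_inv a3
  have ln : ((D.of (K/2)).mul (d.mul r)).mem (u.lh n) := by
    rw [(R.lh_eq ptl).1, show u.dj n u.l * u.r (u.y n u.l) / 2 = 1/2 * (u.dj n u.l * u.r (u.y n u.l)) by ring]
    exact mem_mul mem_half (mem_mul a5 a4)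
  refine ⟨R, k0, eV, ptl, G0, ?_, pos_spec hl1 (mem_sub mem_one ln), bn, ln, ?_, ?_⟩
  · intro x hx
    obtain ⟨b1, b2, b3, -, -, -, -, -⟩ := HL2 hu (mem_mul ln (mem_Om hx))
    exact ⟨b1, b2, pos_spec hG2 (mem_mul b3 bn)⟩
  · have := inn_spec hb bn
    simp only [Par.ctx]; push_cast
    exact th_le this
  · have := inn_spec hl ln
    simp only [Par.ctx]; push_cast
    exact th_le this

def eChk (p : Par) (one kD bn ln : D) : Bool :=
  fin p one kD bn (D.of 0) fun sg _ NN _ NGs _ =>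
    ((((ln.mul (D.of (K/2))).mul (NN.add (sg.mul NGs))).neg).mul ((D.of K).sub ln).inv).inn p.e0 (p.th*p.A/K)

def leM (X : D) (c : ℤ) : Bool := match X.mag with
  | some m => decide (m ≤ c)
  | none => false
lemma leM_spec {X : D} {c : ℤ} (h : leM X c = true) {x : ℂ} (hx : X.mem x) : ‖x‖ ≤ (c:ℝ)/K := by
  unfold leM at h
  split at h
  · rename_i m hm
    have := mag_spec hm hx
    simp at h
    have h' : (m:ℝ) ≤ c := by exact_mod_cast h
    rw [le_div_iff₀ K_pos]; linarith
  · simp at h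

def cell (p : Par) (one kD bn ln X : D) : Bool :=
  fin p one kD bn (ln.mul X) fun sg SS NN NG NGs Ss =>
    leM (ln.mul ((NN.add NG).add (sg.mul NGs))) p.qN &&
    ((hor p.c1 X).bd fun v => ((hor p.c2 X).mul v.inv).bd fun N0 =>
      leM ((((ln.mul ln).mul (SS.add ((sg.mul sg).mul Ss))).sub
       (((hor p.c3 X).mul v.inv).sub ((D.of (3*K/2)).mul (N0.mul N0)))).mul v.inv) p.q1)

lemma cell_spec (h : p.ok) (E : Env p one kD) {n : ℕ} (hn : p.md = min n 2) {X : D} (hi : cell p one kD bn ln X = true)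
    (hu : Dom p.ctx 1 u) (hb : bn.mem (u.bh n)) (hl : ln.mem (u.lh n)) {x : ℂ} (hx : X.mem x) :
    ‖u.ss n (u.lh n * x) - (p.m:ℂ)/K‖ ≤ ((p.R-1:ℤ):ℝ)/K ∧
    ‖u.lh n * (u.sN n (u.lh n * x) + u.sg n (u.lh n * x) * u.NG (u.ss n (u.lh n * x)))‖ ≤ p.qN/K ∧
    ‖((u.lh n ^2 * (u.sS n (u.lh n * x) + u.sg n (u.lh n * x)^2 * SV u.V (u.ss n (u.lh n * x))))
      - SV p.ctx.V0 x) / p.ctx.v0 x‖ ≤ p.q1/K := by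
  obtain ⟨sg, SS, NN, NG, NGs, Ss, hi, H⟩ := fin_spec h E hn hi
  simp only [D.bd_eq, Bool.and_eq_true] at hi
  obtain ⟨-, a1, a2, a3, a4, a5, a6, a7⟩ := H hu hb (mem_mul hl hx)
  refine ⟨a1, leM_spec hi.1 ?_, leM_spec hi.2 ?_⟩
  · have := mem_mul hl (mem_add (mem_add a4 a5) (mem_mul a2 a6))
    rwa [sub_add_cancel] at this
  · have v : (hor p.c1 X).mem (ev p.c1 x) := mem_hor _ hx
    rw [div_eq_mul_inv, Par.v0 h, pow_two, pow_two]
    exact mem_mul (mem_sub (mem_mul (mem_mul hl hl) (mem_add a3 (mem_mul (mem_mul a2 a2) a7)))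
      (mem_S0 h hx v (mem_N0 h hx v))) (mem_inv v)

lemma cell_cj (o : p.ctx.Ok) {n : ℕ} {x : ℂ} {A B C : ℝ} 
    (h : ‖u.cj.ss n (u.cj.lh n * starRingEnd ℂ x) - (p.m:ℂ)/K‖ ≤ A ∧
    ‖u.cj.lh n * (u.cj.sN n (u.cj.lh n * starRingEnd ℂ x) + u.cj.sg n (u.cj.lh n * starRingEnd ℂ x) * u.cj.NG (u.cj.ss n (u.cj.lh n * starRingEnd ℂ x)))‖ ≤ B ∧
    ‖((u.cj.lh n ^2 * (u.cj.sS n (u.cj.lh n * starRingEnd ℂ x) + u.cj.sg n (u.cj.lh n * starRingEnd ℂ x)^2 * SV u.cj.V (u.cj.ss n (u.cj.lh n * starRingEnd ℂ x))))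
      - SV p.ctx.V0 (starRingEnd ℂ x)) / p.ctx.v0 (starRingEnd ℂ x)‖ ≤ C) :
    ‖u.ss n (u.lh n * x) - (p.m:ℂ)/K‖ ≤ A ∧
    ‖u.lh n * (u.sN n (u.lh n * x) + u.sg n (u.lh n * x) * u.NG (u.ss n (u.lh n * x)))‖ ≤ B ∧
    ‖((u.lh n ^2 * (u.sS n (u.lh n * x) + u.sg n (u.lh n * x)^2 * SV u.V (u.ss n (u.lh n * x))))
      - SV p.ctx.V0 x) / p.ctx.v0 x‖ ≤ C := by
  simp only [St.cj_ss, St.cj_lh, St.cj_sN, St.cj_sg, St.cj_NG, St.cj_sS, St.cj_SV, cjf, o.v0_cj, o.SV0_cj, ← map_mul, ← map_add, ← map_pow,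
    ← map_sub, ← map_div₀, Complex.norm_conj, Complex.conj_conj] at h
  refine ⟨?_, h.2⟩
  rw [← Complex.norm_conj]; simpa using h.1

def arc (p : Par) (f : D → Bool) : ℕ → ℤ → Bool
  | 0, _ => false
  | d+1, y => fI (p.R*p.R-y*y) fun N => if N < y*y then true else
    fI (nwt N 6 p.R + 1) fun xb => fI (p.h0*xb/p.R) fun h => fI (y+h) fun y2 =>
    fI (p.R*p.R-y2*y2) fun N2 => fI (nwt N2 6 p.R - 1) fun xa =>
    fI (h/2) fun g => fI ((xb-xa)/2) fun k => fI (nu (g+1) (k+1)) fun ρ => fI (y+g) fun sm => fI (xa+k) fun tm =>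
    decide (N ≤ xb*xb ∧ xa*xa ≤ N2 ∧ 0 ≤ xa ∧ 0 ≤ xb) && (f (mk' (p.m+tm) sm ρ) && (f (mk' (p.m-tm) sm ρ) && (f (mk' (p.m+sm) tm ρ) && (f (mk' (p.m-sm) tm ρ) &&
     arc p f d y2))))

lemma disc_nu {x : ℂ} {cx cy g k : ℤ} (hr : |K*x.re - cx| ≤ g) (hi : |K*x.im - cy| ≤ k) :
    (D.mk cx cy (nu g k)).mem x := by
  refine le_trans ?_ (nu_spec g k)
  refine abs_le_of_sq_le_sq' ?_ (by positivity) |>.2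
  rw [← Complex.normSq_eq_norm_sq, Complex.normSq_apply, ← Complex.normSq_eq_norm_sq, Complex.normSq_apply]
  have r1 := sq_le_sq' (abs_le.1 hr).1 (abs_le.1 hr).2
  have r2 := sq_le_sq' (abs_le.1 hi).1 (abs_le.1 hi).2
  simp
  nlinarith

lemma nu_comm (g k : ℤ) : nu g k = nu k g := by
  unfold nu nuN
  rw [add_comm (k.natAbs*k.natAbs), add_comm k.natAbs g.natAbs]
  congr 2
  rcases lt_trichotomy g.natAbs k.natAbs with h | h | h
  · have h1 : Nat.ble g.natAbs k.natAbs = true := by rw [Nat.ble_eq]; exact h.le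
    have h2 : Nat.ble k.natAbs g.natAbs = false := by
      rw [Bool.eq_false_iff, Ne, Nat.ble_eq]; omega
    rw [h1, h2]; rfl
  · rw [h]
  · have h1 : Nat.ble k.natAbs g.natAbs = true := by rw [Nat.ble_eq]; exact h.le
    have h2 : Nat.ble g.natAbs k.natAbs = false := by
      rw [Bool.eq_false_iff, Ne, Nat.ble_eq]; omega
    rw [h1, h2]; rfl

lemma arc_spec {f : D → Bool} {d : ℕ} {y : ℤ} (hc : arc p f d y = true) {s t : ℝ} (hs : y ≤ s) (hy : 0 ≤ y) (hst : s ≤ t)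
    (hR : s^2+t^2 = p.R^2) (hp : 0 < p.R) (hh : 0 ≤ p.h0) : ∃ sm tm g k : ℤ, |s - sm| ≤ g ∧ |t-tm| ≤ k ∧ 
      f (.mk (p.m+tm) sm (nu k g)) = true ∧ f (.mk (p.m-tm) sm (nu k g)) = true ∧ f (.mk (p.m+sm) tm (nu g k)) = true ∧ f (.mk (p.m-sm) tm (nu g k)) = true := by
  induction d generalizing y with
  | zero => simp [arc] at hc
  | succ d ih =>
    simp only [arc, fI_eq, mk'_eq] at hc
    have y0 : (0:ℝ) ≤ y := by exact_mod_cast hy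
    split_ifs at hc with h1
    · exfalso
      have h1' : (p.R:ℝ)*p.R-y*y < y*y := by exact_mod_cast h1
      nlinarith
    · simp only [Bool.and_eq_true, decide_eq_true_eq] at hc
      obtain ⟨⟨a1, a2, a3, a4⟩, c1, c2, c3, c4, c5⟩ := hc
      set xb := nwt (p.R*p.R-y*y) 6 p.R + 1
      set h := p.h0*xb/p.R
      set xa := nwt (p.R*p.R-(y+h)*(y+h)) 6 p.R - 1
      have h0 : 0 ≤ h := Int.ediv_nonneg (mul_nonneg hh a4) hp.le
      rcases le_total ((y+h:ℤ):ℝ) s with hh | hh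
      · exact ih c5 hh (by omega)
      · have e1 : ((p.R:ℝ)*p.R-y*y) ≤ xb*xb := by exact_mod_cast a1
        have e2 : (xa:ℝ)*xa ≤ ((p.R:ℝ)*p.R-(y+h)*(y+h)) := by exact_mod_cast a2
        have e3 : (0:ℝ) ≤ xa := by exact_mod_cast a3
        have e4 : (0:ℝ) ≤ xb := by exact_mod_cast a4
        have t0 : 0 ≤ t := by linarith
        push_cast at hh
        have tb : t ≤ xb := by nlinarith
        have ta : xa ≤ t := by nlinarith
        have m1 : ∀ a : ℤ, (2:ℝ)*(a/2:ℤ) ≤ a ∧ (a:ℝ) ≤ 2*(a/2:ℤ)+1 := fun a => by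
          constructor <;> norm_cast <;> omega
        obtain ⟨m3, m4⟩ := m1 h
        obtain ⟨m5, m6⟩ := m1 (xb-xa)
        push_cast at m5 m6
        rw [nu_comm] at c1 c2
        refine ⟨_, _, h/2+1, (xb-xa)/2+1, ?_, ?_, c1, c2, c3, c4⟩
        · rw [abs_le]; push_cast; constructor <;> linarith
        · rw [abs_le]; push_cast; constructor <;> linarith

def cover (p : Par) (f : D → Bool) : Bool := match p.dep with
  | 0 => f (D.mk p.m 0 p.R)
  | d+1 => decide (0 < p.R ∧ 0 ≤ p.h0) && arc p f (d+1) 0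
lemma cover_spec {f : D → Bool} (h : cover p f = true) {x : ℂ} (hx : x ∈ sphere (p.ctx.m:ℂ) p.ctx.R) (hi : 0 ≤ x.im) : ∃ X, f X = true ∧ X.mem x := by
  unfold cover at h
  split at h
  · exact ⟨_, h, mem_Om (sphere_subset_closedBall hx)⟩
  · simp only [Bool.and_eq_true, decide_eq_true_eq] at h
    obtain ⟨⟨h1, h2⟩, h3⟩ := h
    have k := K_pos
    have n2 : (K*x.re-p.m)^2+(K*x.im)^2 = (p.R:ℝ)^2 := by
      rw [mem_sphere, dist_eq_norm] at hx
      simp only [Par.ctx] at hx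
      have := congrArg (fun y : ℝ => ((K:ℝ)*y)^2) hx
      simp only [mul_pow] at this
      rw [← Complex.normSq_eq_norm_sq, Complex.normSq_apply] at this
      simp at this
      field_simp at this ⊢
      rcases this with this | this
      · linarith
      · exact absurd this K_pos'.ne'
    have im0 : 0 ≤ K*x.im := mul_nonneg k.le hi
    rcases le_total (K*x.im) |K*x.re-p.m| with h | h
    · obtain ⟨sm, tm, g, k, b1, b2, c1, c2, c3, c4⟩ := arc_spec h3 (s := K*x.im) (t := |K*x.re-p.m|) (by simpa using im0) le_rfl h
        (by rw [sq_abs]; linarith) h1 h2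
      rcases abs_cases (K*x.re-p.m) with ⟨e, -⟩ | ⟨e, -⟩
      · exact ⟨_, c1, disc_nu (by rw [e] at b2; push_cast; rwa [← sub_sub]) b1⟩
      · refine ⟨_, c2, disc_nu (by rw [e, abs_sub_comm] at b2; push_cast; convert b2 using 2; ring) b1⟩
    · obtain ⟨sm, tm, g, k, b1, b2, c1, c2, c3, c4⟩ := arc_spec h3 (s := |K*x.re-p.m|) (t := K*x.im) (by simp) le_rfl h
        (by rw [sq_abs]; linarith) h1 h2
      rcases abs_cases (K*x.re-p.m) with ⟨e, -⟩ | ⟨e, -⟩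
      · exact ⟨_, c3, disc_nu (by rw [e] at b1; push_cast; rwa [← sub_sub]) b2⟩
      · refine ⟨_, c4, disc_nu (by rw [e, abs_sub_comm] at b1; push_cast; convert b1 using 2; ring) b2⟩
def scal (p : Par) : Prop :=
  0 < p.qN ∧ mu p.qN p.Mx < K/2 ∧ 0 ≤ p.q1 ∧ 0 ≤ p.qc ∧ 0 ≤ p.qa ∧
  p.q1 + mu p.W (mu (mu p.qc p.Mx) (mu p.qc p.Mx)) < p.qc ∧
  mu (K + mu p.qa p.Mx) (mu p.W (mu p.qc p.Mx)) < p.qa ∧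
  mu (K + mu p.qa p.Mx) (p.q1 + 3*mu p.W (mu (mu p.qc p.Mx) (mu p.qc p.Mx))/2+1) ≤ p.th*p.P/K ∧ 0 < p.th ∧ p.th < K
instance (p : Par) : Decidable (scal p) := by unfold scal; infer_instance

def chk (p : Par) : Bool := pre p fun one kD bn ln => eChk p one kD bn ln && cover p (cell p one kD bn ln)

/-- the operator maps the unit domain strictly inside itself -/
theorem thmA (h : p.ok) (hs : scal p) {n : ℕ} (hn : p.md = min n 2) (hc : chk p = true) {u : St} (hu : Dom p.ctx 1 u) :
    Good p.ctx n u ∧ Dom p.ctx (p.th/K) (u.T n) ∧ 0 < u.k.re ∧ (∀ x ∈ p.ctx.O, 0 < (1 + u.e * u.V x).re) ∧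
    0 < (u.G (u.y n u.l)).re := by
  have O := Par.Ok h
  obtain ⟨one, kD, bn, ln, hi, E, H⟩ := pre_spec h hn hc
  have H0 := @H
  have H := H hu
  have k := K_pos
  simp only [Bool.and_eq_true] at hi
  obtain ⟨he, hcv⟩ := hi
  obtain ⟨s1, s2, s3, s4, s5, s6, s7, s8, s9, s10⟩ := hs
  have P0 : ∀ {u : St}, Dom p.ctx 1 u → ∀ x ∈ sphere (p.ctx.m:ℂ) p.ctx.R, 0 ≤ x.im → _ := fun {u} hu x hx hi =>
    have ⟨X, hX, hxX⟩ := cover_spec hcv hx hi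
    cell_spec (u := u) h E hn hX hu (H0 hu).bn (H0 hu).ln hxX
  have P : ∀ x ∈ sphere (p.ctx.m:ℂ) p.ctx.R, _ := fun x hx =>
    (le_total 0 x.im).elim (P0 hu x hx) fun hi => cell_cj O (P0 (hu.cj O) (starRingEnd ℂ x) (by
      rw [mem_sphere, dist_eq_norm] at hx ⊢
      rw [← Complex.norm_conj]; simpa using hx) (by simpa using hi))
  have mm : ((p.ctx.m:ℝ):ℂ) = (p.m:ℂ)/K := by simp [Par.ctx]
  have M0 := O.Mx_pos
  have c0 : ∀ {a : ℤ}, 0 ≤ a → (0:ℝ) ≤ a/K := fun ha => div_nonneg (by exact_mod_cast ha) k.le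
  have kf : ∀ a : ℤ, (K:ℝ) * (a/K) ≤ a := fun a => (KK _).le
  have hMx := p.MxK.le
  have hW : (K:ℝ) * (1+p.ctx.ka*p.ctx.Mx^2) ≤ p.W := by
    have a1 := mu_spec O.Mx_pos.le O.Mx_pos.le p.MxK.le p.MxK.le
    have a2 := mu_spec O.ka0 (by positivity) (kf p.ka) a1
    rw [Par.W]; push_cast; rw [pow_two]; simp only [Par.ctx] at *; linarith
  have W0 : 0 ≤ 1+p.ctx.ka*p.ctx.Mx^2 := by have := O.ka0; positivity
  have hK2 : ((K/2:ℤ):ℝ) = K/2 := by norm_num [K]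
  obtain ⟨g, gS⟩ := good_of O H.reg H.ptl H.pt (fun h0 => by have := H.l1; rw [h0] at this; simp at this)
    (R' := ((p.R-1:ℤ):ℝ)/K) (c1 := p.q1/K) (cN := p.qN/K) (by simp only [Par.ctx]; push_cast; gcongr; linarith)
    (fun x hx => by rw [mm]; exact (P x hx).1) (fun x hx => (P x hx).2.1) (fun x hx => (P x hx).2.2)
    (div_pos (by exact_mod_cast s1) k) (by
      have a := mu_spec (c0 s1.le) M0.le (kf _) hMx
      have b : (mu p.qN p.Mx:ℝ) < ((K/2:ℤ):ℝ) := by exact_mod_cast s2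
      rw [hK2] at b
      nlinarith)
  refine ⟨g, ⟨H.hl, ?_, H.hb, g.out, ?_⟩, H.k0, H.eV, H.G0⟩
  · obtain ⟨sg, SS, NN, NG, NGs, Ss, he, HE⟩ := fin_spec h E hn he
    obtain ⟨-, -, a2, a3, a4, a5, a6, a7⟩ := HE hu H.bn (z := 0) (mem_of 0 (by simp))
    have e := e_new O g
    have ng : u.NG 0 = - (2*u.e) := by
      rw [St.NG, NV, hu.nrm.z0, hu.nrm.z1, hu.nrm.z2]; simp
    have m1 := mem_mul (mem_neg (mem_mul (mem_mul H.ln mem_half) (mem_add a4 (mem_mul a2 a6)))) (mem_inv (mem_sub mem_one H.ln))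
    have m2 := inn_spec he m1
    rw [ng] at m2
    have m3 := th_le m2
    rw [e]
    simp only [Par.ctx]
    convert m3 using 2
    push_cast
    ring
  · have hcm := mu_spec (c0 s4) M0.le (kf _) hMx
    have n1 : 0 ≤ (p.qc:ℝ)/K * p.ctx.Mx := mul_nonneg (c0 s4) M0.le
    have hcm2 := mu_spec W0 (mul_nonneg n1 n1) hW (mu_spec n1 n1 hcm hcm)
    have ham := mu_spec (c0 s5) M0.le (kf _) hMx
    have n2 : 0 ≤ (p.qa:ℝ)/K * p.ctx.Mx := mul_nonneg (c0 s5) M0.le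
    have h1a : (K:ℝ) * (1 + p.qa/K*p.ctx.Mx) ≤ ((K + mu p.qa p.Mx:ℤ):ℝ) := by push_cast; linarith
    have s6' : (p.q1:ℝ) + (mu p.W (mu (mu p.qc p.Mx) (mu p.qc p.Mx)) : ℝ) < p.qc := by exact_mod_cast s6
    have s7' : (mu (K + mu p.qa p.Mx) (mu p.W (mu p.qc p.Mx)):ℝ) < p.qa := by exact_mod_cast s7
    have n3 : 0 ≤ (1+p.ctx.ka*p.ctx.Mx^2) * ((p.qc:ℝ)/K * p.ctx.Mx * ((p.qc:ℝ)/K * p.ctx.Mx)) := mul_nonneg W0 (mul_nonneg n1 n1)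
    refine q_out O g.out g.V' (cc := p.qc/K) (aa := p.qa/K) gS (c0 s4) (c0 s5) ?_ ?_ ?_
    · rw [pow_two ((p.qc:ℝ)/K * p.ctx.Mx)]
      have : (K:ℝ) * (p.q1/K + (1+p.ctx.ka*p.ctx.Mx^2) * ((p.qc:ℝ)/K * p.ctx.Mx * ((p.qc:ℝ)/K * p.ctx.Mx))/2) < K * (p.qc/K) := by
        rw [mul_add, KK, KK]; nlinarith
      exact lt_of_mul_lt_mul_left this k.le
    · have := mu_spec (by positivity) (mul_nonneg W0 n1) h1a (mu_spec W0 n1 hW hcm)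
      exact lt_of_mul_lt_mul_left (this.trans_lt (s7'.trans_eq (KK _).symm)) k.le
    · rw [pow_two ((p.qc:ℝ)/K * p.ctx.Mx)]
      have q3 := ediv_ub (3*mu p.W (mu (mu p.qc p.Mx) (mu p.qc p.Mx))) 2 (by norm_num)
      have q1' : 0 ≤ (p.q1:ℝ)/K := c0 s3
      have := mu_spec (y := p.q1/K + 3/2 * ((1+p.ctx.ka*p.ctx.Mx^2) * ((p.qc:ℝ)/K * p.ctx.Mx * ((p.qc:ℝ)/K * p.ctx.Mx)))) 
        (by positivity) (by positivity) h1a (b := p.q1 + 3*mu p.W (mu (mu p.qc p.Mx) (mu p.qc p.Mx))/2+1) (by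
          push_cast at *; rw [mul_add, KK]; linarith)
      refine th_le (a := p.th) (b := p.P) ?_
      rw [le_div_iff₀ k, mul_comm]
      refine this.trans ?_
      exact_mod_cast s8
end RN
end

section
open Metric
namespace RN
set_option maxRecDepth 100000
def P2 : Par := ⟨406819302277, 1022545813832, 69709037201, -439298875762, 10995116278, 91006577431, 6597069767, 752615709213, 13194139533, 24189255811, [0, 1099511627776, 0, 15366921111, -2162959274, 816959130, -214514719, 64022991, -15558090], [1099511627776, 0, 46100763333, -8651837096, 4084795650, -1287088314, 448160937, -124464720], [0, 92201526666, -25955511288, 16339182600, -6435441570, 2688965622, -871253040], [92201526666, -51911022576, 49017547800, -25741766280, 13444828110, -5227518240], [46100763333, -8651837096, 4084795650, -1287088314, 448160937, -124464720], 0, 0, 0, 1088516511498, 21055647672, 288072046477, 21935256974, 33205251159, 40, 25838522368⟩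
def P3 : Par := ⟨1154487209165, 2638827906662, 0, -118747255800, 27487790694, 31885837206, 14293651161, 604731395277, 38482906972, 27487790694, [0, 1099511627776, 0], [1099511627776, 0], [0], [], [], 1, 0, 0, 1044536046387, 13743895347, 126443837194, 17042430231, 74766790689, 0, 0⟩
def P4 : Par := ⟨1099511627776, 2748779069440, 0, 0, 49478023250, 0, 21990232556, 557452395282, 71468255805, 3298534883, [0, 1099511627776, 0], [1099511627776, 0], [0], [], [], 2, -1077521395220, 175921860444, 1044536046387, 989560465, 43980465111, 1044536046, 4398046511, 0, 0⟩
lemma P2_ok : P2.ok := by decide +kernel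
lemma P2_scal : scal P2 := by decide +kernel
lemma P2_chk : chk P2 = true := by decide +kernel
lemma P3_ok : P3.ok := by decide +kernel
lemma P3_scal : scal P3 := by decide +kernel
lemma P3_chk : chk P3 = true := by decide +kernel
lemma P4_ok : P4.ok := by decide +kernel
lemma P4_scal : scal P4 := by decide +kernel
lemma P4_chk : chk P4 = true := by decide +kernel
end RN
end

section
open Metric
namespace RN
section
variable {E : Type*} [NormedAddCommGroup E] [NormedSpace ℂ E]
lemma an_pd {F : ℂ × ℂ → ℂ} {p : ℂ × ℂ} (h : AnalyticAt ℂ F p) :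
    AnalyticAt ℂ (fun p : ℂ × ℂ => deriv (fun w => F (p.1, w)) p.2) p := by
  have h1 : AnalyticAt ℂ (fun q => fderiv ℂ F q ((0:ℂ), (1:ℂ))) p := by
    have := h.fderiv
    exact (ContinuousLinearMap.analyticAt (ContinuousLinearMap.apply ℂ ℂ ((0:ℂ), (1:ℂ))) _).comp (f := fderiv ℂ F) this
  refine h1.congr ?_
  filter_upwards [h.eventually_analyticAt] with q hq
  have a : HasDerivAt (fun w : ℂ => (q.1, w)) ((0:ℂ), (1:ℂ)) q.2 :=
    (hasDerivAt_const q.2 q.1).prodMk (hasDerivAt_id q.2)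
  have b : HasFDerivAt F (fderiv ℂ F q) ((fun w : ℂ => (q.1, w)) q.2) := hq.differentiableAt.hasFDerivAt
  exact ((b.comp_hasDerivAt q.2 a).deriv).symm
lemma an_c2 {F : ℂ × ℂ → ℂ} {f g : E → ℂ} {p : E} (h : AnalyticAt ℂ F (f p, g p)) (hf : AnalyticAt ℂ f p) (hg : AnalyticAt ℂ g p) :
    AnalyticAt ℂ (fun z => F (f z, g z)) p := AnalyticAt.comp (g := F) (f := fun z => (f z, g z)) h (hf.prod hg)
end

structure FamA (c : Ctx) (γ : ℂ → St) : Prop where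
  l : ∀ t ∈ ball (0:ℂ) 1, AnalyticAt ℂ (fun t => (γ t).l) t
  e : ∀ t ∈ ball (0:ℂ) 1, AnalyticAt ℂ (fun t => (γ t).e) t
  b : ∀ t ∈ ball (0:ℂ) 1, AnalyticAt ℂ (fun t => (γ t).b) t
  V : ∀ t ∈ ball (0:ℂ) 1, ∀ x ∈ c.O, AnalyticAt ℂ (fun p : ℂ × ℂ => (γ p.1).V p.2) (t, x)

section
variable {c : Ctx} {γ : ℂ → St} (A : FamA c γ) {t : ℂ} (ht : t ∈ ball (0:ℂ) 1)
include A ht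
lemma FamA.V1 (o : c.Ok) : AnalyticAt ℂ (fun t => (γ t).V 1) t :=
  an_c2 (A.V t ht 1 o.mem1) analyticAt_id analyticAt_const
lemma FamA.G (o : c.Ok) {y : ℂ} (hy : y ∈ c.O) (h : 1 + (γ t).e * (γ t).V y ≠ 0) :
    AnalyticAt ℂ (fun p : ℂ × ℂ => (γ p.1).G p.2) (t, y) := by
  have v1 : AnalyticAt ℂ (fun p : ℂ × ℂ => (γ p.1).V 1) (t, y) := (A.V1 ht o).comp (f := Prod.fst) (x := (t,y)) analyticAt_fst
  have e : AnalyticAt ℂ (fun p : ℂ × ℂ => (γ p.1).e) (t, y) := (A.e t ht).comp (f := Prod.fst) (x := (t,y)) analyticAt_fst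
  have v := A.V t ht y hy
  exact (v1.sub v).div (analyticAt_const.add (e.mul v)) h
lemma FamA.Lm (o : c.Ok) {y : ℂ} (hy : y ∈ c.O) (h : 1 + (γ t).e * (γ t).V y ≠ 0) (hp : 0 < ((γ t).b * (γ t).G y).re) :
    AnalyticAt ℂ (fun p : ℂ × ℂ => (γ p.1).Lm p.2) (t, y) := by
  have b : AnalyticAt ℂ (fun p : ℂ × ℂ => (γ p.1).b) (t, y) := (A.b t ht).comp (f := Prod.fst) (x := (t,y)) analyticAt_fst
  exact (AnalyticAt.comp (g := csq) (f := fun p : ℂ × ℂ => (γ p.1).b * (γ p.1).G p.2) (csq_analyticAt hp) (b.mul (A.G ht o hy h))).neg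
lemma FamA.y (o : c.Ok) (R : Reg c (γ t)) {z : ℂ} (n : ℕ) (h1 : ∀ j < n, (γ t).y j z ∈ c.O) (h2 : ∀ j < n, 0 < ((γ t).b * (γ t).G ((γ t).y j z)).re) :
    AnalyticAt ℂ (fun p : ℂ × ℂ => (γ p.1).y n p.2) (t, z) := by
  induction n with
  | zero => exact analyticAt_snd
  | succ n ih =>
    have := ih (fun j hj => h1 j (by omega)) (fun j hj => h2 j (by omega))
    have := an_c2 (f := Prod.fst) (g := fun p : ℂ × ℂ => (γ p.1).y n p.2) (p := (t,z))
      (A.Lm ht o (h1 n (by omega)) (R.eV _ (h1 n (by omega))) (h2 n (by omega))) analyticAt_fst this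
    simpa only [St.y, Function.iterate_succ_apply'] using this
lemma FamA.Gy (o : c.Ok) (R : Reg c (γ t)) {z : ℂ} {n : ℕ} (h : Pt c (γ t) n z) :
    AnalyticAt ℂ (fun p : ℂ × ℂ => (γ p.1).G ((γ p.1).y n p.2)) (t, z) :=
  an_c2 (f := Prod.fst) (g := fun p : ℂ × ℂ => (γ p.1).y n p.2) (p := (t,z)) 
    (A.G ht o (h.y n le_rfl) (R.eV _ (h.y n le_rfl))) analyticAt_fst (A.y ht o R n (fun j hj => h.y j hj.le) h.re)
lemma FamA.bh (o : c.Ok) {n : ℕ} (g : Good c n (γ t)) : AnalyticAt ℂ (fun t => (γ t).bh n) t :=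
  have h := an_c2 (f := fun t => t) (p := t) (A.Gy ht o g.reg g.ptl) analyticAt_id (A.l t ht)
  h.inv (G_ne_of g.ptl.res).1
lemma FamA.ss (o : c.Ok) {n : ℕ} (g : Good c n (γ t)) {z : ℂ} (h : Pt c (γ t) n z) : 
    AnalyticAt ℂ (fun p : ℂ × ℂ => (γ p.1).ss n p.2) (t, z) := by
  have b : AnalyticAt ℂ (fun p : ℂ × ℂ => (γ p.1).bh n) (t, z) := (A.bh ht o g).comp (f := Prod.fst) (x := (t,z)) analyticAt_fst
  exact AnalyticAt.comp (g := csq) (f := fun p : ℂ × ℂ => (γ p.1).G ((γ p.1).y n p.2) * (γ p.1).bh n) (csq_analyticAt h.res) ((A.Gy ht o g.reg h).mul b)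
lemma FamA.lh (o : c.Ok) {n : ℕ} (g : Good c n (γ t)) : AnalyticAt ℂ (fun t => (γ t).lh n) t :=
  have h := an_c2 (f := fun t => t) (p := t) (an_pd (A.ss ht o g g.ptl)) analyticAt_id (A.l t ht)
  h
lemma FamA.gg (o : c.Ok) {n : ℕ} (g : Good c n (γ t)) {x : ℂ} (hx : x ∈ closedBall (c.m:ℂ) c.R) : 
    AnalyticAt ℂ (fun p : ℂ × ℂ => (γ p.1).gg n p.2) (t, x) := by
  have l : AnalyticAt ℂ (fun p : ℂ × ℂ => (γ p.1).lh n * p.2) (t, x) := 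
    ((A.lh ht o g).comp (f := Prod.fst) (x := (t,x)) analyticAt_fst).mul analyticAt_snd
  have s := an_c2 (f := Prod.fst) (p := (t,x)) (A.ss ht o g (g.pt x hx)) analyticAt_fst l
  exact an_c2 (f := Prod.fst) (p := (t,x)) (A.G ht o (g.ss x hx) (g.reg.eV _ (g.ss x hx))) analyticAt_fst s
lemma FamA.hh (o : c.Ok) {n : ℕ} (g : Good c n (γ t)) (h0 : deriv ((γ t).gg n) 0 ≠ 0) {x : ℂ} (hx : x ∈ closedBall (c.m:ℂ) c.R) : 
    AnalyticAt ℂ (fun p : ℂ × ℂ => (γ p.1).hh n p.2) (t, x) := by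
  have z : (0:ℂ) ∈ closedBall (c.m:ℂ) c.R := ball_subset_closedBall o.mem0
  have a := an_c2 (f := Prod.fst) (g := fun _ => 0) (p := (t,x)) (A.gg ht o g z) analyticAt_fst analyticAt_const
  have b := an_c2 (f := Prod.fst) (g := fun _ => 0) (p := (t,x)) (an_pd (A.gg ht o g z)) analyticAt_fst analyticAt_const
  exact ((A.gg ht o g hx).sub a).div b h0
lemma FamA.kk (o : c.Ok) {n : ℕ} (g : Good c n (γ t)) (h0 : deriv ((γ t).gg n) 0 ≠ 0) :
    AnalyticAt ℂ (fun t => (γ t).kk n) t := by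
  have z : (0:ℂ) ∈ closedBall (c.m:ℂ) c.R := ball_subset_closedBall o.mem0
  exact (an_c2 (f := id) (g := fun _ => 0) (p := t) (an_pd (an_pd (A.hh ht o g h0 z))) analyticAt_id analyticAt_const).div_const
end
lemma Good.gg0 {c : Ctx} {n : ℕ} {u : St} (o : c.Ok) (g : Good c n u) : deriv (u.gg n) 0 ≠ 0 := by
  intro h
  have := g.out.z1
  have e : (u.T n).V = fun _ => 0 := by
    funext x; simp [St.T, St.hh, h]
  rw [e] at this
  simp at this

lemma FamA.T {c : Ctx} {γ : ℂ → St} (A : FamA c γ) (o : c.Ok) {n : ℕ} (g : ∀ t ∈ ball (0:ℂ) 1, Good c n (γ t)) :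
    FamA c (fun t => (γ t).T n) := by
  refine ⟨fun t ht => A.lh ht o (g t ht), fun t ht => ?_, fun t ht => A.bh ht o (g t ht), fun t ht x hx => ?_⟩
  · have l := A.lh ht o (g t ht)
    have k := A.kk ht o (g t ht) ((g t ht).gg0 o)
    exact (k.neg.sub (l.mul (A.e t ht))).div (analyticAt_const.sub l) (sub_ne_zero.2 (g t ht).l1.symm)
  · have h := A.hh ht o (g t ht) ((g t ht).gg0 o) (ball_subset_closedBall hx)
    have k := (A.kk ht o (g t ht) ((g t ht).gg0 o)).comp (f := Prod.fst) (x := (t,x)) analyticAt_fst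
    exact h.div (analyticAt_const.add (k.mul h)) ((g t ht).ph x hx)
end RN
end

section
open Metric
namespace RN
inductive Ix | l | e | b | q (x : ℂ) | V (x : ℂ)
def Ix.ok (c : Ctx) : Ix → Prop
  | .q x => x ∈ c.O
  | .V x => x ∈ c.O
  | _ => True
noncomputable def co (c : Ctx) : Ix → St → ℂ
  | .l, u => u.l
  | .e, u => u.e
  | .b, u => u.b
  | .q x, u => c.q u.V x
  | .V x, u => u.V x
noncomputable def cen (c : Ctx) : Ix → ℂ
  | .l => c.l0
  | .e => c.e0
  | .b => c.b0
  | .q _ => 0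
  | .V x => c.V0 x
noncomputable def rad (c : Ctx) : Ix → ℝ
  | .l => c.ep
  | .e => c.A
  | .b => c.be
  | .q _ => c.P
  | .V _ => (1+c.ka*c.Mx^2) * (c.P * (c.Mx^3 * (1/6 + c.ka * c.Mx^2/20)))
variable {c : Ctx}
lemma rad_pos (o : c.Ok) (i : Ix) : 0 < rad c i := by
  have := o.Mx_pos; have := o.ka0; have := o.P0
  cases i with
  | l => exact o.ep0
  | e => exact o.A0
  | b => exact o.be0
  | q => exact o.P0
  | V => simp only [rad]; positivity
lemma dom_co (o : c.Ok) {θ : ℝ} (h0 : 0 ≤ θ) {u : St} (h : Dom c θ u) {i : Ix} (hi : i.ok c) : ‖co c i u - cen c i‖ ≤ θ * rad c i := by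
  have := o.Mx_pos; have := o.ka0; have := o.P0
  cases i with
  | l => exact h.hl
  | e => exact h.he
  | b => exact h.hb
  | q x => simpa [co, cen, rad] using h.hq x hi
  | V x =>
    refine (V_bd o h.nrm h.hq (by positivity) hi).trans ?_
    have hx := Ctx.norm_le_Mx hi
    simp only [rad]
    rw [show θ * ((1+c.ka*c.Mx^2) * (c.P * (c.Mx^3 * (1/6 + c.ka * c.Mx^2/20)))) = (1+c.ka*c.Mx^2) * (θ * c.P * (c.Mx^3 * (1/6 + c.ka * c.Mx^2/20))) by ring]
    gcongr
lemma dom_of {θ : ℝ} {u : St} (n : Nrm c u.V) (h : ∀ i : Ix, i.ok c → ‖co c i u - cen c i‖ ≤ θ * rad c i) : Dom c θ u :=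
  ⟨h .l trivial, h .e trivial, h .b trivial, n, fun x hx => by simpa [co, cen, rad] using h (.q x) hx⟩

/-- affine combination -/
def lc (u v w : St) (a : ℂ) : St :=
  ⟨u.l + a * (v.l - w.l), u.e + a * (v.e - w.e), u.b + a * (v.b - w.b), fun x => u.V x + a * (v.V x - w.V x)⟩

lemma evd {f g : ℂ → ℂ} (h : ∀ x ∈ c.O, f x = g x) {x : ℂ} (hx : x ∈ c.O) : deriv f x = deriv g x :=
  Filter.EventuallyEq.deriv_eq (by filter_upwards [Ctx.O_open.mem_nhds hx] with y hy using h y hy)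
lemma dlc {f g k : ℂ → ℂ} {x a : ℂ} (hf : AnalyticAt ℂ f x) (hg : AnalyticAt ℂ g x) (hk : AnalyticAt ℂ k x) :
    deriv (fun x => f x + a * (g x - k x)) x = deriv f x + a * (deriv g x - deriv k x) :=
  (hf.differentiableAt.hasDerivAt.add ((hg.differentiableAt.hasDerivAt.sub hk.differentiableAt.hasDerivAt).const_mul a)).deriv

lemma lc_q (o : c.Ok) {u v w : ℂ → ℂ} {a : ℂ} (hu : Nrm c u) (hv : Nrm c v) (hw : Nrm c w) {x : ℂ} (hx : x ∈ c.O) :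
    c.q (fun x => u x + a * (v x - w x)) x = c.q u x + a * (c.q v x - c.q w x) := by
  have e1 : ∀ x ∈ c.O, c.uu (fun x => u x + a * (v x - w x)) x = c.uu u x + a * (c.uu v x - c.uu w x) := fun x hx => by
    simp only [Ctx.uu]; rw [dlc (hu.anV o hx) (hv.anV o hx) (hw.anV o hx)]; ring
  have e2 : ∀ x ∈ c.O, c.om (fun x => u x + a * (v x - w x)) x = c.om u x + a * (c.om v x - c.om w x) := fun x hx => by
    simp only [Ctx.om]; rw [evd e1 hx, dlc (hu.anU o hx) (hv.anU o hx) (hw.anU o hx)]; ring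
  simp only [Ctx.q]; rw [evd e2 hx, dlc (hu.anOm o hx) (hv.anOm o hx) (hw.anOm o hx)]

lemma lc_nrm (o : c.Ok) {u v w : ℂ → ℂ} {a : ℂ} (hu : Nrm c u) (hv : Nrm c v) (hw : Nrm c w) :
    Nrm c (fun x => u x + a * (v x - w x)) := by
  have e1 : ∀ x ∈ c.O, deriv (fun x => u x + a * (v x - w x)) x = deriv u x + a * (deriv v x - deriv w x) := fun x hx => 
    dlc (hu.anV o hx) (hv.anV o hx) (hw.anV o hx)
  refine ⟨hu.d.add ((hv.d.sub hw.d).const_mul a), by simp [hu.z0, hv.z0, hw.z0], ?_, ?_⟩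
  · rw [e1 0 o.mem0, hu.z1, hv.z1, hw.z1]; simp
  · rw [evd e1 o.mem0, dlc (hu.anV o o.mem0).deriv (hv.anV o o.mem0).deriv (hw.anV o o.mem0).deriv, hu.z2, hv.z2, hw.z2]; simp

lemma lc_co (o : c.Ok) {u v w : St} {a : ℂ} (hu : Nrm c u.V) (hv : Nrm c v.V) (hw : Nrm c w.V) {i : Ix} (hi : i.ok c) :
    co c i (lc u v w a) = co c i u + a * (co c i v - co c i w) := by
  cases i with
  | q x => exact lc_q o hu hv hw hi
  | _ => rfl

lemma FamA.co {γ : ℂ → St} (A : FamA c γ) (o : c.Ok) {i : Ix} (hi : i.ok c) {t : ℂ} (ht : t ∈ ball (0:ℂ) 1) :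
    AnalyticAt ℂ (fun t => co c i (γ t)) t := by
  cases i with
  | l => exact A.l t ht
  | e => exact A.e t ht
  | b => exact A.b t ht
  | V x => exact an_c2 (f := fun t => t) (p := t) (A.V t ht x hi) analyticAt_id analyticAt_const
  | q x =>
    have v := (o.v0_an x).comp (f := Prod.snd) (x := (t,x)) analyticAt_snd
    have v0 := o.v0_ne (Ctx.norm_le_Mx hi)
    have a1 := (an_pd (A.V t ht x hi)).div v v0
    have a2 := (an_pd a1).div v v0
    have a3 := an_pd a2
    exact an_c2 (f := fun t => t) (p := t) a3 analyticAt_id analyticAt_const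

lemma FamA.lc {γ δ ε : ℂ → St} {a : ℂ → ℂ} (h1 : FamA c γ) (h2 : FamA c δ) (h3 : FamA c ε) (ha : ∀ t ∈ ball (0:ℂ) 1, AnalyticAt ℂ a t) :
    FamA c (fun t => lc (γ t) (δ t) (ε t) (a t)) := by
  refine ⟨fun t ht => ?_, fun t ht => ?_, fun t ht => ?_, fun t ht x hx => ?_⟩
  · exact (h1.l t ht).add ((ha t ht).mul ((h2.l t ht).sub (h3.l t ht)))
  · exact (h1.e t ht).add ((ha t ht).mul ((h2.e t ht).sub (h3.e t ht)))
  · exact (h1.b t ht).add ((ha t ht).mul ((h2.b t ht).sub (h3.b t ht)))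
  · exact (h1.V t ht x hx).add (((ha t ht).comp (f := Prod.fst) (x := (t,x)) analyticAt_fst).mul ((h2.V t ht x hx).sub (h3.V t ht x hx)))
lemma FamA.const (o : c.Ok) {u : St} (h : Nrm c u.V) : FamA c (fun _ => u) :=
  ⟨fun _ _ => analyticAt_const, fun _ _ => analyticAt_const, fun _ _ => analyticAt_const, fun t _ x hx => 
    (h.anV o hx).comp (f := Prod.snd) (x := (t,x)) analyticAt_snd⟩

lemma schw {φ : ℂ → ℂ} {a b C : ℂ} {ρ R1 : ℝ} (hρ : 0 < ρ) (h : ∀ t ∈ ball (0:ℂ) 1, AnalyticAt ℂ φ t)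
    (hb : ∀ t ∈ ball (0:ℂ) 1, ‖φ t - C‖ ≤ ρ) (hs : ball a R1 ⊆ ball (0:ℂ) 1) (hba : b ∈ ball a R1) :
    ‖φ b - φ a‖ ≤ 3*ρ/R1 * ‖b - a‖ := by
  have := Complex.dist_le_div_mul_dist_of_mapsTo_ball (f := φ) (c := a) (z := b) (R₁ := R1) (R₂ := 3*ρ)
    (fun t ht => (h t (hs ht)).differentiableAt.differentiableWithinAt) (fun t ht => by
      have h1 := hb t (hs ht)
      have h2 := hb a (hs (mem_ball_self (pos_of_mem_ball hba)))
      rw [mem_closedBall, dist_eq_norm]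
      have := norm_sub_le (φ t - C) (φ a - C)
      rw [sub_sub_sub_cancel_right] at this
      linarith) hba
  simpa [dist_eq_norm] using this

structure Near (c : Ctx) (s : ℝ) (a b : St) : Prop where
  ex : ∃ γ, FamA c γ ∧ (∀ t ∈ ball (0:ℂ) 1, Dom c 1 (γ t)) ∧ γ 0 = a ∧ γ s = b

lemma ofR_ball {s : ℝ} (h0 : 0 ≤ s) (h1 : s < 1) : (s:ℂ) ∈ ball (0:ℂ) 1 := by
  simp [abs_of_nonneg h0, h1]

lemma Near.co (o : c.Ok) {s : ℝ} (h0 : 0 ≤ s) (h1 : s < 1) {a b : St} (h : Near c s a b) {i : Ix} (hi : i.ok c) :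
    ‖co c i b - co c i a‖ ≤ 3 * rad c i * s := by
  obtain ⟨γ, A, D, rfl, rfl⟩ := h
  have := schw (φ := fun t => RN.co c i (γ t)) (a := 0) (b := s) (R1 := 1) (rad_pos o i) (fun t ht => A.co o hi ht) 
    (fun t ht => by simpa using dom_co o zero_le_one (D t ht) hi) (subset_refl _) (ofR_ball h0 h1)
  simpa [abs_of_nonneg h0] using this
end RN
end

section
open Metric Filter Topology
namespace RN
variable {c : Ctx}
lemma St.ext' {u v : St} (h1 : u.l = v.l) (h2 : u.e = v.e) (h3 : u.b = v.b) (h4 : ∀ x, u.V x = v.V x) : u = v := by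
  cases u; cases v; simp at *; exact ⟨h1, h2, h3, funext h4⟩
lemma lc_zero (u v w : St) : lc u v w 0 = u := by apply St.ext' <;> simp [lc]
lemma lc_one (u v : St) : lc u v u 1 = v := by apply St.ext' <;> simp [lc]
lemma Dom.mono (o : c.Ok) {θ θ' : ℝ} (h0 : 0 ≤ θ) (h : θ ≤ θ') {u : St} (hu : Dom c θ u) : Dom c θ' u :=
  dom_of hu.nrm (fun i hi => (dom_co o h0 hu hi).trans (mul_le_mul_of_nonneg_right h (rad_pos o i).le))

structure HA (c : Ctx) (n : ℕ) (θ : ℝ) : Prop where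
  ok : c.Ok
  g : ∀ u, Dom c 1 u → Good c n u
  d : ∀ u, Dom c 1 u → Dom c θ (u.T n)
  t0 : 0 < θ
  t1 : θ < 1

lemma Near.T {n : ℕ} {θ : ℝ} (H : HA c n θ) {s : ℝ} {a b : St} (h : Near c s a b) : 
    ∃ δ, FamA c δ ∧ (∀ t ∈ ball (0:ℂ) 1, Dom c θ (δ t)) ∧ δ 0 = a.T n ∧ δ s = b.T n := by
  obtain ⟨γ, A, D, rfl, rfl⟩ := h
  exact ⟨fun t => (γ t).T n, A.T H.ok (fun t ht => H.g _ (D t ht)), fun t ht => H.d _ (D t ht), rfl, rfl⟩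

lemma Near.step {n : ℕ} {θ : ℝ} (H : HA c n θ) {s : ℝ} (s0 : 0 < s) (s1 : s ≤ θ) {a b : St} (h : Near c s a b) :
    Near c (s / (1 + (1-θ)^2/4)) (a.T n) (b.T n) := by
  obtain ⟨δ, A, D, h0, hs⟩ := h.T H
  have t0 := H.t0
  have t1 := H.t1
  have o := H.ok
  set ε := (1-θ)^2/4 with hε
  have e0 : 0 < ε := by have : 0 < 1 - θ := by linarith
                        positivity
  have e1 : ε < 1 - θ := by nlinarith
  set s' := s / (1+ε) with hs'
  have e2 : s = s' * (1+ε) := by rw [hs']; field_simp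
  have p0 : 0 < s' := by positivity
  have p1 : s' < s := by rw [e2]; nlinarith
  have sb := ofR_ball s0.le (by linarith : s < 1)
  have sb' := ofR_ball p0.le (by linarith : s' < 1)
  refine ⟨fun t => lc (δ t) (δ s) (δ s') (t/s'), ?_, ?_, ?_, ?_⟩
  · exact FamA.lc A (FamA.const o (D _ sb).nrm) (FamA.const o (D _ sb').nrm) (fun t ht => analyticAt_id.div_const)
  · intro t ht
    refine dom_of (lc_nrm o (D _ ht).nrm (D _ sb).nrm (D _ sb').nrm) (fun i hi => ?_)
    rw [lc_co o (D _ ht).nrm (D _ sb).nrm (D _ sb').nrm hi]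
    have r0 := rad_pos o i
    have b1 := schw (φ := fun t => RN.co c i (δ t)) (a := s') (b := s) (C := cen c i) (R1 := 1-θ) r0 (fun t ht => A.co o hi ht)
      (fun t ht => (dom_co o t0.le (D t ht) hi).trans (by nlinarith))
      (by
        intro z hz
        rw [mem_ball, dist_eq_norm] at *
        have := norm_add_le (z - s') (s':ℂ)
        rw [sub_add_cancel, Complex.norm_real, Real.norm_eq_abs, abs_of_pos p0] at this
        rw [sub_zero]; linarith)
      (by
        rw [mem_ball, dist_eq_norm, ← Complex.ofReal_sub, Complex.norm_real, Real.norm_eq_abs, abs_of_pos (by linarith)]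
        nlinarith)
    have b2 := dom_co o t0.le (D t ht) hi
    have n1 : ‖((s:ℂ) - s')‖ = s' * ε := by
      rw [← Complex.ofReal_sub, Complex.norm_real, Real.norm_eq_abs, abs_of_pos (by linarith)]
      linarith
    rw [n1] at b1
    have n2 : ‖t / (s':ℂ)‖ ≤ 1 / s' := by
      rw [norm_div, Complex.norm_real, Real.norm_eq_abs, abs_of_pos p0]
      have : ‖t‖ < 1 := by simpa using ht
      gcongr
    have b3 : ‖t / (s':ℂ) * (RN.co c i (δ s) - RN.co c i (δ s'))‖ ≤ (1 - θ) * rad c i := by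
      rw [norm_mul]
      refine (mul_le_mul n2 b1 (norm_nonneg _) (by positivity)).trans ?_
      have q : 1 / s' * (3 * rad c i / (1-θ) * (s' * ε)) = 3/4 * ((1-θ) * rad c i) := by
        rw [hε]; have : 1 - θ ≠ 0 := by linarith
        field_simp
      rw [q]
      have : 0 < (1-θ) * rad c i := mul_pos (by linarith) r0
      linarith
    rw [show RN.co c i (δ t) + t / (s':ℂ) * (RN.co c i (δ s) - RN.co c i (δ s')) - cen c i = (RN.co c i (δ t) - cen c i) + t / (s':ℂ) * (RN.co c i (δ s) - RN.co c i (δ s')) by ring]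
    refine (norm_add_le _ _).trans ?_
    linarith
  · simp only [zero_div, lc_zero]; exact h0
  · simp only []
    rw [div_self (by exact_mod_cast p0.ne'), lc_one]; exact hs

/-- affine families -/
lemma near_aff (o : c.Ok) {θ σ d : ℝ} (s0 : 0 < σ) {u v : St} (t0 : 0 ≤ θ) (hu : Dom c θ u) (hv : Nrm c v.V)
    (h : ∀ i : Ix, i.ok c → ‖co c i v - co c i u‖ ≤ d * rad c i) (hd : d / σ + θ ≤ 1) : Near c σ u v := by
  refine ⟨fun t => lc u v u (t/σ), FamA.lc (FamA.const o hu.nrm) (FamA.const o hv) (FamA.const o hu.nrm) (fun t ht => analyticAt_id.div_const), ?_, ?_, ?_⟩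
  · intro t ht
    refine dom_of (lc_nrm o hu.nrm hv hu.nrm) (fun i hi => ?_)
    rw [lc_co o hu.nrm hv hu.nrm hi]
    have r0 := rad_pos o i
    have b2 := dom_co o t0 hu hi
    have n2 : ‖t / (σ:ℂ)‖ ≤ 1 / σ := by
      rw [norm_div, Complex.norm_real, Real.norm_eq_abs, abs_of_pos s0]
      have : ‖t‖ < 1 := by simpa using ht
      gcongr
    have b3 : ‖t / (σ:ℂ) * (co c i v - co c i u)‖ ≤ d / σ * rad c i := by
      rw [norm_mul]
      refine (mul_le_mul n2 (h i hi) (norm_nonneg _) (by positivity)).trans (le_of_eq ?_)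
      ring
    rw [show co c i u + t / (σ:ℂ) * (co c i v - co c i u) - cen c i = (co c i u - cen c i) + t / (σ:ℂ) * (co c i v - co c i u) by ring]
    refine (norm_add_le _ _).trans ?_
    nlinarith
  · simp only [zero_div, lc_zero]
  · simp only []
    rw [div_self (by exact_mod_cast s0.ne'), lc_one]

noncomputable def U0 (c : Ctx) : St := ⟨c.l0, c.e0, c.b0, c.V0⟩
lemma q_V0 (o : c.Ok) {x : ℂ} (hx : x ∈ c.O) : c.q c.V0 x = 0 := by
  have e1 : ∀ x ∈ c.O, c.uu c.V0 x = (fun _ => (1:ℂ)) x := fun x hx => div_self (o.v0_ne (Ctx.norm_le_Mx hx))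
  have e2 : ∀ x ∈ c.O, c.om c.V0 x = (fun _ => (0:ℂ)) x := fun x hx => by
    simp only [Ctx.om]; rw [evd e1 hx]; simp
  rw [Ctx.q, evd e2 hx]; simp
lemma co_U0 (o : c.Ok) {i : Ix} (hi : i.ok c) : co c i (U0 c) = cen c i := by
  cases i with
  | q x => exact q_V0 o hi
  | _ => rfl
lemma U0_dom (o : c.Ok) : Dom c 0 (U0 c) := dom_of (V0nrm o) (fun i hi => by simp [co_U0 o hi])

noncomputable def sq (c : Ctx) (n : ℕ) (k : ℕ) : St := (fun u => u.T n)^[k] (U0 c)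
lemma sq_succ (n k : ℕ) : sq c n (k+1) = (sq c n k).T n := by rw [sq, Function.iterate_succ_apply']; rfl
lemma sq_dom {n : ℕ} {θ : ℝ} (H : HA c n θ) (k : ℕ) : Dom c θ (sq c n k) := by
  induction k with
  | zero => exact (U0_dom H.ok).mono H.ok le_rfl H.t0.le
  | succ k ih => rw [sq_succ]; exact H.d _ (ih.mono H.ok H.t0.le H.t1.le)
lemma sq_near {n : ℕ} {θ : ℝ} (H : HA c n θ) (k : ℕ) : Near c (θ * (1 / (1 + (1-θ)^2/4))^k) (sq c n k) (sq c n (k+1)) := by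
  have t0 := H.t0
  induction k with
  | zero =>
    simp only [pow_zero, mul_one]
    refine near_aff H.ok H.t0 le_rfl (U0_dom H.ok) (sq_dom H 1).nrm (d := θ) (fun i hi => ?_) (by rw [div_self H.t0.ne']; simp)
    rw [show sq c n 0 = U0 c from rfl, co_U0 H.ok hi]; exact dom_co H.ok H.t0.le (sq_dom H 1) hi
  | succ k ih =>
    rw [sq_succ (k := k), sq_succ (k := k+1)]
    convert ih.step H (by positivity) ?_ using 1
    · rw [pow_succ]; ring
    · refine mul_le_of_le_one_right t0.le (pow_le_one₀ (by positivity) ?_)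
      rw [div_le_one (by positivity)]; nlinarith [sq_nonneg (1-θ)]
end RN
end

section
open Metric Filter Topology
namespace RN
variable {c : Ctx}

lemma lu_deriv {F : ℕ → ℂ → ℂ} {f g : ℂ → ℂ} (h : TendstoLocallyUniformlyOn F f atTop c.O) (hF : ∀ k, DifferentiableOn ℂ (F k) c.O)
    (hg : ContinuousOn g c.O) : TendstoLocallyUniformlyOn (fun k x => deriv (F k) x / g⁻¹ x) (fun x => deriv f x / g⁻¹ x) atTop c.O := by
  have h1 := h.deriv (Eventually.of_forall hF) Ctx.O_open
  have d := h.differentiableOn (Eventually.of_forall hF) Ctx.O_open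
  have h2 := TendstoLocallyUniformlyOn.mul₀ h1 (G := fun _ => g) (g := g) (l := atTop)
    (by
      apply TendstoUniformlyOn.tendstoLocallyUniformlyOn
      rw [Metric.tendstoUniformlyOn_iff]
      intro ε e0
      exact Eventually.of_forall fun k x hx => by simpa using e0) (d.deriv Ctx.O_open).continuousOn hg
  refine (h2.congr (fun k x hx => ?_)).congr_right (fun x hx => ?_) <;> simp [div_eq_mul_inv]

structure FP (c : Ctx) (n : ℕ) (θ : ℝ) (u : St) : Prop where
  dom : Dom c θ u
  l : (u.T n).l = u.l
  e : (u.T n).e = u.e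
  b : (u.T n).b = u.b
  V : ∀ x ∈ c.O, (u.T n).V x = u.V x
  cl : starRingEnd ℂ u.l = u.l
  ce : starRingEnd ℂ u.e = u.e
  cb : starRingEnd ℂ u.b = u.b
  cV : ∀ x ∈ c.O, u.V (starRingEnd ℂ x) = starRingEnd ℂ (u.V x)

lemma sq_cj (o : c.Ok) (n k : ℕ) : (sq c n k).cj = sq c n k := by
  induction k with
  | zero =>
    apply St.ext' <;> simp [sq, U0, St.cj, cjf, o.cj]
  | succ k ih => rw [sq_succ, ← St.cj_T, ih]

theorem thmB {n : ℕ} {θ : ℝ} (H : HA c n θ) : ∃ u, FP c n θ u := by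
  have o := H.ok
  have t0 := H.t0
  have t1 := H.t1
  set r := 1 / (1 + (1-θ)^2/4) with hr
  have q0 : 0 < (1-θ)^2/4 := by have : 0 < 1-θ := by linarith
                                positivity
  have r0 : 0 < r := by positivity
  have r1 : r < 1 := by rw [hr, div_lt_one (by positivity)]; linarith
  set w : ℕ → St := sq c n with hw
  have D := sq_dom H
  have st : ∀ i : Ix, i.ok c → ∀ k, dist (co c i (w k)) (co c i (w (k+1))) ≤ (3 * θ * rad c i) * r^k := fun i hi k => by
    rw [dist_comm, dist_eq_norm]
    refine ((sq_near H k).co o (by positivity) ?_ hi).trans (le_of_eq ?_)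
    · refine lt_of_le_of_lt (mul_le_of_le_one_right t0.le (pow_le_one₀ (by positivity) r1.le)) t1
    · ring
  have cv : ∀ i : Ix, i.ok c → Tendsto (fun k => co c i (w k)) atTop (𝓝 (limUnder atTop (fun k => co c i (w k)))) := fun i hi =>
    (cauchySeq_of_le_geometric r _ r1 (st i hi)).tendsto_limUnder
  set v : St := ⟨limUnder atTop (fun k => co c .l (w k)), limUnder atTop (fun k => co c .e (w k)), limUnder atTop (fun k => co c .b (w k)),
    fun x => limUnder atTop (fun k => co c (.V x) (w k))⟩ with hv
  have cvV : ∀ x ∈ c.O, Tendsto (fun k => (w k).V x) atTop (𝓝 (v.V x)) := fun x hx => cv (.V x) hx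
  have lu : TendstoLocallyUniformlyOn (fun k => (w k).V) v.V atTop c.O := by
    apply TendstoUniformlyOn.tendstoLocallyUniformlyOn
    rw [Metric.tendstoUniformlyOn_iff]
    intro ε e0
    have tz : Tendsto (fun k => (3 * θ * rad c (.V 0)) * r^k / (1-r)) atTop (𝓝 0) := by
      have := ((tendsto_pow_atTop_nhds_zero_of_lt_one r0.le r1).const_mul (3 * θ * rad c (.V 0))).div_const (1-r)
      simpa using this
    filter_upwards [tz.eventually (gt_mem_nhds e0)] with k hk x hx
    rw [dist_comm]
    exact lt_of_le_of_lt (dist_le_of_le_geometric_of_tendsto r _ r1 (st (.V x) hx) (cv (.V x) hx) k) hk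
  have dV : DifferentiableOn ℂ v.V c.O := lu.differentiableOn (Eventually.of_forall fun k => (D k).nrm.d) Ctx.O_open
  have cg : ContinuousOn (fun x => (c.v0 x)⁻¹) c.O := fun x hx => 
    ((o.v0_an x).inv (o.v0_ne (Ctx.norm_le_Mx hx))).continuousAt.continuousWithinAt
  have l1 : TendstoLocallyUniformlyOn (fun k => c.uu (w k).V) (c.uu v.V) atTop c.O := by
    have := lu_deriv lu (fun k => (D k).nrm.d) cg
    refine (this.congr (fun k x hx => ?_)).congr_right (fun x hx => ?_) <;> simp [Ctx.uu]
  have l2 : TendstoLocallyUniformlyOn (fun k => c.om (w k).V) (c.om v.V) atTop c.O := by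
    have := lu_deriv l1 (fun k x hx => ((D k).nrm.anU o hx).differentiableAt.differentiableWithinAt) cg
    refine (this.congr (fun k x hx => ?_)).congr_right (fun x hx => ?_) <;> simp [Ctx.om]
  have l3 : TendstoLocallyUniformlyOn (fun k => c.q (w k).V) (c.q v.V) atTop c.O := 
    l2.deriv (Eventually.of_forall fun k x hx => ((D k).nrm.anOm o hx).differentiableAt.differentiableWithinAt) Ctx.O_open
  have d1 := lu.deriv (Eventually.of_forall fun k => (D k).nrm.d) Ctx.O_open
  have d2 := d1.deriv (Eventually.of_forall fun k => (D k).nrm.d.deriv Ctx.O_open) Ctx.O_open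
  have nv : Nrm c v.V := by
    refine ⟨dV, ?_, ?_, ?_⟩
    · refine tendsto_nhds_unique (cvV 0 o.mem0) ?_
      simp only [hw, fun k => (D k).nrm.z0]; exact tendsto_const_nhds
    · refine tendsto_nhds_unique (d1.tendsto_at o.mem0) ?_
      simp only [Function.comp, hw, fun k => (D k).nrm.z1]; exact tendsto_const_nhds
    · refine tendsto_nhds_unique (d2.tendsto_at o.mem0) ?_
      simp only [Function.comp, hw, fun k => (D k).nrm.z2]; exact tendsto_const_nhds
  have cv' : ∀ i : Ix, i.ok c → Tendsto (fun k => co c i (w k)) atTop (𝓝 (co c i v)) := fun i hi => by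
    cases i with
    | q x => exact l3.tendsto_at hi
    | l => exact cv .l hi
    | e => exact cv .e hi
    | b => exact cv .b hi
    | V x => exact cv (.V x) hi
  have dv : Dom c θ v := dom_of nv (fun i hi => 
    le_of_tendsto ((cv' i hi).sub_const _).norm (Eventually.of_forall fun k => dom_co o t0.le (D k) hi))
  have fx : ∀ i : Ix, i.ok c → co c i (v.T n) = co c i v := fun i hi => by
    have lt : Tendsto (fun k => co c i (w (k+1))) atTop (𝓝 (co c i v)) := (cv' i hi).comp (tendsto_add_atTop_nat 1)
    refine tendsto_nhds_unique ?_ lt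
    rw [tendsto_iff_norm_sub_tendsto_zero]
    have sz : Tendsto (fun k => (3 * θ / (1-r) / (1-θ)) * r^k) atTop (𝓝 0) := by
      simpa using (tendsto_pow_atTop_nhds_zero_of_lt_one r0.le r1).const_mul (3 * θ / (1-r) / (1-θ))
    refine squeeze_zero' (Eventually.of_forall fun k => norm_nonneg _) ?_ (by simpa using sz.const_mul (3 * rad c i))
    filter_upwards [sz.eventually (gt_mem_nhds zero_lt_one)] with k hk
    have p1 : 0 < 1 - r := by linarith
    have p2 : 0 < 1 - θ := by linarith
    have nr : Near c ((3 * θ / (1-r) / (1-θ)) * r^k) (w k) v := by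
      refine near_aff o (by positivity) t0.le (D k) nv (d := 3 * θ * r^k/(1-r)) (fun j hj => ?_) ?_
      · rw [← dist_eq_norm, dist_comm]
        refine (dist_le_of_le_geometric_of_tendsto r _ r1 (st j hj) (cv' j hj) k).trans (le_of_eq (by ring))
      · have : 3 * θ * r ^ k / (1 - r) / (3 * θ / (1 - r) / (1 - θ) * r ^ k) = 1 - θ := by field_simp
        rw [this]; linarith
    obtain ⟨δ, A, Dd, h0, hs⟩ := nr.T H
    have nr' : Near c ((3 * θ / (1-r) / (1-θ)) * r^k) ((w k).T n) (v.T n) := ⟨δ, A, fun t ht => (Dd t ht).mono o t0.le t1.le, h0, hs⟩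
    have := nr'.co o (by positivity) hk hi
    rw [hw, sq_succ, norm_sub_rev]
    exact this
  have cjc : ∀ k, starRingEnd ℂ (w k).l = (w k).l ∧ starRingEnd ℂ (w k).e = (w k).e ∧ starRingEnd ℂ (w k).b = (w k).b ∧ 
      ∀ x, (w k).V (starRingEnd ℂ x) = starRingEnd ℂ ((w k).V x) := fun k => by
    have := sq_cj o n k
    refine ⟨congrArg St.l this, congrArg St.e this, congrArg St.b this, fun x => ?_⟩
    have h := congrFun (congrArg St.V this) (starRingEnd ℂ x)
    simp only [St.cj_V, cjf, Complex.conj_conj] at h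
    exact h.symm
  have sc : ∀ {f : ℕ → ℂ} {a : ℂ}, Tendsto f atTop (𝓝 a) → Tendsto (fun k => starRingEnd ℂ (f k)) atTop (𝓝 (starRingEnd ℂ a)) := fun h =>
    (Complex.continuous_conj.tendsto _).comp h
  refine ⟨v, dv, fx .l trivial, fx .e trivial, fx .b trivial, fun x hx => fx (.V x) hx, ?_, ?_, ?_, ?_⟩
  · refine tendsto_nhds_unique ?_ (cv' .l trivial)
    exact (sc (cv' .l trivial)).congr (fun k => (cjc k).1)
  · refine tendsto_nhds_unique ?_ (cv' .e trivial)
    exact (sc (cv' .e trivial)).congr (fun k => (cjc k).2.1)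
  · refine tendsto_nhds_unique ?_ (cv' .b trivial)
    exact (sc (cv' .b trivial)).congr (fun k => (cjc k).2.2.1)
  · intro x hx
    refine tendsto_nhds_unique (cvV _ (cj_O hx)) ?_
    exact (sc (cvV x hx)).congr (fun k => ((cjc k).2.2.2 x).symm)
end RN
end

section
open Metric Filter Topology
namespace RN
variable {c : Ctx} {u : St} {n : ℕ} {θ : ℝ}
noncomputable def St.U (u : St) (y : ℂ) : ℂ := u.b * u.G y

structure FX (c : Ctx) (n : ℕ) (u : St) : Prop where
  reg : Reg c u
  b0 : u.b ≠ 0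
  l0 : u.l ≠ 0
  y : ∀ x ∈ c.O, ∀ j ≤ n, u.y j (u.l * x) ∈ c.O
  re : ∀ x ∈ c.O, ∀ j ≤ n, 0 < (u.U (u.y j (u.l * x))).re
  s : ∀ x ∈ c.O, csq (u.U (u.y n (u.l * x))) ∈ c.O
  s2 : ∀ x ∈ c.O, u.U (csq (u.U (u.y n (u.l * x)))) = u.l ^ 2 * u.U x
  q : u.U (u.y n u.l) = 1

lemma Reg.U_deriv (R : Reg c u) (hb : u.b ≠ 0) {y : ℂ} (hy : y ∈ c.O) : AnalyticAt ℂ u.U y ∧ deriv u.U y ≠ 0 := by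
  have J := R.jetG hy
  refine ⟨analyticAt_const.mul J.an, ?_⟩
  have := (J.an.differentiableAt.hasDerivAt.const_mul u.b).deriv
  have e : u.U = fun y => u.b * u.G y := rfl
  rw [e, this]
  exact mul_ne_zero hb (by rw [J.h1]; exact J.d0)

lemma alg_aux {k h1 hx d : ℂ} (p1 : 1 + k * h1 ≠ 0) (px : 1 + k * hx ≠ 0) :
    hx * d + -h1 * d = -(d * (1 + k * h1)) * ((h1 / (1 + k * h1) - hx / (1 + k * hx)) / (1 / (1 + k * hx))) := by
  obtain ⟨A, hA⟩ : ∃ A, A = 1 + k * h1 := ⟨_, rfl⟩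
  obtain ⟨B, hB⟩ : ∃ B, B = 1 + k * hx := ⟨_, rfl⟩
  rw [← hA] at p1; rw [← hB] at px
  rw [← hA, ← hB]
  field_simp
  rw [hA, hB]; ring

lemma FP.fx (H : HA c n θ) (f : FP c n θ u) : FX c n u := by
  have o := H.ok
  have g := H.g u (f.dom.mono o H.t0.le H.t1.le)
  have hl : u.lh n = u.l := f.l
  have hb : u.bh n = u.b := f.b
  have G0 : u.G (u.y n u.l) ≠ 0 := (G_ne_of g.ptl.res).1
  have b0 : u.b ≠ 0 := by rw [← hb]; exact (G_ne_of g.ptl.res).2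
  have l0 : u.l ≠ 0 := by rw [← hl]; exact (g.reg.lh_eq g.ptl).2
  have cb : c.O ⊆ closedBall (c.m:ℂ) c.R := ball_subset_closedBall
  have pt := g.pt
  have ss := g.ss
  rw [hl] at pt ss
  have se : ∀ z, u.ss n z = csq (u.U (u.y n z)) := fun z => by rw [St.ss, hb, St.U, mul_comm]
  have gs : ∀ x, u.gg n x = u.G (u.ss n (u.l * x)) := fun x => by rw [St.gg, hl]
  have s1 : u.ss n u.l = 1 := Reg.ss_l G0
  have G1 : u.G 1 = 0 := by simp [St.G]
  have g1 : u.gg n 1 = 0 := by rw [gs, mul_one, s1, G1]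
  have l1 : 1 - u.l ≠ 0 := by have := g.l1; rw [hl] at this; exact sub_ne_zero.2 this.symm
  have ek : u.kk n = - u.e := by
    have := f.e
    change (-u.kk n - u.lh n * u.e) / (1 - u.lh n) = u.e at this
    rw [hl, div_eq_iff l1] at this
    linear_combination -this
  have d0 : deriv (u.gg n) 0 ≠ 0 := Good.gg0 o g
  obtain ⟨C, hC⟩ : ∃ C, ∀ x ∈ c.O, u.gg n x = C * u.G x := by
    refine ⟨-(deriv (u.gg n) 0 * (1 + u.kk n * u.hh n 1)), fun x hx => ?_⟩
    have V1 : u.V 1 = _ := (f.V 1 o.mem1).symm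
    have Vx : u.V x = _ := (f.V x hx).symm
    have p1 := g.ph 1 o.mem1
    have px := g.ph x hx
    have h1 : u.hh n 1 = - u.gg n 0 / deriv (u.gg n) 0 := by rw [St.hh, g1, zero_sub]
    have hx' : u.gg n x = u.hh n x * deriv (u.gg n) 0 + u.gg n 0 := by rw [St.hh]; field_simp; ring
    have h1' : u.gg n 0 = - u.hh n 1 * deriv (u.gg n) 0 := by rw [h1]; field_simp
    have eV : 1 + u.e * u.V x = 1 / (1 + u.kk n * u.hh n x) := by
      rw [Vx]; simp only [St.T]
      have ek' : u.e = - u.kk n := by rw [ek, neg_neg]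
      rw [ek', eq_div_iff px]; field_simp; ring
    rw [St.G, eV, V1, Vx]; simp only [St.T]
    rw [hx', h1']
    exact alg_aux p1 px
  have C2 : C = u.l ^ 2 := by
    have J1 := g.reg.jetG o.mem1
    have J2 := g.reg.jetSS g.ptl
    have a1 : HasDerivAt (u.gg n) (deriv u.G 1 * (deriv (u.ss n) u.l * u.l)) 1 := by
      have h1 : HasDerivAt (fun x => u.l * x) u.l 1 := by simpa using (hasDerivAt_id (1:ℂ)).const_mul u.l
      have h2 : HasDerivAt (u.ss n) (deriv (u.ss n) u.l) (u.l * 1) := by rw [mul_one]; exact J2.an.differentiableAt.hasDerivAt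
      have h3 := HasDerivAt.comp (1:ℂ) h2 h1
      have h4 : HasDerivAt u.G (deriv u.G 1) ((u.ss n ∘ fun x => u.l * x) 1) := by
        simp only [Function.comp, mul_one, s1]; exact J1.an.differentiableAt.hasDerivAt
      have := HasDerivAt.comp (1:ℂ) h4 h3
      refine this.congr_of_eventuallyEq (Eventually.of_forall fun x => ?_)
      rw [gs]; rfl
    have a2 : HasDerivAt (u.gg n) (C * deriv u.G 1) 1 := by
      refine (J1.an.differentiableAt.hasDerivAt.const_mul C).congr_of_eventuallyEq ?_
      filter_upwards [c.O_open.mem_nhds o.mem1] with x hx using hC x hx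
    have e := a1.unique a2
    have hd : deriv (u.ss n) u.l = u.l := f.l
    rw [hd] at e
    have nz : deriv u.G 1 ≠ 0 := by rw [J1.h1]; exact J1.d0
    apply mul_right_cancel₀ nz
    linear_combination -e
  refine ⟨g.reg, b0, l0, fun x hx j hj => (pt x (cb hx)).y j hj, fun x hx j hj => ?_, fun x hx => ?_, fun x hx => ?_, ?_⟩
  · rcases hj.lt_or_eq with h | rfl
    · exact (pt x (cb hx)).re j h
    · have := (pt x (cb hx)).res
      rw [hb, mul_comm] at this; exact this
  · rw [← se]; exact ss x (cb hx)
  · have := hC x hx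
    rw [gs, C2] at this
    rw [← se, St.U, this, St.U]; ring
  · rw [St.U, ← hb, St.bh, inv_mul_cancel₀ G0]
end RN
end

section
open Metric Filter Topology
namespace RN
structure RS (α β l : ℝ) (n : ℕ) (u φ L : ℝ → ℝ) : Prop where
  I0 : (0:ℝ) ∈ Set.Ioo α β
  I1 : (1:ℝ) ∈ Set.Ioo α β
  anti : StrictAntiOn u (Set.Ioo α β)
  cont : ContinuousOn u (Set.Ioo α β)
  u1 : u 1 = 0
  l1 : |l| < 1
  Ld : ∀ y, L y = - √(u y)
  y : ∀ x ∈ Set.Ioo α β, ∀ j ≤ n, L^[j] (l * x) ∈ Set.Ioo α β ∧ 0 < u (L^[j] (l * x))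
  s : ∀ x ∈ Set.Ioo α β, √(u (L^[n] (l * x))) ∈ Set.Ioo α β ∧ u (√(u (L^[n] (l * x)))) = l ^ 2 * u x
  q : u (L^[n] l) = 1
  ul : l ^ 2 < u |l|
  ph : ∀ y ∈ Set.Ioo α β, 0 ≤ u y → u y ≤ 1 → φ (u y) = y

variable {α β l : ℝ} {n : ℕ} {u φ L : ℝ → ℝ}
lemma RS.li (h : RS α β l n u φ L) : |l| ∈ Set.Ioo α β :=
  ⟨h.I0.1.trans_le (abs_nonneg _), h.l1.trans h.I1.2⟩

lemma RS.claim (h : RS α β l n u φ L) {x x' : ℝ} (hx : x ∈ Set.Ioo α β) (hx' : x' ∈ Set.Ioo α β)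
    (a : |x| ≤ 1) (a' : |x'| ≤ 1) : ∀ j ≤ n, L^[j+1] (l * x) < L^[j] (l * x') := by
  have b : ∀ {x}, |x| ≤ 1 → |l * x| ≤ |l| := fun {x} hx => by
    rw [abs_mul]; exact mul_le_of_le_one_right (abs_nonneg _) hx
  intro j
  induction j with
  | zero =>
    intro _
    have h0 := (h.y x hx 0 (Nat.zero_le _)).1
    simp only [Function.iterate_zero, id] at h0
    simp only [Nat.zero_add, Function.iterate_one, Function.iterate_zero, id]
    have h1 : u |l| ≤ u (l * x) := h.anti.antitoneOn h0 h.li ((le_abs_self _).trans (b a))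
    have h2 : |l| < √(u (l * x)) := by
      apply Real.lt_sqrt_of_sq_lt
      rw [sq_abs]; exact h.ul.trans_le h1
    rw [h.Ld]
    have := neg_le_of_abs_le (b a')
    linarith
  | succ j ih =>
    intro hj
    have i := ih (by omega)
    rw [Function.iterate_succ_apply' L (j+1), Function.iterate_succ_apply' L j (l * x'), h.Ld, h.Ld]
    have m1 := h.y x hx (j+1) hj
    have m2 := h.y x' hx' j (by omega)
    have := h.anti m1.1 m2.1 i
    have := Real.sqrt_lt_sqrt m2.2.le this
    linarith

lemma RS.claim2 (h : RS α β l n u φ L) {x x' : ℝ} (hx : x ∈ Set.Ioo α β) (hx' : x' ∈ Set.Ioo α β)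
    (a : |x| ≤ 1) (a' : |x'| ≤ 1) : ∀ i j, j + i ≤ n → L^[j+i+1] (l * x) < L^[j] (l * x') := by
  intro i
  induction i with
  | zero => intro j hj; exact h.claim hx hx' a a' j hj
  | succ i ih =>
    intro j hj
    have h1 := h.claim hx hx a a (j+(i+1)) hj
    exact h1.trans (ih j (by omega))

lemma RS.Q (h : RS α β l n u φ L) : -1 < L^[n] l ∧ L^[n] l < 1 ∧ L^[n] l ∈ Set.Ioo α β := by
  have h1 := h.claim h.I1 h.I1 (by simp) (by simp) n le_rfl
  have h2 := (h.y 1 h.I1 n le_rfl)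
  rw [mul_one] at h1 h2
  rw [Function.iterate_succ_apply', h.Ld, h.q, Real.sqrt_one] at h1
  refine ⟨h1, ?_, h2.1⟩
  by_contra hc
  have := h.anti.antitoneOn h.I1 h2.1 (not_lt.1 hc)
  rw [h.q, h.u1] at this; linarith

lemma RS.ex (h : RS α β l n u φ L) {ζ : ℝ} (hz : |ζ| ≤ 1) :
    ∃ x ∈ Set.Ioo α β, |x| ≤ 1 ∧ u x = ζ ^ 2 := by
  obtain ⟨q1, q2, q3⟩ := h.Q
  have sub : Set.Icc (L^[n] l) 1 ⊆ Set.Ioo α β := fun x hx => ⟨q3.1.trans_le hx.1, hx.2.trans_lt h.I1.2⟩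
  have := intermediate_value_Icc' q2.le (h.cont.mono sub)
  rw [h.u1, h.q] at this
  obtain ⟨x, hx, e⟩ := this ⟨sq_nonneg ζ, by rw [← sq_abs]; exact pow_le_one₀ (abs_nonneg _) hz⟩
  exact ⟨x, sub hx, abs_le.2 ⟨by linarith [hx.1], hx.2⟩, e⟩

lemma RS.orb (h : RS α β l n u φ L) {f : ℝ → ℝ} (hf : ∀ z, f z = φ (z ^ 2)) {ζ x : ℝ} (hz : |ζ| ≤ 1)
    (hx : x ∈ Set.Ioo α β) (a : |x| ≤ 1) (hu : u x = ζ ^ 2) :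
    f ζ = x ∧ |l| < f (l * ζ) ∧ f (l * ζ) ≤ 1 ∧
    (∀ i ≤ n, f^[i+2] (l * ζ) = L^[n-i] (l * x)) ∧
    (∀ j ≤ n, |L^[j] (l * x)| ≤ 1) := by
  have z1 : ζ ^ 2 ≤ 1 := by rw [← sq_abs]; exact pow_le_one₀ (abs_nonneg _) hz
  have e1 : f ζ = x := by rw [hf, ← hu]; exact h.ph x hx (by rw [hu]; positivity) (by rw [hu]; exact z1)
  have b : |l * x| ≤ |l| := by
    rw [abs_mul]; exact mul_le_of_le_one_right (abs_nonneg _) a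
  have Yle : ∀ j ≤ n, L^[j] (l * x) ≤ |l| := by
    intro j hj
    rcases j with _ | j
    · exact (le_abs_self _).trans b
    · have := h.claim2 hx hx a a j 0 (by omega)
      simp only [Nat.zero_add, Function.iterate_zero, id] at this
      exact this.le.trans ((le_abs_self _).trans b)
  have Yge : ∀ j ≤ n, -1 < L^[j] (l * x) := by
    intro j hj
    have h1 := h.claim2 h.I1 hx (by simp) a (n - j) j (by omega)
    rw [mul_one, show j + (n - j) = n by omega, Function.iterate_succ_apply', h.Ld, h.q, Real.sqrt_one] at h1
    exact h1
  have Yab : ∀ j ≤ n, |L^[j] (l * x)| ≤ 1 := fun j hj =>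
    abs_le.2 ⟨(Yge j hj).le, (Yle j hj).trans h.l1.le⟩
  obtain ⟨s1, s2⟩ := h.s x hx
  have l2 : l ^ 2 ≤ 1 := by rw [← sq_abs]; exact pow_le_one₀ (abs_nonneg _) h.l1.le
  have p0 : 0 ≤ l ^ 2 * ζ ^ 2 := by positivity
  have p1 : l ^ 2 * ζ ^ 2 ≤ 1 := mul_le_one₀ l2 (by positivity) z1
  have e2 : f (l * ζ) = √(u (L^[n] (l * x))) := by
    rw [hf, mul_pow, ← hu, ← s2]
    exact h.ph _ s1 (by rw [s2, hu]; exact p0) (by rw [s2, hu]; exact p1)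
  have sle : √(u (L^[n] (l * x))) ≤ 1 := by
    by_contra hc
    have := h.anti h.I1 s1 (not_le.1 hc)
    rw [s2, hu, h.u1] at this; linarith
  have step : ∀ j ≤ n, u (L^[j] (l * x)) ≤ 1 → φ (u (L^[j] (l * x))) = L^[j] (l * x) := fun j hj h1 =>
    h.ph _ (h.y x hx j hj).1 (h.y x hx j hj).2.le h1
  refine ⟨e1, ?_, e2 ▸ sle, ?_, Yab⟩
  · rw [e2]; apply Real.lt_sqrt_of_sq_lt
    rw [sq_abs]
    exact h.ul.trans_le (h.anti.antitoneOn (h.y x hx n le_rfl).1 h.li (Yle n le_rfl))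
  · intro i
    induction i with
    | zero =>
      intro _
      simp only [Nat.zero_add, Nat.sub_zero]
      rw [show (2:ℕ) = 1 + 1 from rfl, Function.iterate_succ_apply', Function.iterate_one, e2, hf,
        Real.sq_sqrt (h.y x hx n le_rfl).2.le]
      exact step n le_rfl (by simpa using (Real.sqrt_le_iff.1 sle).2)
    | succ i ih =>
      intro hi
      rw [show i + 1 + 2 = (i + 2) + 1 by ring, Function.iterate_succ_apply', ih (by omega), hf]
      have e : L^[n - i] (l * x) = - √(u (L^[n - (i+1)] (l * x))) := by
        rw [show n - i = (n - (i+1)) + 1 by omega, Function.iterate_succ_apply', h.Ld]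
      have hp := (h.y x hx (n - (i+1)) (by omega)).2
      have e3 : (L^[n - i] (l * x)) ^ 2 = u (L^[n - (i+1)] (l * x)) := by
        rw [e, neg_sq, Real.sq_sqrt hp.le]
      rw [e3]
      refine step _ (by omega) ?_
      rw [← e3, ← sq_abs]; exact pow_le_one₀ (abs_nonneg _) (Yab _ (by omega))

theorem thmR (h : RS α β l n u φ L) {f : ℝ → ℝ} (hf : ∀ z, f z = φ (z ^ 2)) :
    (∀ ζ, |ζ| ≤ 1 → f^[n+2] (l * ζ) = l * f ζ ∧ |f ζ| ≤ 1 ∧ ∀ k < n + 2, |f^[k] (l * ζ)| ≤ 1) ∧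
    (∀ ζ ζ', |ζ| ≤ 1 → |ζ'| ≤ 1 → ∀ k₁ k₂, k₁ < k₂ → k₂ < n + 2 → f^[k₁] (l * ζ) ≠ f^[k₂] (l * ζ')) := by
  have b : ∀ {x}, |x| ≤ 1 → |l * x| ≤ |l| := fun {x} hx => by
    rw [abs_mul]; exact mul_le_of_le_one_right (abs_nonneg _) hx
  constructor
  · intro ζ hz
    obtain ⟨x, hx, a, hu⟩ := h.ex hz
    obtain ⟨e1, e2, e3, e4, e5⟩ := h.orb hf hz hx a hu
    refine ⟨?_, by rw [e1]; exact a, ?_⟩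
    · rw [e4 n le_rfl, e1]; simp
    · intro k hk
      rcases k with _ | _ | k
      · exact (b hz).trans h.l1.le
      · simp only [Nat.zero_add, Function.iterate_one]
        exact abs_le.2 ⟨by linarith [abs_nonneg l], e3⟩
      · rw [e4 k (by omega)]; exact e5 _ (by omega)
  · intro ζ ζ' hz hz' k₁ k₂ hk hk2
    obtain ⟨x, hx, a, hu⟩ := h.ex hz
    obtain ⟨e1, e2, e3, e4, e5⟩ := h.orb hf hz hx a hu
    obtain ⟨x', hx', a', hu'⟩ := h.ex hz'
    obtain ⟨e1', e2', e3', e4', e5'⟩ := h.orb hf hz' hx' a' hu'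
    have low : ∀ {i}, i < n → L^[n-i] (l * x') < -|l| := fun {i} hi => by
      have h0 : L^[n-i] (l * x') ≤ L^[1] (l * x') := by
        rcases Nat.eq_or_lt_of_le (show 1 ≤ n - i by omega) with h1 | h1
        · rw [← h1]
        · have := h.claim2 hx' hx' a' a' (n - i - 2) 1 (by omega)
          rw [show 1 + (n - i - 2) + 1 = n - i by omega] at this
          exact this.le
      have h0' := (h.y x' hx' 0 (Nat.zero_le _)).1
      simp only [Function.iterate_zero, id] at h0'
      have h1 : u |l| ≤ u (l * x') := h.anti.antitoneOn h0' h.li ((le_abs_self _).trans (b a'))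
      have h2 : |l| < √(u (l * x')) := by
        apply Real.lt_sqrt_of_sq_lt
        rw [sq_abs]; exact h.ul.trans_le h1
      rw [Function.iterate_one, h.Ld] at h0
      linarith
    rcases k₂ with _ | _ | k₂
    · omega
    · have : k₁ = 0 := by omega
      subst this
      simp only [Nat.zero_add, Function.iterate_one, Function.iterate_zero, id]
      have := (le_abs_self _).trans (b hz)
      exact (this.trans_lt e2').ne
    · rw [e4' k₂ (by omega)]
      have hl := low (show k₂ < n by omega)
      rcases k₁ with _ | _ | k₁
      · simp only [Function.iterate_zero, id]
        have := neg_le_of_abs_le (b hz)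
        exact (hl.trans_le this).ne'
      · simp only [Nat.zero_add, Function.iterate_one]
        have := abs_nonneg l
        exact (by linarith : L^[n-k₂] (l * x') < f (l * ζ)).ne'
      · rw [e4 k₁ (by omega)]
        have := h.claim2 hx hx' a a' (k₂ - k₁ - 1) (n - k₂) (by omega)
        rw [show n - k₂ + (k₂ - k₁ - 1) + 1 = n - k₁ by omega] at this
        exact this.ne
end RN
end

section
open Metric Filter Topology
namespace RN
variable {α β l : ℝ} {n : ℕ} {u φ L : ℝ → ℝ}

lemma acomp (f : ℂ → ℂ) (x : ℂ) {g : ℂ → ℂ} (hg : AnalyticAt ℂ g (f x)) (hf : AnalyticAt ℂ f x) :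
    AnalyticAt ℂ (fun z => g (f z)) x := hg.comp hf

theorem thmC (h : RS α β l n u φ L) (l0 : l ≠ 0) {F : ℂ → ℂ} {ρ : ℝ} (hρ : 1 < ρ)
    (hF : DifferentiableOn ℂ F (ball 0 ρ))
    (hc : ∀ w ∈ ball (0:ℂ) ρ, F (starRingEnd ℂ w) = starRingEnd ℂ (F w))
    (hφ : ∀ t, φ t = (F t).re) (hd : deriv F 0 ≠ 0) :
    ∃ (lam r r' : ℝ) (f : ℂ → ℂ),
      0 < |lam| ∧ |lam| < 1 ∧ 0 < r' ∧ r' < r ∧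
      AnalyticOnNhd ℂ f (Metric.ball (0 : ℂ) r) ∧
      (∀ z : ℂ, f (starRingEnd ℂ z) = starRingEnd ℂ (f z)) ∧
      deriv f 0 = 0 ∧ iteratedDeriv 2 f 0 = 2 ∧
      (∀ z ∈ Metric.ball (0 : ℂ) r', ∀ k < n+2, f^[k] ((lam : ℂ) * z) ∈ Metric.ball (0 : ℂ) r) ∧
      (∀ z ∈ Metric.ball (0 : ℂ) r', f^[n+2] ((lam : ℂ) * z) = (lam : ℂ) * f z) ∧
      ∃ a b : ℝ, a < 0 ∧ 0 < b ∧ Set.Icc a b ⊆ Set.Ioo (-r) r ∧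
        (∀ k < n+2, (fun x : ℝ => (f (x : ℂ)).re)^[k] '' Set.Icc a b ⊆ Set.Ioo (-r) r) ∧
        (fun x : ℝ => (f (x : ℂ)).re)^[n+2] '' Set.Icc a b ⊆ Set.Icc a b ∧
        (∀ k₁ k₂ : ℕ, k₁ < k₂ → k₂ < n+2 →
          interior ((fun x : ℝ => (f (x : ℂ)).re)^[k₁] '' Set.Icc a b) ∩
            interior ((fun x : ℝ => (f (x : ℂ)).re)^[k₂] '' Set.Icc a b) = ∅) := by
  classical
  have ρ0 : 0 < ρ := by linarith
  obtain ⟨F0, hF0⟩ : ∃ F0 : ℂ → ℂ, F0 = fun w => if ‖w‖ < ρ then F w else 0 := ⟨_, rfl⟩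
  have F0e : ∀ w, ‖w‖ < ρ → F0 w = F w := fun w hw => by rw [hF0]; simp [hw]
  have F0ev : ∀ w, ‖w‖ < ρ → F0 =ᶠ[𝓝 w] F := fun w hw => by
    filter_upwards [isOpen_ball.mem_nhds (show w ∈ ball (0:ℂ) ρ by simpa using hw)] with z hz
    exact F0e z (by simpa using hz)
  have F0an : ∀ w, ‖w‖ < ρ → AnalyticAt ℂ F0 w := fun w hw =>
    (hF.analyticAt (isOpen_ball.mem_nhds (by simpa using hw))).congr (F0ev w hw).symm
  have F0c : ∀ w, F0 (starRingEnd ℂ w) = starRingEnd ℂ (F0 w) := fun w => by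
    by_cases hw : ‖w‖ < ρ
    · rw [F0e w hw, F0e _ (by rwa [RCLike.norm_conj]), hc w (by simpa using hw)]
    · rw [hF0]; simp only [RCLike.norm_conj, if_neg hw, map_zero]
  have dF0 : deriv F0 0 = deriv F 0 := (F0ev 0 (by simpa using ρ0)).deriv_eq
  obtain ⟨a, ha⟩ : ∃ a : ℝ, (a:ℂ) = deriv F0 0 := by
    have e : (starRingEnd ℂ ∘ F0 ∘ starRingEnd ℂ) = F0 := by
      funext w; simp [F0c]
    have := congrFun (deriv_conj_conj (𝕜 := ℂ) (f := F0)) 0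
    rw [e] at this
    simp only [Function.comp, map_zero] at this
    exact ⟨_, Complex.conj_eq_iff_re.1 this.symm⟩
  have a0 : a ≠ 0 := by
    rintro rfl
    rw [dF0] at ha; exact hd (by rw [← ha]; simp)
  have a0' : (a:ℂ) ≠ 0 := by exact_mod_cast a0
  have aa : 0 < |a| := abs_pos.2 a0
  obtain ⟨f, hf⟩ : ∃ f : ℂ → ℂ, f = fun z => a * F0 (z^2 / a^2) := ⟨_, rfl⟩
  obtain ⟨r, hr⟩ : ∃ r : ℝ, r = |a| * √ρ := ⟨_, rfl⟩
  have sρ : 1 < √ρ := by rw [Real.lt_sqrt zero_le_one]; simpa using hρ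
  have ar : |a| < r := by rw [hr]; exact lt_mul_of_one_lt_right aa sρ
  have sm : ∀ z : ℂ, ‖z‖ < r → ‖z^2 / (a:ℂ)^2‖ < ρ := fun z hz => by
    rw [norm_div, norm_pow, norm_pow, Complex.norm_real, Real.norm_eq_abs, div_lt_iff₀ (by positivity)]
    have : ‖z‖^2 < r^2 := pow_lt_pow_left₀ hz (norm_nonneg _) (by norm_num)
    rw [hr, mul_pow, Real.sq_sqrt ρ0.le] at this; linarith
  have inn : ∀ z : ℂ, AnalyticAt ℂ (fun z : ℂ => z^2 / (a:ℂ)^2) z := fun z => by fun_prop (disch := exact pow_ne_zero 2 a0')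
  have fan : ∀ z : ℂ, ‖z‖ < r → AnalyticAt ℂ f z := fun z hz => by
    rw [hf]
    exact analyticAt_const.mul (acomp (fun z : ℂ => z^2 / (a:ℂ)^2) z (F0an _ (sm z hz)) (inn z))
  have fc : ∀ z : ℂ, f (starRingEnd ℂ z) = starRingEnd ℂ (f z) := fun z => by
    rw [hf]; simp only [map_mul, Complex.conj_ofReal, ← F0c, map_div₀, map_pow]
  obtain ⟨φ1, hφ1⟩ : ∃ φ1 : ℝ → ℝ, φ1 = fun t : ℝ => (F0 (t:ℂ)).re := ⟨_, rfl⟩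
  have h' : RS α β l n u φ1 L := by
    refine { h with ph := fun y hy y0 y1 => ?_ }
    rw [hφ1]; simp only
    rw [F0e _ (by rw [Complex.norm_real, Real.norm_eq_abs, abs_of_nonneg y0]; linarith), ← hφ]
    exact h.ph y hy y0 y1
  obtain ⟨f1, hf1⟩ : ∃ f1 : ℝ → ℝ, f1 = fun z => φ1 (z^2) := ⟨_, rfl⟩
  obtain ⟨R1, R2⟩ := thmR h' (f := f1) (fun z => by rw [hf1])
  obtain ⟨g, hg⟩ : ∃ g : ℝ → ℝ, g = fun x : ℝ => (f (x : ℂ)).re := ⟨_, rfl⟩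
  have gf : ∀ x : ℝ, f x = (g x : ℂ) := fun x => by
    rw [hg]; simp only
    have := fc x
    rw [Complex.conj_ofReal] at this
    exact (Complex.conj_eq_iff_re.1 this.symm).symm
  have gfk : ∀ k, ∀ x : ℝ, f^[k] x = (g^[k] x : ℂ) := fun k => by
    induction k with
    | zero => intro x; rfl
    | succ k ih => intro x; rw [Function.iterate_succ_apply', Function.iterate_succ_apply', ih, gf]
  have gs : ∀ ζ, g (a * ζ) = a * f1 ζ := fun ζ => by
    rw [hg, hf, hf1, hφ1]
    simp only
    have : ((a * ζ : ℝ):ℂ)^2 / (a:ℂ)^2 = ((ζ^2 : ℝ) : ℂ) := by push_cast; field_simp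
    rw [this, Complex.re_ofReal_mul]
  have gsk : ∀ k ζ, g^[k] (a * ζ) = a * f1^[k] ζ := fun k => by
    induction k with
    | zero => intro x; rfl
    | succ k ih => intro x; rw [Function.iterate_succ_apply', Function.iterate_succ_apply', ih, gs]
  have orb : ∀ k < n + 2, ‖f^[k] ((l:ℂ) * 0)‖ < r := fun k hk => by
    have e : (l:ℂ) * 0 = ((a * (l * 0) : ℝ) : ℂ) := by push_cast; ring
    rw [e, gfk, gsk, Complex.norm_real, Real.norm_eq_abs, abs_mul]
    have := ((R1 0 (by simp)).2.2 k hk)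
    exact (mul_le_of_le_one_right (abs_nonneg _) this).trans_lt ar
  have ank : ∀ k ≤ n + 2, AnalyticAt ℂ (fun z : ℂ => f^[k] ((l:ℂ) * z)) 0 := by
    intro k
    induction k with
    | zero => intro _; simp only [Function.iterate_zero, id]; fun_prop
    | succ k ih =>
      intro hk
      simp only [Function.iterate_succ_apply']
      exact acomp (fun z : ℂ => f^[k] ((l:ℂ) * z)) 0 (fan _ (orb k (by omega))) (ih (by omega))
  have f0 : AnalyticAt ℂ f 0 := fan 0 (by rw [norm_zero]; linarith)
  have ev : ∀ᶠ z in 𝓝 (0:ℂ), f^[n+2] ((l:ℂ) * z) = (l:ℂ) * f z := by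
    rw [← (ank (n+2) le_rfl).frequently_eq_iff_eventually_eq (show AnalyticAt ℂ (fun z => (l:ℂ) * f z) 0 from analyticAt_const.mul f0)]
    have key : ∀ t : ℝ, |t| ≤ |a| → f^[n+2] ((l:ℂ) * t) = (l:ℂ) * f t := fun t ht => by
      have e1 : t = a * (t / a) := by field_simp
      have e2 : l * t = a * (l * (t / a)) := by field_simp
      have z1 : |t / a| ≤ 1 := by rw [abs_div, div_le_one aa]; exact ht
      have := (R1 _ z1).1
      rw [← Complex.ofReal_mul, gfk, gf, e2, gsk, this]
      rw [e1, gs, ← e1]; push_cast; ring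
    rw [frequently_iff]
    intro U hU
    rw [mem_nhdsWithin_iff_exists_mem_nhds_inter] at hU
    obtain ⟨W, hW, hU⟩ := hU
    obtain ⟨ε, ε0, hε⟩ := Metric.mem_nhds_iff.1 hW
    have t0 : 0 < min (ε/2) |a| := by positivity
    refine ⟨((min (ε/2) |a| : ℝ):ℂ), hU ⟨hε ?_, ?_⟩, key _ ?_⟩
    · rw [mem_ball_zero_iff, Complex.norm_real, Real.norm_eq_abs, abs_of_pos t0]
      exact (min_le_left _ _).trans_lt (by linarith)
    · simpa only [Set.mem_compl_iff, Set.mem_singleton_iff, Complex.ofReal_eq_zero] using t0.ne'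
    · rw [abs_of_pos t0]; exact min_le_right _ _
  have ev2 : ∀ᶠ z in 𝓝 (0:ℂ), ∀ k < n + 2, f^[k] ((l:ℂ) * z) ∈ ball (0:ℂ) r := by
    have : ∀ k ∈ Finset.range (n+2), ∀ᶠ z in 𝓝 (0:ℂ), f^[k] ((l:ℂ) * z) ∈ ball (0:ℂ) r := fun k hk => by
      have hk := Finset.mem_range.1 hk
      exact (ank k hk.le).continuousAt.eventually_mem (isOpen_ball.mem_nhds (by simpa using orb k hk))
    filter_upwards [(Filter.eventually_all_finset _).2 this] with z hz k hk using hz k (Finset.mem_range.2 hk)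
  obtain ⟨δ, δ0, hδ⟩ := Metric.eventually_nhds_iff.1 (ev.and ev2)
  have r0 : 0 < r := aa.trans ar
  have lpos := abs_pos.2 l0
  have Jz : ∀ w, w ∈ Set.Icc (-(|a| * |l|)) (|a| * |l|) → ∃ ζ, |ζ| ≤ 1 ∧ w = a * (l * ζ) := fun w hw => by
    refine ⟨w / (a * l), ?_, by field_simp⟩
    rw [abs_div, abs_mul, div_le_one (by positivity)]
    exact abs_le.2 hw
  have dfe : ∀ᶠ z in 𝓝 (0:ℂ), deriv f z = z * (2 / a * deriv F0 (z^2/(a:ℂ)^2)) := by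
    filter_upwards [isOpen_ball.mem_nhds (show (0:ℂ) ∈ ball (0:ℂ) r by simpa using r0)] with z hz
    have hz' := sm z (by simpa using hz)
    have h1 : HasDerivAt (fun z : ℂ => z^2 / (a:ℂ)^2) (2 * z / (a:ℂ)^2) z := by
      simpa using (hasDerivAt_pow 2 z).div_const ((a:ℂ)^2)
    have h2 := (F0an _ hz').differentiableAt.hasDerivAt
    have h3 := (h2.comp z h1).const_mul (a:ℂ)
    have : f = fun z => (a:ℂ) * (F0 ∘ fun z : ℂ => z^2 / (a:ℂ)^2) z := by rw [hf]; rfl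
    rw [this, h3.deriv]
    field_simp
  have df0 : deriv f 0 = 0 := by rw [dfe.self_of_nhds]; simp
  have ddf : iteratedDeriv 2 f 0 = 2 := by
    rw [iteratedDeriv_succ, iteratedDeriv_one]
    rw [(show deriv f =ᶠ[𝓝 0] _ from dfe).deriv_eq]
    have h1 : DifferentiableAt ℂ (fun z : ℂ => 2 / (a:ℂ) * deriv F0 (z^2/(a:ℂ)^2)) 0 := by
      have h2 : AnalyticAt ℂ (deriv F0) ((0:ℂ)^2/(a:ℂ)^2) := (F0an _ (sm 0 (by simpa using r0))).deriv
      exact (acomp (fun z : ℂ => z^2 / (a:ℂ)^2) 0 h2 (inn 0)).differentiableAt.const_mul _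
    have := ((hasDerivAt_id (0:ℂ)).mul h1.hasDerivAt).deriv
    have e : ((id : ℂ → ℂ) * fun z : ℂ => 2 / (a:ℂ) * deriv F0 (z^2/(a:ℂ)^2)) = fun z : ℂ => z * (2 / (a:ℂ) * deriv F0 (z^2/(a:ℂ)^2)) := rfl
    rw [e] at this
    rw [this]
    simp [← ha, a0']
  have jr : |a| * |l| < r := (mul_le_of_le_one_right aa.le h.l1.le).trans_lt ar
  refine ⟨l, r, min δ (r/2), f, lpos, h.l1, by positivity, (min_le_right _ _).trans_lt (by linarith),
    fun z hz => fan z (by simpa using hz), fc, df0, ddf, fun z hz => ?_, fun z hz => ?_,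
    -(|a| * |l|), |a| * |l|, by have : 0 < |a| * |l| := by positivity
                                linarith, by positivity, fun x hx => ⟨?_, ?_⟩, ?_, ?_, ?_⟩
  · exact (hδ (lt_of_lt_of_le hz (min_le_left _ _))).2
  · exact (hδ (lt_of_lt_of_le hz (min_le_left _ _))).1
  · linarith [hx.1]
  · linarith [hx.2]
  · rw [← hg]
    rintro k hk _ ⟨w, hw, rfl⟩
    obtain ⟨ζ, z1, rfl⟩ := Jz w hw
    rw [gsk, Set.mem_Ioo, ← abs_lt, abs_mul]
    exact (mul_le_of_le_one_right aa.le ((R1 ζ z1).2.2 k hk)).trans_lt ar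
  · rw [← hg]
    rintro _ ⟨w, hw, rfl⟩
    obtain ⟨ζ, z1, rfl⟩ := Jz w hw
    rw [gsk, (R1 ζ z1).1, Set.mem_Icc, ← abs_le, abs_mul, abs_mul]
    gcongr
    exact mul_le_of_le_one_right lpos.le (R1 ζ z1).2.1
  · rw [← hg]
    intro k₁ k₂ hk hk2
    rw [Set.eq_empty_iff_forall_notMem]
    rintro x ⟨hx1, hx2⟩
    obtain ⟨w, hw, e⟩ := interior_subset hx1
    obtain ⟨w', hw', e'⟩ := interior_subset hx2
    obtain ⟨ζ, z1, rfl⟩ := Jz w hw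
    obtain ⟨ζ', z1', rfl⟩ := Jz w' hw'
    rw [gsk] at e e'
    exact R2 ζ ζ' z1 z1' k₁ k₂ hk hk2 (mul_left_cancel₀ a0 (e.trans e'.symm))
end RN
end

section
open Metric Filter Topology
namespace RN
variable {c : Ctx} {u : St} {n : ℕ} {θ : ℝ}

structure EX (c : Ctx) (u : St) : Prop where
  q : ∃ q < 1, ∀ x ∈ c.O, ‖deriv u.V x - 1‖ ≤ q
  k : 0 < u.k.re
  e : ∀ x ∈ c.O, 0 < (1 + u.e * u.V x).re
  b : 0 < u.b.re
  l1 : |u.l.re| < 1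
  ul : u.l.re ^ 2 < (u.U ((|u.l.re| : ℝ) : ℂ)).re

lemma V_sub {q : ℝ} (d : DifferentiableOn ℂ u.V c.O) (hq : ∀ x ∈ c.O, ‖deriv u.V x - 1‖ ≤ q) {x y : ℂ} (hx : x ∈ c.O)
    (hy : y ∈ c.O) : ‖(u.V x - u.V y) - (x - y)‖ ≤ q * ‖x - y‖ := by
  have := Convex.norm_image_sub_le_of_norm_hasDerivWithin_le (f := fun x => u.V x - x) (f' := fun x => deriv u.V x - 1)
    (s := c.O) (C := q) (x := y) (y := x)
    (fun z hz => ((d.differentiableAt (c.O_open.mem_nhds hz)).hasDerivAt.sub (hasDerivAt_id z)).hasDerivWithinAt)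
    hq (convex_ball _ _) hy hx
  simpa [sub_sub_sub_comm] using this

lemma EX.injV (E : EX c u) (R : Reg c u) {x y : ℂ} (hx : x ∈ c.O) (hy : y ∈ c.O) (h : u.V x = u.V y) : x = y := by
  obtain ⟨q, q1, hq⟩ := E.q
  have := V_sub R.d hq hx hy
  rw [h, sub_self, zero_sub, norm_neg] at this
  by_contra hc
  have h2 : 0 < ‖x - y‖ := norm_pos_iff.2 (sub_ne_zero.2 hc)
  nlinarith

lemma Reg.U_inj' (R : Reg c u) (b0 : u.b ≠ 0) {x y : ℂ} (hx : x ∈ c.O) (hy : y ∈ c.O) (h : u.U x = u.U y) : u.V x = u.V y := by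
  have h := mul_left_cancel₀ b0 h
  rw [St.G, St.G, div_eq_div_iff (R.eV x hx) (R.eV y hy)] at h
  have k := R.k0
  rw [St.k] at k
  apply mul_left_cancel₀ k
  linear_combination -h

lemma EX.inj (E : EX c u) (X : FX c n u) : Set.InjOn u.U c.O := fun _ hx _ hy h =>
  E.injV X.reg hx hy (X.reg.U_inj' X.b0 hx hy h)

lemma FP.Ucj (f : FP c n θ u) (o : c.Ok) {x : ℂ} (hx : x ∈ c.O) : u.U (starRingEnd ℂ x) = starRingEnd ℂ (u.U x) := by
  rw [St.U, St.U, St.G, St.G]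
  have h1 := f.cV 1 o.mem1
  rw [map_one] at h1
  simp only [map_mul, map_div₀, map_sub, map_add, map_one, f.ce, f.cb, f.cV x hx, ← h1]

lemma real_O {t : ℝ} (h : t ∈ Set.Ioo (c.m - c.R) (c.m + c.R)) : (t:ℂ) ∈ c.O := by
  rw [Ctx.O, mem_ball, Complex.dist_of_im_eq (by simp)]
  simp only [Complex.ofReal_re]
  rw [Real.dist_eq, abs_lt]; constructor <;> linarith [h.1, h.2]

lemma real_I {t : ℝ} (h : (t:ℂ) ∈ c.O) : t ∈ Set.Ioo (c.m - c.R) (c.m + c.R) := by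
  rw [Ctx.O, mem_ball, Complex.dist_of_im_eq (by simp)] at h
  simp only [Complex.ofReal_re] at h
  rw [Real.dist_eq, abs_lt] at h; constructor <;> linarith [h.1, h.2]

lemma csq_real {t : ℝ} (h : 0 < t) : csq (t:ℂ) = (√t : ℝ) := by
  have h0 : 0 < (t:ℂ).re := h
  have e := csq_conj (t:ℂ)
  rw [Complex.conj_ofReal] at e
  have e' := Complex.conj_eq_iff_re.1 e.symm
  have p := csq_re h0
  have s := csq_sq h0
  rw [← e']
  congr 1
  rw [← e'] at s
  have s' : (csq (t:ℂ)).re ^ 2 = t := by exact_mod_cast s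
  rw [← s'] 
  rw [s', ← Real.sqrt_sq p.le, s']

theorem thmD (o : c.Ok) (f : FP c n θ u) (X : FX c n u) (E : EX c u) {F : ℂ → ℂ} {ρ : ℝ} (hρ : 1 < ρ)
    (hF : DifferentiableOn ℂ F (ball 0 ρ))
    (hc : ∀ w ∈ ball (0:ℂ) ρ, F (starRingEnd ℂ w) = starRingEnd ℂ (F w))
    (hU : ∀ y ∈ c.O, ‖u.U y‖ < ρ → F (u.U y) = y) :
    ∃ (lam r r' : ℝ) (f : ℂ → ℂ),
      0 < |lam| ∧ |lam| < 1 ∧ 0 < r' ∧ r' < r ∧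
      AnalyticOnNhd ℂ f (Metric.ball (0 : ℂ) r) ∧
      (∀ z : ℂ, f (starRingEnd ℂ z) = starRingEnd ℂ (f z)) ∧
      deriv f 0 = 0 ∧ iteratedDeriv 2 f 0 = 2 ∧
      (∀ z ∈ Metric.ball (0 : ℂ) r', ∀ k < n+2, f^[k] ((lam : ℂ) * z) ∈ Metric.ball (0 : ℂ) r) ∧
      (∀ z ∈ Metric.ball (0 : ℂ) r', f^[n+2] ((lam : ℂ) * z) = (lam : ℂ) * f z) ∧
      ∃ a b : ℝ, a < 0 ∧ 0 < b ∧ Set.Icc a b ⊆ Set.Ioo (-r) r ∧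
        (∀ k < n+2, (fun x : ℝ => (f (x : ℂ)).re)^[k] '' Set.Icc a b ⊆ Set.Ioo (-r) r) ∧
        (fun x : ℝ => (f (x : ℂ)).re)^[n+2] '' Set.Icc a b ⊆ Set.Icc a b ∧
        (∀ k₁ k₂ : ℕ, k₁ < k₂ → k₂ < n+2 →
          interior ((fun x : ℝ => (f (x : ℂ)).re)^[k₁] '' Set.Icc a b) ∩
            interior ((fun x : ℝ => (f (x : ℂ)).re)^[k₂] '' Set.Icc a b) = ∅) := by
  have hl : ((u.l.re : ℝ):ℂ) = u.l := Complex.conj_eq_iff_re.1 f.cl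
  have he : ((u.e.re : ℝ):ℂ) = u.e := Complex.conj_eq_iff_re.1 f.ce
  have hb : ((u.b.re : ℝ):ℂ) = u.b := Complex.conj_eq_iff_re.1 f.cb
  have hUr : ∀ t : ℝ, (t:ℂ) ∈ c.O → (((u.U t).re : ℝ):ℂ) = u.U t := fun t ht => by
    have := f.Ucj o ht
    rw [Complex.conj_ofReal] at this
    exact Complex.conj_eq_iff_re.1 this.symm
  have hVr : ∀ t : ℝ, (t:ℂ) ∈ c.O → (((u.V t).re : ℝ):ℂ) = u.V t := fun t ht => by
    have := f.cV _ ht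
    rw [Complex.conj_ofReal] at this
    exact Complex.conj_eq_iff_re.1 this.symm
  have m1 : ((1:ℝ):ℂ) ∈ c.O := by simpa using o.mem1
  have mono : ∀ s t : ℝ, (s:ℂ) ∈ c.O → (t:ℂ) ∈ c.O → s < t → (u.V s).re < (u.V t).re := fun s t hs ht hst => by
    obtain ⟨q, q1, hq⟩ := E.q
    have := V_sub X.reg.d hq ht hs
    have h2 := (Complex.abs_re_le_norm _).trans this
    rw [← Complex.ofReal_sub, Complex.norm_real, Real.norm_eq_abs, abs_of_pos (sub_pos.2 hst)] at h2
    simp only [Complex.sub_re, Complex.ofReal_re] at h2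
    have h3 := (abs_le.1 h2).1
    nlinarith
  have Ure : ∀ t : ℝ, (t:ℂ) ∈ c.O → (u.U t).re = u.b.re * (((u.V (1:ℝ)).re - (u.V t).re) / (1 + u.e.re * (u.V t).re)) := fun t ht => by
    have h1 := hVr 1 m1
    rw [Complex.ofReal_one] at h1
    have : u.U t = ((u.b.re * (((u.V (1:ℝ)).re - (u.V t).re) / (1 + u.e.re * (u.V t).re)) : ℝ):ℂ) := by
      rw [St.U, St.G]; push_cast
      rw [hb, he, hVr t ht, h1]
    rw [this, Complex.ofReal_re]
  have ep : ∀ t : ℝ, (t:ℂ) ∈ c.O → 0 < 1 + u.e.re * (u.V t).re := fun t ht => by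
    have := E.e _ ht
    rw [← he, ← hVr t ht] at this
    simpa using this
  have kp := ep 1 m1
  have anti : ∀ s t : ℝ, (s:ℂ) ∈ c.O → (t:ℂ) ∈ c.O → s < t → (u.U t).re < (u.U s).re := fun s t hs ht hst => by
    rw [Ure t ht, Ure s hs]
    apply mul_lt_mul_of_pos_left _ E.b
    rw [div_lt_div_iff₀ (ep t ht) (ep s hs)]
    have := mono s t hs ht hst
    nlinarith [mul_pos (sub_pos.2 this) kp]
  obtain ⟨l, hl'⟩ : ∃ l : ℝ, l = u.l.re := ⟨_, rfl⟩
  rw [← hl'] at hl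
  obtain ⟨v, hv⟩ : ∃ v : ℝ → ℝ, v = fun t : ℝ => (u.U t).re := ⟨_, rfl⟩
  have hv' : ∀ t : ℝ, v t = (u.U t).re := fun t => by rw [hv]
  obtain ⟨L, hL⟩ : ∃ L : ℝ → ℝ, L = fun t => -√(v t) := ⟨_, rfl⟩
  have hvU : ∀ t : ℝ, (t:ℂ) ∈ c.O → (v t : ℂ) = u.U t := fun t ht => by rw [hv']; exact hUr t ht
  have Y : ∀ x : ℝ, (x:ℂ) ∈ c.O → ∀ j ≤ n, u.y j (u.l * x) = (L^[j] (l * x) : ℝ) := by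
    intro x hx j
    induction j with
    | zero => intro _; simp [St.y, hl]
    | succ j ih =>
      intro hj
      have i := ih (by omega)
      have h1 := X.y x hx j (by omega)
      have h2 := X.re x hx j (by omega)
      rw [St.y, Function.iterate_succ_apply', Function.iterate_succ_apply']
      rw [St.y] at i
      rw [St.y, i] at h1 h2
      rw [i]
      rw [St.Lm]
      change -csq (u.U _) = _
      rw [← hvU _ h1, csq_real (by rw [hv']; exact h2)]; rw [← Complex.ofReal_neg]; congr 1; rw [hL]
  have rs : RS (c.m - c.R) (c.m + c.R) l n v (fun t => (F t).re) L := by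
    refine ⟨real_I (by simpa using o.mem0), real_I m1, ?_, ?_, ?_, ?_, ?_, ?_, ?_, ?_, ?_, ?_⟩
    · intro s hs t ht hst
      rw [hv', hv']; exact anti s t (real_O hs) (real_O ht) hst
    · intro t ht
      have h1 := (X.reg.U_deriv X.b0 (real_O ht)).1.continuousAt
      rw [hv]
      exact (Complex.continuous_re.continuousAt.comp (h1.comp Complex.continuous_ofReal.continuousAt)).continuousWithinAt
    · rw [hv']; simp [St.U, St.G]
    · rw [hl']; exact E.l1
    · intro y; rw [hL]
    · intro x hx j hj
      have hx := real_O hx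
      have h1 := X.y x hx j hj
      have h2 := X.re x hx j hj
      rw [Y x hx j hj] at h1 h2
      exact ⟨real_I h1, by rw [hv']; exact h2⟩
    · intro x hx
      have hx := real_O hx
      have h0 := X.y x hx n le_rfl
      have h1 := X.s x hx
      have h2 := X.s2 x hx
      have h3 := X.re x hx n le_rfl
      rw [Y x hx n le_rfl] at h0 h3
      rw [Y x hx n le_rfl, ← hvU _ h0, csq_real (by rw [hv']; exact h3)] at h1 h2
      refine ⟨real_I h1, ?_⟩
      rw [← hvU _ h1, ← hvU _ hx, ← hl] at h2
      exact_mod_cast h2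
    · have h1 := X.q
      have h2 := Y 1 m1 n le_rfl
      have h3 := X.y 1 o.mem1 n le_rfl
      simp only [Complex.ofReal_one, mul_one] at h2 h3
      rw [h2] at h1 h3
      rw [← hvU _ h3] at h1
      exact_mod_cast h1
    · rw [hv', hl']; exact E.ul
    · intro y hy h0 h1
      have hy := real_O hy
      rw [hvU y hy, hU y hy]
      · simp
      · rw [← hvU y hy, Complex.norm_real, Real.norm_eq_abs, abs_of_nonneg h0]; linarith
  refine thmC rs ?_ hρ hF hc (fun t => rfl) ?_
  · rintro rfl; exact X.l0 (by rw [← hl]; simp)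
  · intro h0
    have U1 : u.U 1 = 0 := by simp [St.U, St.G]
    have a1 := (X.reg.U_deriv X.b0 o.mem1).1
    have d1 : HasDerivAt F (deriv F 0) (u.U 1) := by
      rw [U1]; exact (hF.differentiableAt (isOpen_ball.mem_nhds (by simp; linarith))).hasDerivAt
    have d2 := HasDerivAt.comp (1:ℂ) d1 a1.differentiableAt.hasDerivAt
    have d3 : HasDerivAt (F ∘ u.U) 1 1 := by
      refine (hasDerivAt_id (1:ℂ)).congr_of_eventuallyEq ?_
      filter_upwards [c.O_open.mem_nhds o.mem1, a1.continuousAt.eventually_mem (isOpen_ball.mem_nhds (show u.U 1 ∈ ball (0:ℂ) ρ by rw [U1]; simp; linarith))] with y hy hy2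
      exact hU y hy (by simpa using hy2)
    have := d2.unique d3
    rw [h0, zero_mul] at this
    exact zero_ne_one this
end RN
end

section
open Metric Filter Topology
namespace RN
variable {c : Ctx} {u : St} {n : ℕ} {θ : ℝ}

noncomputable def St.F0 (u : St) (c : Ctx) : ℂ → ℂ := Function.invFunOn u.U c.O

lemma EX.F0_U (E : EX c u) (X : FX c n u) {y : ℂ} (hy : y ∈ c.O) : u.F0 c (u.U y) = y :=
  (E.inj X).leftInvOn_invFunOn hy

lemma EX.F0_diff (E : EX c u) (X : FX c n u) {y : ℂ} (hy : y ∈ c.O) : DifferentiableAt ℂ (u.F0 c) (u.U y) := by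
  obtain ⟨a, d⟩ := X.reg.U_deriv X.b0 hy
  have hs : HasStrictDerivAt u.U (deriv u.U y) y := a.hasStrictDerivAt
  have h1 := hs.to_localInverse d
  refine h1.hasDerivAt.differentiableAt.congr_of_eventuallyEq ?_
  have hs' := (hs.hasStrictFDerivAt_equiv d)
  have h2 := hs'.eventually_right_inverse
  have h3 := hs'.localInverse_continuousAt
  have h4 := hs'.localInverse_apply_image
  have h5 := h3.eventually_mem (c.O_open.mem_nhds (by rw [h4]; exact hy))
  filter_upwards [h2, h5] with w hw hO
  conv_lhs => rw [← hw]
  exact E.F0_U X hO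

lemma EX.F0_cj (E : EX c u) (X : FX c n u) (f : FP c n θ u) (o : c.Ok) {y : ℂ} (hy : y ∈ c.O) :
    u.F0 c (starRingEnd ℂ (u.U y)) = starRingEnd ℂ (u.F0 c (u.U y)) := by
  rw [← f.Ucj o hy, E.F0_U X (cj_O hy), E.F0_U X hy]

lemma Vq (o : c.Ok) (D : Dom c 1 u) {q : ℝ}
    (hq : c.ka * c.Mx^2 + (1 + c.ka * c.Mx^2) * (c.P * (c.Mx^2 * (1/2 + c.ka * c.Mx^2/4))) ≤ q) :
    ∀ x ∈ c.O, ‖deriv u.V x - 1‖ ≤ q := by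
  intro x hx
  have hx' := Ctx.norm_le_Mx hx
  have hP := o.P0
  have hka := o.ka0
  rw [Vd_eq o D.nrm (fun x hx => by simpa using D.hq x hx) hx]
  have h1 := u_bd o D.nrm (P := c.P) (fun x hx => by simpa using D.hq x hx) hx
  have h2 := o.v0_norm hx'
  have h3 := o.hv x hx'
  have e : c.v0 x * c.uu u.V x - 1 = c.v0 x * (c.uu u.V x - 1) + (c.v0 x - 1) := by ring
  rw [e]
  have k1 : c.ka * ‖x‖^2 ≤ c.ka * c.Mx^2 := o.kx hx'
  have k2 : c.P * (‖x‖^2 * (1/2 + c.ka * ‖x‖^2/4)) ≤ c.P * (c.Mx^2 * (1/2 + c.ka * c.Mx^2/4)) := by gcongr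
  refine (norm_add_le _ _).trans (le_trans ?_ hq)
  rw [norm_mul]
  have : ‖c.v0 x‖ * ‖c.uu u.V x - 1‖ ≤ (1 + c.ka * c.Mx^2) * (c.P * (c.Mx^2 * (1/2 + c.ka * c.Mx^2/4))) :=
    mul_le_mul (by linarith) (h1.trans k2) (norm_nonneg _) (by positivity)
  linarith

lemma mkEX (o : c.Ok) (f : FP c n θ u) (X : FX c n u) (D : Dom c 1 u) (k : 0 < u.k.re)
    (he : ∀ x ∈ c.O, 0 < (1 + u.e * u.V x).re) {q E Λ : ℝ}
    (hq : c.ka * c.Mx^2 + (1 + c.ka * c.Mx^2) * (c.P * (c.Mx^2 * (1/2 + c.ka * c.Mx^2/4))) ≤ q) (q1 : q < 1)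
    (hb : c.be < c.b0) (hE : |c.e0| + c.A ≤ E) (hΛ : |c.l0| + c.ep ≤ Λ) (hΛ1 : Λ < 1)
    (hs : Λ^2 * (1 + E * (1 + q) * Λ) < (c.b0 - c.be) * (1 - q) * (1 - Λ)) : EX c u := by
  have Hq := Vq o D hq
  have nl : ∀ {a : ℂ} {b r : ℝ}, ‖a - b‖ ≤ 1 * r → ‖a‖ ≤ |b| + r := fun {a b r} h => by
    have := norm_sub_norm_le a b
    rw [Complex.norm_real, Real.norm_eq_abs] at this; linarith
  have l1 : |u.l.re| ≤ Λ := (Complex.abs_re_le_norm _).trans ((nl D.hl).trans hΛ)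
  have b1 : c.b0 - c.be ≤ u.b.re := by
    have := (Complex.abs_re_le_norm _).trans D.hb
    simp only [Complex.sub_re, Complex.ofReal_re] at this
    linarith [(abs_le.1 this).1]
  have e1 : |u.e.re| ≤ E := (Complex.abs_re_le_norm _).trans ((nl D.he).trans hE)
  have he' : ((u.e.re : ℝ):ℂ) = u.e := Complex.conj_eq_iff_re.1 f.ce
  have hb' : ((u.b.re : ℝ):ℂ) = u.b := Complex.conj_eq_iff_re.1 f.cb
  have hVr : ∀ t : ℝ, (t:ℂ) ∈ c.O → (((u.V t).re : ℝ):ℂ) = u.V t := fun t ht => by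
    have := f.cV _ ht
    rw [Complex.conj_ofReal] at this
    exact Complex.conj_eq_iff_re.1 this.symm
  refine ⟨⟨q, q1, Hq⟩, k, he, by linarith, l1.trans_lt hΛ1, ?_⟩
  obtain ⟨t, ht⟩ : ∃ t, t = |u.l.re| := ⟨_, rfl⟩
  rw [← sq_abs, ← ht]
  rw [← ht] at l1
  have t0 : 0 ≤ t := by rw [ht]; exact abs_nonneg _
  have m1 : ((1:ℝ):ℂ) ∈ c.O := by simpa using o.mem1
  have m0 : ((0:ℝ):ℂ) ∈ c.O := by simpa using o.mem0
  have mt : (t:ℂ) ∈ c.O := real_O ⟨(real_I m0).1.trans_le t0, (by linarith : t < 1).trans (real_I m1).2⟩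
  have s1 := (Complex.abs_re_le_norm _).trans (V_sub X.reg.d Hq m1 mt)
  have s0 := (Complex.abs_re_le_norm _).trans (V_sub X.reg.d Hq mt m0)
  rw [← Complex.ofReal_sub, Complex.norm_real, Real.norm_eq_abs] at s1 s0
  rw [abs_of_nonneg (show 0 ≤ 1 - t by linarith)] at s1
  rw [abs_of_nonneg (show 0 ≤ t - 0 by linarith)] at s0
  have z0 : u.V ((0:ℝ):ℂ) = 0 := by simpa using D.nrm.z0
  rw [z0] at s0
  simp only [Complex.sub_re, Complex.ofReal_re, Complex.zero_re, sub_zero] at s1 s0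
  have s1 := (abs_le.1 s1).1
  have s0 := abs_le.1 s0
  have q0 : 0 ≤ q := (norm_nonneg _).trans (Hq 0 o.mem0)
  have ep := he _ mt
  have h1 := hVr 1 m1
  rw [Complex.ofReal_one] at h1
  have Ue : u.U t = ((u.b.re * (((u.V (1:ℝ)).re - (u.V t).re) / (1 + u.e.re * (u.V t).re)) : ℝ):ℂ) := by
    rw [St.U, St.G]; push_cast
    rw [hb', he', hVr t mt, h1]
  rw [Ue, Complex.ofReal_re]
  rw [← he', ← hVr t mt] at ep
  have ep' : 0 < 1 + u.e.re * (u.V t).re := by simpa using ep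
  have E0 : 0 ≤ E := (abs_nonneg _).trans e1
  have Va : |(u.V t).re| ≤ (1 + q) * t := abs_le.2 ⟨by nlinarith, by linarith⟩
  have eV : 1 + u.e.re * (u.V t).re ≤ 1 + E * (1+q) * Λ := by
    have h2 : u.e.re * (u.V t).re ≤ E * ((1 + q) * t) := (le_abs_self _).trans (by
      rw [abs_mul]; exact mul_le_mul e1 Va (abs_nonneg _) E0)
    have h3 : E * ((1 + q) * t) ≤ E * ((1 + q) * Λ) := by gcongr
    linarith
  rw [← mul_div_assoc, lt_div_iff₀ ep']
  have v1 : (1 - q) * (1 - Λ) ≤ (u.V (1:ℝ)).re - (u.V t).re := by nlinarith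
  calc t^2 * (1 + u.e.re * (u.V t).re) ≤ Λ^2 * (1 + E * (1 + q) * Λ) := by gcongr
    _ < (c.b0 - c.be) * (1 - q) * (1 - Λ) := hs
    _ ≤ _ := by
      rw [mul_assoc]
      have : 0 ≤ (1 - q) * (1 - Λ) := mul_nonneg (by linarith) (by linarith)
      exact mul_le_mul b1 v1 this (by linarith)
end RN
end

section
open Metric Filter Topology
namespace RN
variable {c : Ctx} {u : St} {n : ℕ} {θ : ℝ}

/-- the target statement -/
def Tgt (p : ℕ) : Prop :=
    ∃ (lam r r' : ℝ) (f : ℂ → ℂ),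
      0 < |lam| ∧ |lam| < 1 ∧ 0 < r' ∧ r' < r ∧
      AnalyticOnNhd ℂ f (Metric.ball (0 : ℂ) r) ∧
      (∀ z : ℂ, f (starRingEnd ℂ z) = starRingEnd ℂ (f z)) ∧
      deriv f 0 = 0 ∧ iteratedDeriv 2 f 0 = 2 ∧
      (∀ z ∈ Metric.ball (0 : ℂ) r', ∀ k < p, f^[k] ((lam : ℂ) * z) ∈ Metric.ball (0 : ℂ) r) ∧
      (∀ z ∈ Metric.ball (0 : ℂ) r', f^[p] ((lam : ℂ) * z) = (lam : ℂ) * f z) ∧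
      ∃ a b : ℝ, a < 0 ∧ 0 < b ∧ Set.Icc a b ⊆ Set.Ioo (-r) r ∧
        (∀ k < p, (fun x : ℝ => (f (x : ℂ)).re)^[k] '' Set.Icc a b ⊆ Set.Ioo (-r) r) ∧
        (fun x : ℝ => (f (x : ℂ)).re)^[p] '' Set.Icc a b ⊆ Set.Icc a b ∧
        (∀ k₁ k₂ : ℕ, k₁ < k₂ → k₂ < p →
          interior ((fun x : ℝ => (f (x : ℂ)).re)^[k₁] '' Set.Icc a b) ∩
            interior ((fun x : ℝ => (f (x : ℂ)).re)^[k₂] '' Set.Icc a b) = ∅)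

structure Pk (c : Ctx) (n : ℕ) (u : St) : Prop where
  ok : c.Ok
  fp : ∃ θ, FP c n θ u
  fx : FX c n u
  ex : EX c u
  dom : Dom c 1 u

lemma pack {p : Par} (h : p.ok) (hs : scal p) {n : ℕ} (hn : p.md = min n 2) (hc : chk p = true) {c : Ctx} (hcx : p.ctx = c) {q E Λ : ℝ}
    (hq : c.ka * c.Mx^2 + (1 + c.ka * c.Mx^2) * (c.P * (c.Mx^2 * (1/2 + c.ka * c.Mx^2/4))) ≤ q) (q1 : q < 1)
    (hb : c.be < c.b0) (hE : |c.e0| + c.A ≤ E) (hΛ : |c.l0| + c.ep ≤ Λ) (hΛ1 : Λ < 1)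
    (hsc : Λ^2 * (1 + E * (1 + q) * Λ) < (c.b0 - c.be) * (1 - q) * (1 - Λ)) : ∃ u, Pk c n u := by
  subst hcx
  have o := Par.Ok h
  have hs' := hs
  obtain ⟨-, -, -, -, -, -, -, -, t0, t1⟩ := hs'
  have k := K_pos
  have H : HA p.ctx n (p.th/K) := by
    refine ⟨o, fun u hu => (thmA h hs hn hc hu).1, fun u hu => (thmA h hs hn hc hu).2.1, ?_, ?_⟩
    · have : (0:ℝ) < p.th := by exact_mod_cast t0
      positivity
    · rw [div_lt_one k]; exact_mod_cast t1
  obtain ⟨u, f⟩ := thmB H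
  have D := f.dom.mono o H.t0.le H.t1.le
  have A := (thmA h hs hn hc D).2.2
  exact ⟨u, o, ⟨_, f⟩, f.fx H, mkEX o f (f.fx H) D A.1 A.2.1 hq q1 hb hE hΛ hΛ1 hsc, D⟩

lemma surj (P : Pk c n u) {m r ρ : ℝ} (hO : closedBall (m:ℂ) r ⊆ c.O) (h1 : |1 - m| < r) (hρ : 0 < ρ)
    (hs : ∀ x ∈ sphere (m:ℂ) r, ρ ≤ ‖u.U x‖) : ∀ w ∈ ball (0:ℂ) ρ, ∃ y ∈ c.O, u.U y = w := by
  have X := P.fx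
  have an : ∀ y ∈ c.O, AnalyticAt ℂ u.U y := fun y hy => (X.reg.U_deriv X.b0 hy).1
  have so : IsOpen (u.U '' ball (m:ℂ) r) := by
    rw [isOpen_iff_mem_nhds]
    rintro _ ⟨y, hy, rfl⟩
    obtain ⟨a, d⟩ := X.reg.U_deriv X.b0 (hO (ball_subset_closedBall hy))
    rw [← a.hasStrictDerivAt.map_nhds_eq d]
    exact image_mem_map (isOpen_ball.mem_nhds hy)
  have kc : IsClosed (u.U '' closedBall (m:ℂ) r) :=
    ((isCompact_closedBall _ _).image_of_continuousOn (fun y hy => (an y (hO hy)).continuousAt.continuousWithinAt)).isClosed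
  have := IsPreconnected.subset_left_of_subset_union so kc.isOpen_compl ?_ ?_ ?_ (convex_ball (0:ℂ) ρ).isPreconnected
  · intro w hw
    obtain ⟨y, hy, e⟩ := this hw
    exact ⟨y, hO (ball_subset_closedBall hy), e⟩
  · rw [Set.disjoint_compl_right_iff_subset]
    exact Set.image_mono ball_subset_closedBall
  · intro w hw
    by_cases h : w ∈ u.U '' closedBall (m:ℂ) r
    · left
      obtain ⟨y, hy, rfl⟩ := h
      rcases (mem_closedBall.1 hy).lt_or_eq with h | h
      · exact ⟨y, h, rfl⟩
      · have := hs y h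
        rw [mem_ball_zero_iff] at hw; linarith
    · right; exact h
  · refine ⟨0, by simpa using hρ, 1, ?_, by simp [St.U, St.G]⟩
    rw [mem_ball, Complex.dist_of_im_eq (by simp)]
    simpa [Real.dist_eq] using h1

theorem thmE (P : Pk c n u) {ρ : ℝ} (hρ : 1 < ρ) (hs : ∀ w ∈ ball (0:ℂ) ρ, ∃ y ∈ c.O, u.U y = w) : Tgt (n+2) := by
  obtain ⟨θ, f⟩ := P.fp
  refine thmD P.ok f P.fx P.ex hρ (F := u.F0 c) ?_ ?_ ?_
  · intro w hw
    obtain ⟨y, hy, rfl⟩ := hs w hw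
    exact (P.ex.F0_diff P.fx hy).differentiableWithinAt
  · intro w hw
    obtain ⟨y, hy, rfl⟩ := hs w hw
    exact P.ex.F0_cj P.fx f P.ok hy
  · intro y hy _; exact P.ex.F0_U P.fx hy

lemma sph (P : Pk c n u) (hV : ∀ x, c.V0 x = x) (ka : c.ka = 0) {E s d ρ : ℝ} (hE : |c.e0| + c.A ≤ E)
    (hb : c.be < c.b0) {x : ℂ} (hx : x ∈ c.O) (xs : ‖x‖ ≤ s) (xd : d ≤ ‖x - 1‖) (ρ0 : 0 < ρ)
    (h : ρ * (1 + E * (s + c.P * s^3/6)) ≤ (c.b0 - c.be) * (d - c.P * (1 + s^3)/6)) : ρ ≤ ‖u.U x‖ := by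
  have D := P.dom
  have P0 := P.ok.P0
  have s0 : 0 ≤ s := (norm_nonneg _).trans xs
  have vb : ∀ x ∈ c.O, ‖u.V x - x‖ ≤ c.P * ‖x‖^3 / 6 := fun x hx => by
    have := V_bd P.ok D.nrm (P := c.P) (fun x hx => by simpa using D.hq x hx) P0.le hx
    rw [hV, ka] at this
    refine this.trans (le_of_eq ?_); ring
  have e1 : ‖u.e‖ ≤ E := by
    have := norm_sub_norm_le u.e c.e0
    rw [Complex.norm_real, Real.norm_eq_abs] at this
    linarith [D.he]
  have b1 : c.b0 - c.be ≤ ‖u.b‖ := by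
    have h1 := norm_sub_norm_le (c.b0:ℂ) u.b
    rw [Complex.norm_real, Real.norm_eq_abs, norm_sub_rev] at h1
    linarith [D.hb, le_abs_self c.b0]
  have v1 := vb 1 P.ok.mem1
  have vx := vb x hx
  have x3 : ‖x‖^3 ≤ s^3 := pow_le_pow_left₀ (norm_nonneg _) xs 3
  have x4 : c.P * ‖x‖^3/6 ≤ c.P * s^3/6 := by gcongr
  rw [norm_one, one_pow, mul_one] at v1
  have dn : ‖1 + u.e * u.V x‖ ≤ 1 + E * (s + c.P * s^3/6) := by
    refine (norm_add_le _ _).trans ?_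
    rw [norm_one, norm_mul]
    have : ‖u.V x‖ ≤ s + c.P * s^3/6 := by
      have := norm_sub_norm_le (u.V x) x
      linarith
    have : ‖u.e‖ * ‖u.V x‖ ≤ E * (s + c.P * s^3/6) := mul_le_mul e1 this (norm_nonneg _) ((norm_nonneg _).trans e1)
    linarith
  have nm : d - c.P * (1 + s^3)/6 ≤ ‖u.V 1 - u.V x‖ := by
    have e : x - 1 = (u.V 1 - 1) - (u.V x - x) - (u.V 1 - u.V x) := by ring
    have h1 := norm_sub_le ((u.V 1 - 1) - (u.V x - x)) (u.V 1 - u.V x)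
    rw [← e] at h1
    have h2 := norm_sub_le (u.V 1 - 1) (u.V x - x)
    linarith
  rw [St.U, St.G, norm_mul, norm_div, ← mul_div_assoc, le_div_iff₀ (norm_pos_iff.2 (P.fx.reg.eV x hx))]
  have B0 : 0 < c.b0 - c.be := by linarith
  calc ρ * ‖1 + u.e * u.V x‖ ≤ ρ * (1 + E * (s + c.P * s^3/6)) := by gcongr
    _ ≤ _ := h
    _ ≤ (c.b0 - c.be) * ‖u.V 1 - u.V x‖ := by gcongr
    _ ≤ _ := by gcongr

theorem tgt4 (n : ℕ) (hn : 2 ≤ n) : Tgt (n + 2) := by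
  obtain ⟨c, hc⟩ : ∃ c, P4.ctx = c := ⟨_, rfl⟩
  have hc' := hc
  unfold P4 Par.ctx K at hc'
  push_cast at hc'
  have e1 : c.be < c.b0 := by rw [← hc']; norm_num
  have e2 : |c.e0| + c.A ≤ 0.0201 := by rw [← hc']; norm_num
  have e3 : c.ka = 0 := by rw [← hc']; norm_num
  have e4 : c.R ≤ 2.5 ∧ 2.495 ≤ c.R := by rw [← hc']; norm_num
  have e5 : c.m = 1 := by rw [← hc']; norm_num
  have e6 : 0 ≤ c.P ∧ c.P ≤ 0.0031 := by rw [← hc']; norm_num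
  have e7 : |c.l0| + c.ep ≤ 0.05 := by rw [← hc']; norm_num
  have e8 : 0.4419 ≤ c.b0 - c.be := by rw [← hc']; norm_num
  have hV : ∀ x, c.V0 x = x := fun x => by
    rw [← hc]; simp [P4, Par.ctx, ev, K]
  obtain ⟨u, P⟩ := pack (n := n) P4_ok P4_scal (by simp [P4, hn]) P4_chk hc (q := 0.1) (E := 0.0201) (Λ := 0.05)
    (by
      have : c.Mx ≤ 3.5 := by rw [Ctx.Mx, e5]; norm_num; linarith
      have h0 : 0 ≤ c.Mx := by rw [Ctx.Mx, e5]; norm_num; linarith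
      rw [e3]
      have h2 : c.Mx^2 ≤ 3.5^2 := pow_le_pow_left₀ h0 this 2
      have : c.P * c.Mx^2 ≤ 0.0031 * 3.5^2 := mul_le_mul e6.2 h2 (by positivity) (by norm_num)
      nlinarith) (by norm_num) e1 e2 e7 (by norm_num) (by nlinarith)
  refine thmE P (ρ := 1.001) (by norm_num) (surj P (m := 1) (r := 2.49) ?_ (by norm_num) (by norm_num) ?_)
  · rw [Ctx.O, e5]; exact closedBall_subset_ball (by linarith)
  · intro x hx
    rw [mem_sphere, dist_eq_norm, Complex.ofReal_one] at hx
    refine sph P hV e3 e2 e1 (s := 3.49) (d := 2.49) ?_ ?_ hx.ge (by norm_num) ?_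
    · rw [Ctx.O, e5, mem_ball, dist_eq_norm, Complex.ofReal_one, hx]; linarith
    · have := norm_sub_norm_le x 1
      rw [norm_one, hx] at this; linarith
    · nlinarith
end RN
end

section
open Metric Filter Topology
namespace RN

theorem tgt3 : Tgt (1 + 2) := by
  obtain ⟨c, hc⟩ : ∃ c, P3.ctx = c := ⟨_, rfl⟩
  have hc' := hc
  unfold P3 Par.ctx K at hc'
  push_cast at hc'
  have e1 : c.be < c.b0 := by rw [← hc']; norm_num
  have e2 : |c.e0| + c.A ≤ 0.042001 := by rw [← hc', abs_of_nonneg] <;> norm_num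
  have e3 : c.ka = 0 := by rw [← hc']; norm_num
  have e4 : c.R ≤ 2.4 ∧ 2.39999 ≤ c.R := by rw [← hc']; norm_num
  have e5 : |1.05 - c.m| ≤ 0.00001 := by rw [← hc', abs_le]; norm_num
  have e6 : 0 ≤ c.P ∧ c.P ≤ 0.025001 := by rw [← hc']; norm_num
  have e7 : |c.l0| + c.ep ≤ 0.14 := by rw [← hc', abs_of_nonpos] <;> norm_num
  have e8 : 0.51499 ≤ c.b0 - c.be := by rw [← hc']; norm_num
  have hV : ∀ x, c.V0 x = x := fun x => by
    rw [← hc]; simp [P3, Par.ctx, ev, K]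
  have m5 := abs_le.1 e5
  obtain ⟨u, P⟩ := pack (n := 1) P3_ok P3_scal (by simp [P3]) P3_chk hc (q := 0.2) (E := 0.042001) (Λ := 0.14)
    (by
      have m0 : |c.m| = c.m := abs_of_pos (by linarith)
      have : c.Mx ≤ 3.46 := by rw [Ctx.Mx, m0]; linarith
      have h0 : 0 ≤ c.Mx := by rw [Ctx.Mx, m0]; linarith
      rw [e3]
      have h2 : c.Mx^2 ≤ 3.46^2 := pow_le_pow_left₀ h0 this 2
      have : c.P * c.Mx^2 ≤ 0.025001 * 3.46^2 := mul_le_mul e6.2 h2 (by positivity) (by norm_num)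
      nlinarith) (by norm_num) e1 e2 e7 (by norm_num) (by nlinarith)
  have dm : dist ((1.05:ℝ):ℂ) (c.m:ℂ) ≤ 0.00001 := by
    rw [Complex.dist_of_im_eq (by simp)]; simpa [Real.dist_eq] using e5
  have hO : closedBall ((1.05:ℝ):ℂ) 2.398 ⊆ c.O := by
    intro x hx
    rw [Ctx.O, mem_ball]
    have := dist_triangle x ((1.05:ℝ):ℂ) (c.m:ℂ)
    rw [mem_closedBall] at hx
    linarith
  refine thmE P (ρ := 1.001) (by norm_num) (surj P (m := 1.05) (r := 2.398) hO (by rw [abs_lt]; norm_num) (by norm_num) ?_)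
  intro x hx
  have hxO := hO (sphere_subset_closedBall hx)
  rw [mem_sphere, dist_eq_norm] at hx
  have q1 : (x.re - 1.05)^2 + x.im^2 = 2.398^2 := by
    rw [← hx, Complex.sq_norm, Complex.normSq_apply]; simp; ring
  have q2 : ‖x‖^2 = x.re^2 + x.im^2 := by
    rw [Complex.sq_norm, Complex.normSq_apply]; ring
  have q3 : ‖x - 1‖^2 = (x.re-1)^2 + x.im^2 := by
    rw [Complex.sq_norm, Complex.normSq_apply]; simp; ring
  have τ : -2.398 ≤ x.re - 1.05 ∧ x.re - 1.05 ≤ 2.398 := abs_le.1 (abs_le_of_sq_le_sq (by nlinarith [sq_nonneg x.im]) (by norm_num))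
  rcases le_total (x.re - 1.05) 1.2 with h | h
  · refine sph P hV e3 e2 e1 (s := 3.062) (d := 2.347) hxO ?_ ?_ (by norm_num) ?_
    · exact le_of_sq_le_sq (by linarith) (by norm_num)
    · exact le_of_sq_le_sq (by linarith) (norm_nonneg _)
    · obtain ⟨p0, p1⟩ := e6
      calc (1.001:ℝ) * (1 + 0.042001 * (3.062 + c.P * 3.062^3/6)) ≤ 1.001 * (1 + 0.042001 * (3.062 + 0.025001 * 3.062^3/6)) := by gcongr
        _ ≤ 0.51499 * (2.347 - 0.025001 * (1 + 3.062^3)/6) := by norm_num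
        _ ≤ (c.b0 - c.be) * (2.347 - c.P * (1 + 3.062^3)/6) := by gcongr
  · refine sph P hV e3 e2 e1 (s := 3.448) (d := 2.423) hxO ?_ ?_ (by norm_num) ?_
    · exact le_of_sq_le_sq (by linarith) (by norm_num)
    · exact le_of_sq_le_sq (by linarith) (norm_nonneg _)
    · obtain ⟨p0, p1⟩ := e6
      calc (1.001:ℝ) * (1 + 0.042001 * (3.448 + c.P * 3.448^3/6)) ≤ 1.001 * (1 + 0.042001 * (3.448 + 0.025001 * 3.448^3/6)) := by gcongr
        _ ≤ 0.51499 * (2.423 - 0.025001 * (1 + 3.448^3)/6) := by norm_num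
        _ ≤ (c.b0 - c.be) * (2.423 - c.P * (1 + 3.448^3)/6) := by gcongr
end RN
end

section
open Metric Filter Topology
namespace RN
def nf (p : Par) (one W : D) (a c r : ℤ) : Bool :=
  (D.mk c 0 r).inn p.m (p.R-1) && (decide (0 < a ∧ 0 ≤ r) &&
  ((W.mul p.bD.inv).bd fun w => ((D.of K).add (p.eD.mul w)).bd fun dn => dn.pos &&
  inp p (D.mk c 0 r) fun _ V' _ _ => inp p (D.of c) fun Vc _ _ _ =>
  match ((D.of K).sub ((D.of a).mul V')).mag with
  | none => false
  | some L => match ((D.of a).mul (((one.sub w).mul dn.inv).sub Vc)).mag with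
    | none => false
    | some M => decide (L < K ∧ M + mu L r ≤ r)))

def nf3 (p : Par) (ρ a1 c1 r1 a2 c2 r2 a3 c3 r3 : ℤ) : Bool :=
  (D.of K).inn p.m (p.R-1) && inp p (D.of K) fun one _ _ _ => (p.lD.mul p.lD).bd fun l2 =>
  nf p one (l2.mul (D.mk 0 0 ρ)) a1 c1 r1 &&
  (nf p one (l2.mul ((D.mk c1 0 r1).mul (D.mk c1 0 r1))) a2 c2 r2 &&
   nf p one ((D.mk c2 0 r2).mul (D.mk c2 0 r2)) a3 c3 r3)
end RN
end

section
open Metric Filter Topology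
namespace RN

lemma mem_ofK (a : ℤ) : (D.of a).mem ((a:ℂ)/K) := mem_of _ (by have := Kc; field_simp)

lemma fixpt {N N' : ℂ → ℂ} {c : ℂ} {r L : ℝ} (r0 : 0 ≤ r) (L1 : L < 1)
    (hd : ∀ x ∈ closedBall c r, HasDerivAt N (N' x) x) (hL : ∀ x ∈ closedBall c r, ‖N' x‖ ≤ L)
    (hM : ‖N c - c‖ + L * r ≤ r) : ∃ x ∈ closedBall c r, N x = x := by
  have mc : c ∈ closedBall c r := mem_closedBall_self r0
  have L0 : 0 ≤ L := (norm_nonneg _).trans (hL c mc)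
  have lip : ∀ x ∈ closedBall c r, ∀ y ∈ closedBall c r, ‖N y - N x‖ ≤ L * ‖y - x‖ := fun x hx y hy =>
    (convex_closedBall c r).norm_image_sub_le_of_norm_hasDerivWithin_le (fun z hz => (hd z hz).hasDerivWithinAt) hL hx hy
  have mt : Set.MapsTo N (closedBall c r) (closedBall c r) := fun x hx => by
    have h1 := lip c mc x hx
    rw [mem_closedBall, dist_eq_norm] at hx ⊢
    have e : N x - c = (N x - N c) + (N c - c) := by ring
    rw [e]
    have := norm_add_le (N x - N c) (N c - c)
    have : L * ‖x - c‖ ≤ L * r := by gcongr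
    linarith
  have cw : ContractingWith ⟨L, L0⟩ (mt.restrict N _ _) := by
    refine ⟨by exact_mod_cast L1, LipschitzWith.of_dist_le_mul ?_⟩
    rintro ⟨x, hx⟩ ⟨y, hy⟩
    have := lip y hy x hx
    rw [← dist_eq_norm, ← dist_eq_norm] at this
    exact this
  have : Nonempty (closedBall c r) := ⟨⟨c, mc⟩⟩
  have : CompleteSpace (closedBall c r) := isClosed_closedBall.isComplete.completeSpace_coe
  have := cw.fixedPoint_isFixedPt
  exact ⟨_, (ContractingWith.fixedPoint _ cw).2, congrArg Subtype.val this⟩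

lemma nf_spec {p : Par} (h : p.ok) {u : St} (hu : Dom p.ctx 1 u) (R : Reg p.ctx u) (hb : u.b ≠ 0) {one W : D} {a c r : ℤ}
    (hn : nf p one W a c r = true) (h1 : one.mem (u.V 1)) {w : ℂ} (hw : W.mem w) :
    ∃ x ∈ p.ctx.O, (D.mk c 0 r).mem x ∧ u.U x = w := by
  unfold nf at hn
  simp only [D.bd_eq, Bool.and_eq_true, decide_eq_true_eq] at hn
  obtain ⟨hin, ⟨a0, r0⟩, dp, hi⟩ := hn
  obtain ⟨V, V', N, S, hi, sp⟩ := inp_spec h hi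
  obtain ⟨Vc, _, _, _, hi, sc⟩ := inp_spec h hi
  split at hi
  · simp at hi
  rename_i L hL
  split at hi
  · simp at hi
  rename_i M hM
  simp only [decide_eq_true_eq] at hi
  have k := K_pos
  have hwb := mem_mul hw (mem_inv (mem_bD hu))
  have hdn := mem_add mem_one (mem_mul (mem_eD hu) hwb)
  have dn0 : 1 + u.e * (w * u.b⁻¹) ≠ 0 := fun h0 => by
    have := pos_spec dp hdn
    rw [h0] at this; simp at this
  have inO : ∀ x ∈ closedBall ((c:ℂ)/K) ((r:ℝ)/K), (D.mk c 0 r).mem x ∧ x ∈ p.ctx.O := fun x hx => by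
    have hm : (D.mk c 0 r).mem x := mem_mk (by rw [← dist_eq_norm]; exact hx)
    exact ⟨hm, O_of (inn_spec hin hm)⟩
  have rK : 0 ≤ (r:ℝ)/K := div_nonneg (by exact_mod_cast r0) k.le
  have cO := (inO _ (mem_closedBall_self rK)).2
  obtain ⟨t, ht⟩ : ∃ t, t = (u.V 1 - w * u.b⁻¹) * (1 + u.e * (w * u.b⁻¹))⁻¹ := ⟨_, rfl⟩
  have tm := mem_mul (mem_sub h1 hwb) (mem_inv hdn)
  rw [← ht] at tm
  have Mb := mag_spec hM (mem_mul (mem_ofK a) (mem_sub tm (sc hu cO (mem_ofK c)).1))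
  obtain ⟨x, hx, e⟩ := fixpt (N := fun x => x + (a:ℂ)/K * (t - u.V x)) (N' := fun x => 1 - (a:ℂ)/K * deriv u.V x)
    (c := (c:ℂ)/K) (r := (r:ℝ)/K) (L := (L:ℝ)/K) rK
    (by rw [div_lt_one k]; exact_mod_cast hi.1)
    (fun x hx => by
      have d : HasDerivAt u.V (deriv u.V x) x := (R.d.differentiableAt (p.ctx.O_open.mem_nhds (inO x hx).2)).hasDerivAt
      have := (hasDerivAt_id x).add (((hasDerivAt_const x t).sub d).const_mul ((a:ℂ)/K))
      exact this.congr_deriv (by ring))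
    (fun x hx => by
      obtain ⟨m, o⟩ := inO x hx
      have := mag_spec hL (mem_sub mem_one (mem_mul (mem_ofK a) (sp hu o m).2.1))
      rw [le_div_iff₀ k, mul_comm]; exact this)
    (by
      simp only [add_sub_cancel_left]
      have L0 : (0:ℝ) ≤ L := by
        obtain ⟨m, o⟩ := inO _ (mem_closedBall_self rK)
        have := mag_spec hL (mem_sub mem_one (mem_mul (mem_ofK a) (sp hu o m).2.1))
        exact le_trans (by positivity) this
      have := mu_spec (div_nonneg L0 k.le) rK (KK L).le (KK r).le
      have h2 : ((M + mu L r : ℤ):ℝ) ≤ r := by exact_mod_cast hi.2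
      push_cast at h2
      rw [le_div_iff₀ k]
      linarith)
  obtain ⟨m, o⟩ := inO x hx
  refine ⟨x, o, m, ?_⟩
  have ak : (a:ℂ)/K ≠ 0 := div_ne_zero (by exact_mod_cast a0.ne') Kc
  have e2 : u.V x = t := by
    have : (a:ℂ)/K * (t - u.V x) = 0 := by simpa using e
    rcases mul_eq_zero.1 this with h | h
    · exact absurd h ak
    · exact (sub_eq_zero.1 h).symm
  have ev := R.eV x o
  have e3 : t * (1 + u.e * (w * u.b⁻¹)) = u.V 1 - w * u.b⁻¹ := by
    rw [ht, mul_assoc, inv_mul_cancel₀ dn0, mul_one]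
  rw [St.U, St.G, e2]
  rw [e2] at ev
  have e4 : u.V 1 - t = w * u.b⁻¹ * (1 + u.e * t) := by linear_combination -e3
  rw [e4, mul_div_assoc, div_self ev, mul_one]
  field_simp
end RN
end

section
open Metric Filter Topology
namespace RN
variable {c : Ctx} {u : St} {θ : ℝ}

/-- extension by the functional equation -/
noncomputable def St.F3 (u : St) (c : Ctx) (w : ℂ) : ℂ :=
  (u.l^2)⁻¹ * u.F0 c ((u.F0 c (u.l^2 * (u.F0 c (u.l^2 * w))^2))^2)

theorem thmE2 (P : Pk c 0 u) {ρ : ℝ} (hρ : 1 < ρ)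
    (hs : ∀ w ∈ ball (0:ℂ) ρ, ∃ x1 ∈ c.O, ∃ x2 ∈ c.O, ∃ x3 ∈ c.O, u.U x1 = u.l^2 * w ∧ u.U x2 = u.l^2 * x1^2 ∧ u.U x3 = x2^2) :
    Tgt (0+2) := by
  obtain ⟨θ, f⟩ := P.fp
  have X := P.fx
  have E := P.ex
  refine thmD P.ok f X E hρ (F := u.F3 c) ?_ ?_ ?_
  · intro w hw
    obtain ⟨x1, h1, x2, h2, x3, h3, e1, e2, e3⟩ := hs w hw
    have f1 := E.F0_U X h1
    have f2 := E.F0_U X h2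
    have d1 := E.F0_diff X h1
    have d2 := E.F0_diff X h2
    have d3 := E.F0_diff X h3
    rw [e1] at f1 d1
    rw [e2] at f2 d2
    rw [e3] at d3
    have g1 : DifferentiableAt ℂ (fun w => u.F0 c (u.l^2 * w)) w :=
      DifferentiableAt.comp (g := u.F0 c) (f := fun w => u.l^2 * w) w d1 (by fun_prop)
    have g2 : DifferentiableAt ℂ (fun w => u.F0 c (u.l^2 * (u.F0 c (u.l^2 * w))^2)) w :=
      DifferentiableAt.comp (g := u.F0 c) (f := fun w => u.l^2 * (u.F0 c (u.l^2 * w))^2) w (by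
        simpa only [f1] using d2) ((g1.pow 2).const_mul _)
    have g3 : DifferentiableAt ℂ (fun w => u.F0 c ((u.F0 c (u.l^2 * (u.F0 c (u.l^2 * w))^2))^2)) w :=
      DifferentiableAt.comp (g := u.F0 c) (f := fun w => (u.F0 c (u.l^2 * (u.F0 c (u.l^2 * w))^2))^2) w (by
        simpa only [f1, f2] using d3) (g2.pow 2)
    exact (g3.const_mul _).differentiableWithinAt
  · intro w hw
    obtain ⟨x1, h1, x2, h2, x3, h3, e1, e2, e3⟩ := hs w hw
    have f1 := E.F0_U X h1
    have f2 := E.F0_U X h2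
    have f3 := E.F0_U X h3
    have c1 := E.F0_cj X f P.ok h1
    have c2 := E.F0_cj X f P.ok h2
    have c3 := E.F0_cj X f P.ok h3
    rw [f1, e1, map_mul, map_pow, f.cl] at c1
    rw [f2, e2, map_mul, map_pow, map_pow, f.cl] at c2
    rw [f3, e3, map_pow] at c3
    rw [e1] at f1
    rw [e2] at f2
    rw [e3] at f3
    rw [St.F3, St.F3, c1, c2, c3, f1, f2, f3, map_mul, map_inv₀, map_pow, f.cl]
  · intro y hy _
    have y0 : ∀ z, u.y 0 z = z := fun z => by simp [St.y]
    have ly := X.y y hy 0 le_rfl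
    have lly := X.y _ ly 0 le_rfl
    have r1 := X.re y hy 0 le_rfl
    have r2 := X.re _ ly 0 le_rfl
    have s1 := X.s y hy
    have s2 := X.s _ ly
    have t1 := X.s2 y hy
    have t2 := X.s2 _ ly
    simp only [y0] at ly lly r1 r2 s1 s2 t1 t2
    rw [St.F3, ← t1, E.F0_U X s1, csq_sq r1, ← t2, E.F0_U X s2, csq_sq r2, E.F0_U X lly]
    have := X.l0
    field_simp

lemma P2_nf : nf3 P2 1100611139403 1044536046387 1099511627776 324355930193 1066526278942 824633720832 252887674388 1099511627776 197912092999 714682558054 = true := by decide +kernel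

theorem tgt2 : Tgt (0 + 2) := by
  obtain ⟨c, hc⟩ : ∃ c, P2.ctx = c := ⟨_, rfl⟩
  have hc' := hc
  unfold P2 Par.ctx K at hc'
  push_cast at hc'
  have e1 : c.be < c.b0 := by rw [← hc']; norm_num
  have e2 : |c.e0| + c.A ≤ 0.09 := by rw [← hc', abs_of_nonneg] <;> norm_num
  have e3 : 0 ≤ c.ka ∧ c.ka ≤ 0.0635 := by rw [← hc']; norm_num
  have e4 : 0 ≤ c.Mx ∧ c.Mx ≤ 1.3001 := by rw [Ctx.Mx, ← hc', abs_of_nonneg] <;> norm_num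
  have e6 : 0 ≤ c.P ∧ c.P ≤ 0.02201 := by rw [← hc']; norm_num
  have e7 : |c.l0| + c.ep ≤ 0.41 := by rw [← hc', abs_of_nonpos] <;> norm_num
  have e8 : 0.672 ≤ c.b0 - c.be := by rw [← hc']; norm_num
  obtain ⟨u, P⟩ := pack (n := 0) P2_ok P2_scal (by simp [P2]) P2_chk hc (q := 0.14) (E := 0.09) (Λ := 0.41)
    (by
      obtain ⟨k0, k1⟩ := e3
      obtain ⟨m0, m1⟩ := e4
      obtain ⟨p0, p1⟩ := e6
      calc c.ka * c.Mx^2 + (1 + c.ka * c.Mx^2) * (c.P * (c.Mx^2 * (1/2 + c.ka * c.Mx^2/4)))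
          ≤ 0.0635 * 1.3001^2 + (1 + 0.0635 * 1.3001^2) * (0.02201 * (1.3001^2 * (1/2 + 0.0635 * 1.3001^2/4))) := by gcongr
        _ ≤ 0.14 := by norm_num) (by norm_num) e1 e2 e7 (by norm_num) (by nlinarith)
  subst hc
  have nf := P2_nf
  unfold nf3 at nf
  simp only [Bool.and_eq_true] at nf
  obtain ⟨h1, nf⟩ := nf
  obtain ⟨one, _, _, _, nf, so⟩ := inp_spec P2_ok nf
  simp only [D.bd_eq, Bool.and_eq_true] at nf
  obtain ⟨n1, n2, n3⟩ := nf
  have m1 := (so P.dom (O_of (inn_spec h1 mem_one)) mem_one).1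
  have l2 := mem_mul (mem_lD P.dom) (mem_lD P.dom)
  have X := P.fx
  refine thmE2 P (ρ := 1.0009) (by norm_num) ?_
  intro w hw
  rw [mem_ball_zero_iff] at hw
  have wm : (D.mk 0 0 1100611139403).mem w := mem_mk (by
    simp only [Int.cast_zero, zero_div, sub_zero]
    refine hw.le.trans ?_
    norm_num [K])
  obtain ⟨x1, o1, q1, u1⟩ := nf_spec P2_ok P.dom X.reg X.b0 n1 m1 (mem_mul l2 wm)
  obtain ⟨x2, o2, q2, u2⟩ := nf_spec P2_ok P.dom X.reg X.b0 n2 m1 (mem_mul l2 (mem_mul q1 q1))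
  obtain ⟨x3, o3, q3, u3⟩ := nf_spec P2_ok P.dom X.reg X.b0 n3 m1 (mem_mul q2 q2)
  exact ⟨x1, o1, x2, o2, x3, o3, by rw [u1]; ring, by rw [u2]; ring, by rw [u3]; ring⟩
end RN
end


open Metric

/-- **Existence of periodic points of the renormalization operator** (concrete
Cvitanović–Feigenbaum functional-equation form).  For every period `p ≥ 2` there exist
`λ` with `0 < |λ| < 1`, radii `r > r' > 0`, and a complex analytic function `f` on the disk
`D_r`, commuting with complex conjugation (hence real on `ℝ`), normalized so that
`f(z) = f(0) + z² + O(z³)`, such that for `z ∈ D_{r'}` the points `λz, f(λz), …, f^{p-1}(λz)`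
stay in `D_r` and `f^p(λz) = λ f(z)`; moreover there is a nondegenerate closed interval
`J ⊆ D_r ∩ ℝ` with `0` in its interior such that `f^p(J) ⊆ J` and `J, f(J), …, f^{p-1}(J)`
lie in `D_r ∩ ℝ` and have pairwise disjoint interiors. -/
theorem renormalization_periodic_point (p : ℕ) (hp : 2 ≤ p) :
    ∃ (lam r r' : ℝ) (f : ℂ → ℂ),
      0 < |lam| ∧ |lam| < 1 ∧ 0 < r' ∧ r' < r ∧
      AnalyticOnNhd ℂ f (Metric.ball (0 : ℂ) r) ∧
      (∀ z : ℂ, f (starRingEnd ℂ z) = starRingEnd ℂ (f z)) ∧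
      deriv f 0 = 0 ∧ iteratedDeriv 2 f 0 = 2 ∧
      (∀ z ∈ Metric.ball (0 : ℂ) r', ∀ k < p, f^[k] ((lam : ℂ) * z) ∈ Metric.ball (0 : ℂ) r) ∧
      (∀ z ∈ Metric.ball (0 : ℂ) r', f^[p] ((lam : ℂ) * z) = (lam : ℂ) * f z) ∧
      ∃ a b : ℝ, a < 0 ∧ 0 < b ∧ Set.Icc a b ⊆ Set.Ioo (-r) r ∧
        (∀ k < p, (fun x : ℝ => (f (x : ℂ)).re)^[k] '' Set.Icc a b ⊆ Set.Ioo (-r) r) ∧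
        (fun x : ℝ => (f (x : ℂ)).re)^[p] '' Set.Icc a b ⊆ Set.Icc a b ∧
        (∀ k₁ k₂ : ℕ, k₁ < k₂ → k₂ < p →
          interior ((fun x : ℝ => (f (x : ℂ)).re)^[k₁] '' Set.Icc a b) ∩
            interior ((fun x : ℝ => (f (x : ℂ)).re)^[k₂] '' Set.Icc a b) = ∅) := by
  obtain ⟨n, rfl⟩ : ∃ n, p = n + 2 := ⟨p - 2, by omega⟩
  rcases n with _ | _ | n
  · exact RN.tgt2
  · exact RN.tgt3
  · exact RN.tgt4 (n + 1 + 1) (by omega)
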